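/- For every positive integer λ, the series P_{u,λ} := Σ_{n ≥ 1, gcd(n,a₂)=1} ρ_λ(n)/φ(ℓ(n)) (sum over positive integers n coprime to a₂) converges to a positive real number, and for every A > 0 there is a constant C = C(a₁, a₂, λ, A) > 0 such that |Σ_{p ≤ x, p prime} (log g_u(p−1))^λ − P_{u,λ}·π(x)| ≤ C·x/(log x)^A for all x ≥ 2. -/

import Mathlib

open scoped BigOperators

/-- `gu u n = gcd(n, u n)`. -/
noncomputable def gu (u : ℕ → ℤ) (n : ℕ) : ℕ := Int.gcd (n : ℤ) (u n)

/-- Rank of appearance of `m` in the sequence `u`. -/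
noncomputable def zu (u : ℕ → ℤ) (m : ℕ) : ℕ := sInf {n : ℕ | 0 < n ∧ (m : ℤ) ∣ u n}

/-- `ℓ(m) = lcm(m, z_u(m))`. -/
noncomputable def ellu (u : ℕ → ℤ) (m : ℕ) : ℕ := Nat.lcm m (zu u m)

/-- The arithmetic function `ρ_λ`. -/
noncomputable def rho (lam n : ℕ) : ℝ :=
  (Nat.factorial lam : ℝ) *
    ∑ f ∈ (Fintype.piFinset fun _ : n.primeFactors => Finset.range (lam + 1)) |>.filter
        (fun f => ∑ p, f p = lam),
      ∏ p : n.primeFactors,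
        (((n.factorization (p : ℕ) : ℝ) ^ f p - ((n.factorization (p : ℕ) : ℝ) - 1) ^ f p) *
          Real.log ((p : ℕ) : ℝ) ^ f p / (Nat.factorial (f p) : ℝ))

/-- The set of primes `≤ x`. -/
noncomputable def primesUpTo (x : ℝ) : Finset ℕ :=
  (Finset.range (⌊x⌋₊ + 1)).filter Nat.Prime

/-- `π(x)`, the number of primes `≤ x`. -/
noncomputable def primePi (x : ℝ) : ℕ := (primesUpTo x).card

/-- `π(x; b, a)`, the number of primes `p ≤ x` with `p ≡ a (mod b)`. -/
noncomputable def primePiMod (x : ℝ) (b a : ℕ) : ℕ :=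
  ((primesUpTo x).filter fun p => p % b = a % b).card

/-- `Δ(x; b, a) = π(x; b, a) - π(x)/φ(b)`. -/
noncomputable def chebErr (x : ℝ) (b a : ℕ) : ℝ :=
  (primePiMod x b a : ℝ) - (primePi x : ℝ) / (Nat.totient b : ℝ)

section

open Complex Filter Topology MeasureTheory Asymptotics

/-- The integral attached to the partial sums. -/
noncomputable def swI (h : ℕ → ℂ) (s : ℂ) : ℂ :=
  ∫ t in Set.Ioi (1 : ℝ), (∑ k ∈ Finset.Icc 1 ⌊t⌋₊, h k) * (t : ℂ) ^ (-(s + 1))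

lemma sw_measurable (h : ℕ → ℂ) : Measurable fun t : ℝ => ∑ k ∈ Finset.Icc 1 ⌊t⌋₊, h k := by
  have : (fun t : ℝ => ∑ k ∈ Finset.Icc 1 ⌊t⌋₊, h k) =
    (fun n : ℕ => ∑ k ∈ Finset.Icc 1 n, h k) ∘ (fun t : ℝ => ⌊t⌋₊) := rfl
  rw [this]
  exact (measurable_from_nat).comp Nat.measurable_floor

lemma swI_norm_le (h : ℕ → ℂ) (K : ℝ) (N : ℕ) (hN : 1 ≤ N)
    (hK : ∀ n, ‖∑ k ∈ Finset.Icc 1 n, h k‖ ≤ K) (h0 : ∀ k, k ≤ N → h k = 0)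
    (s : ℂ) (hs : 0 < s.re) : ‖swI h s‖ ≤ K * (N : ℝ) ^ (-s.re) / s.re := by
  have hN' : (0 : ℝ) < N := by exact_mod_cast hN
  have hIntg : IntegrableOn (fun t : ℝ => K * t ^ (-s.re - 1)) (Set.Ioi (N : ℝ)) :=
    (integrableOn_Ioi_rpow_of_lt (by linarith) hN').const_mul K
  have e1 : swI h s = ∫ t in Set.Ioi (N : ℝ),
      (∑ k ∈ Finset.Icc 1 ⌊t⌋₊, h k) * (t : ℂ) ^ (-(s + 1)) := by
    unfold swI
    apply setIntegral_eq_of_subset_of_forall_sdiff_eq_zero measurableSet_Ioi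
    · intro t ht
      simp only [Set.mem_Ioi] at *
      have : (1 : ℝ) ≤ N := by exact_mod_cast hN
      linarith
    · rintro t ⟨ht1, ht2⟩
      simp only [Set.mem_Ioi, not_lt] at *
      rw [Finset.sum_eq_zero, zero_mul]
      intro k hk
      apply h0
      have := (Finset.mem_Icc.1 hk).2
      have h3 : ⌊t⌋₊ ≤ N := by
        have := Nat.floor_le_floor ht2
        simpa using this
      omega
  rw [e1]
  have hval : ∫ t in Set.Ioi (N : ℝ), K * t ^ (-s.re - 1) = K * (N : ℝ) ^ (-s.re) / s.re := by
    rw [integral_const_mul, integral_Ioi_rpow_of_lt (by linarith) hN']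
    have : -s.re - 1 + 1 = -s.re := by ring
    rw [this]; field_simp
  rw [← hval]
  apply norm_integral_le_of_norm_le hIntg
  rw [ae_restrict_iff' measurableSet_Ioi]
  refine Eventually.of_forall fun t ht => ?_
  have htp : 0 < t := lt_trans hN' ht
  rw [norm_mul, Complex.norm_cpow_eq_rpow_re_of_pos htp]
  have : (-(s + 1)).re = -s.re - 1 := by simp; ring
  rw [this]
  exact mul_le_mul_of_nonneg_right (hK _) (by positivity)

lemma swI_differentiableAt (h : ℕ → ℂ) (K : ℝ)
    (hK : ∀ n, ‖∑ k ∈ Finset.Icc 1 n, h k‖ ≤ K) 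
    (s : ℂ) (hs : 0 < s.re) : DifferentiableAt ℂ (swI h) s := by
  set f : ℝ → ℂ := (Set.Ioi (1 : ℝ)).indicator (fun t => ∑ k ∈ Finset.Icc 1 ⌊t⌋₊, h k) with hf
  have hK0 : 0 ≤ K := le_trans (norm_nonneg _) (hK 0)
  have hfb : ∀ t, ‖f t‖ ≤ K := by
    intro t
    rw [hf, Set.indicator_apply]
    split_ifs
    · exact hK _
    · simpa using hK0
  have hfm : Measurable f := (sw_measurable h).indicator measurableSet_Ioi
  have e : swI h = fun s => mellin f (-s) := by
    funext s
    unfold swI mellin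
    have : Set.Ioi (1 : ℝ) ⊆ Set.Ioi 0 := Set.Ioi_subset_Ioi (by norm_num)
    symm
    rw [← integral_indicator measurableSet_Ioi, ← integral_indicator measurableSet_Ioi]
    congr 1
    funext t
    simp only [hf, Set.indicator_apply, Set.mem_Ioi, smul_eq_mul]
    by_cases h1 : 1 < t
    · have h2 : 0 < t := by linarith
      simp only [h1, h2, if_true]
      rw [mul_comm]; congr 2; ring
    · simp [h1]
  rw [e]
  have : DifferentiableAt ℂ (mellin f) (-s) := by
    apply mellin_differentiableAt_of_isBigO_rpow (a := 0) (b := (-s).re - 1)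
    · intro x hx
      refine ⟨Set.univ ∩ Metric.ball x 1, ?_, ?_⟩
      · exact mem_nhdsWithin_of_mem_nhds (by simpa using Metric.ball_mem_nhds x one_pos)
      · refine Measure.integrableOn_of_bounded (M := K) ?_ hfm.aestronglyMeasurable ?_
        · simp
        · exact Eventually.of_forall hfb
    · simp only [neg_zero, Real.rpow_zero]
      exact IsBigO.of_bound K (Eventually.of_forall fun t => by simpa using hfb t)
    · simpa using hs
    · have : f =ᶠ[𝓝[>] 0] fun _ => (0 : ℂ) := by
        have : Set.Iio (1 : ℝ) ∈ 𝓝[>] (0 : ℝ) := mem_nhdsWithin_of_mem_nhds (Iio_mem_nhds one_pos)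
        filter_upwards [this] with t ht
        simp only [hf, Set.indicator_apply, Set.mem_Ioi]
        rw [if_neg]; simp only [Set.mem_Iio] at ht; linarith
      exact this.trans_isBigO (isBigO_zero _ _)
    · linarith
  exact this.comp s (differentiableAt_id.neg)

lemma LSeries_eq_swI (h : ℕ → ℂ) (K : ℝ)
    (hK : ∀ n, ‖∑ k ∈ Finset.Icc 1 n, h k‖ ≤ K) (s : ℂ) (hs : 0 < s.re)
    (hS : LSeriesSummable h s) : LSeries h s = s * swI h s := by
  apply LSeries_eq_mul_integral h le_rfl hs hS
  simp only [Real.rpow_zero]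
  exact IsBigO.of_bound K (Eventually.of_forall fun t => by simpa using hK t)

/-- partial sums of periodic mean zero functions -/
lemma sw_periodic_sum (g : ℕ → ℂ) (q : ℕ) (hq : 0 < q) (hper : ∀ n, g (n + q) = g n)
    (hsum : ∑ k ∈ Finset.range q, g k = 0) (M : ℝ) (hM : ∀ n, ‖g n‖ ≤ M) (n : ℕ) :
    ‖∑ k ∈ Finset.range n, g k‖ ≤ M * q := by
  have hM0 : 0 ≤ M := le_trans (norm_nonneg _) (hM 0)
  induction n using Nat.strong_induction_on with
  | _ n ih =>
    by_cases hn : n < q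
    · calc ‖∑ k ∈ Finset.range n, g k‖ ≤ ∑ k ∈ Finset.range n, ‖g k‖ := norm_sum_le _ _
        _ ≤ ∑ k ∈ Finset.range n, M := Finset.sum_le_sum fun k _ => hM k
        _ = M * n := by simp [mul_comm]
        _ ≤ M * q := by gcongr
    · push Not at hn
      obtain ⟨m, rfl⟩ := Nat.exists_eq_add_of_le hn
      rw [Finset.sum_range_add, hsum, zero_add]
      have : ∀ k, g (q + k) = g k := fun k => by rw [add_comm, hper]
      simp only [this]
      exact ih m (by omega)

lemma sw_sum_Icc_eq (g : ℕ → ℂ) (n : ℕ) : ∑ k ∈ Finset.Icc 1 n, g k =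
    ∑ k ∈ Finset.range (n + 1), g k - g 0 := by
  rw [Finset.range_eq_Ico, Finset.sum_eq_sum_Ico_succ_bot (by omega)]
  simp [← Finset.Ico_succ_right_eq_Icc]

lemma sw_zmod_range_sum (q : ℕ) [NeZero q] (F : ZMod q → ℂ) :
    ∑ k ∈ Finset.range q, F (k : ZMod q) = ∑ a : ZMod q, F a := by
  refine Finset.sum_bij' (fun k _ => (k : ZMod q)) (fun a _ => a.val) ?_ ?_ ?_ ?_ ?_
  · simp
  · intro a _; simp [ZMod.val_lt]
  · intro k hk; exact ZMod.val_cast_of_lt (Finset.mem_range.1 hk)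
  · intro a _; simp
  · simp

/-- every character has bounded partial sums, after subtraction of the mean value. -/
lemma sw_char_sum (q : ℕ) [NeZero q] (χ : DirichletCharacter ℂ q) (n : ℕ) :
    ‖∑ k ∈ Finset.Icc 1 n, (χ k - (∑ a : ZMod q, χ a) / q)‖ ≤ 4 * q := by
  have hq : 0 < q := NeZero.pos q
  have hq' : (q : ℂ) ≠ 0 := by exact_mod_cast hq.ne'
  set κ : ℂ := (∑ a : ZMod q, χ a) / q with hκ
  have hκ1 : ‖κ‖ ≤ 1 := by
    rw [hκ, norm_div]
    simp only [Complex.norm_natCast]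
    rw [div_le_one (by exact_mod_cast hq)]
    calc ‖∑ a : ZMod q, χ a‖ ≤ ∑ a : ZMod q, ‖χ a‖ := norm_sum_le _ _
      _ ≤ ∑ a : ZMod q, 1 := Finset.sum_le_sum fun a _ => χ.norm_le_one a
      _ = q := by simp
  have hb : ∀ n : ℕ, ‖χ n - κ‖ ≤ 2 := fun n => by
    have := norm_sub_le (χ n) κ
    have := χ.norm_le_one (n : ZMod q)
    linarith
  have h1 := sw_periodic_sum (fun n => χ n - κ) q hq (fun n => by simp)
    (by
      rw [sw_zmod_range_sum q (fun a => χ a - κ), Finset.sum_sub_distrib]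
      simp [hκ]
      field_simp; simp) 2 hb (n + 1)
  rw [sw_sum_Icc_eq]
  have h2 := hb 0
  have := norm_sub_le (∑ k ∈ Finset.range (n + 1), (χ k - κ)) (χ (0 : ℕ) - κ)
  have h3 : (1 : ℝ) ≤ q := by exact_mod_cast hq
  linarith

end

section

open Complex Filter Topology MeasureTheory Asymptotics

/-- tail of an arithmetic function. -/
noncomputable def swTail (N : ℕ) (f : ℕ → ℂ) (k : ℕ) : ℂ := if k ≤ N then 0 else f k

lemma swTail_summable {N : ℕ} {f : ℕ → ℂ} {s : ℂ} (hS : LSeriesSummable f s) :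
    LSeriesSummable (swTail N f) s := by
  rw [← LSeriesSummable_congr' s (f := f)]
  · exact hS
  · filter_upwards [eventually_gt_atTop N] with n hn
    simp [swTail, not_le.2 hn]

lemma LSeries_trunc (N : ℕ) (f : ℕ → ℂ) (s : ℂ) (hS : LSeriesSummable f s) :
    LSeries f s = ∑ n ∈ Finset.Icc 1 N, f n * (n : ℂ) ^ (-s) + LSeries (swTail N f) s := by
  have h1 : LSeriesSummable (f - swTail N f) s := hS.sub (swTail_summable hS)
  have h2 : LSeries (f - swTail N f) s = ∑ n ∈ Finset.Icc 1 N, f n * (n : ℂ) ^ (-s) := by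
    unfold LSeries
    rw [tsum_eq_sum (s := Finset.Icc 1 N)]
    · apply Finset.sum_congr rfl
      intro n hn
      have := Finset.mem_Icc.1 hn
      rw [LSeries.term_of_ne_zero (by omega)]
      simp [swTail, this.2, Complex.cpow_neg, div_eq_mul_inv]
    · intro n hn
      by_cases h0 : n = 0
      · simp [h0]
      · rw [LSeries.term_of_ne_zero h0]
        have : ¬ n ≤ N := fun h => hn (Finset.mem_Icc.2 ⟨by omega, h⟩)
        simp [swTail, this]
  rw [← h2, LSeries_sub hS (swTail_summable hS)]
  ring

lemma swTail_sum (N : ℕ) (f : ℕ → ℂ) (n : ℕ) : ∑ k ∈ Finset.Icc 1 n, swTail N f k =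
    ∑ k ∈ Finset.Icc 1 n, f k - ∑ k ∈ Finset.Icc 1 (min n N), f k := by
  have : ∑ k ∈ Finset.Icc 1 (min n N), f k = ∑ k ∈ Finset.Icc 1 n, (if k ≤ N then f k else 0) := by
    rw [← Finset.sum_filter]
    apply Finset.sum_congr _ (fun _ _ => rfl)
    ext k; simp; omega
  rw [this, ← Finset.sum_sub_distrib]
  apply Finset.sum_congr rfl
  intro k _
  unfold swTail
  split_ifs <;> simp

lemma swTail_bound (N : ℕ) (f : ℕ → ℂ) (K : ℝ) (hK : ∀ n, ‖∑ k ∈ Finset.Icc 1 n, f k‖ ≤ K) (n : ℕ) :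
    ‖∑ k ∈ Finset.Icc 1 n, swTail N f k‖ ≤ 2 * K := by
  rw [swTail_sum]
  have := norm_sub_le (∑ k ∈ Finset.Icc 1 n, f k) (∑ k ∈ Finset.Icc 1 (min n N), f k)
  have h1 := hK n
  have h2 := hK (min n N)
  linarith

lemma sw_char_sum_nontriv (q : ℕ) [NeZero q] (χ : DirichletCharacter ℂ q) (hχ : χ ≠ 1) (n : ℕ) :
    ‖∑ k ∈ Finset.Icc 1 n, (χ k : ℂ)‖ ≤ 4 * q := by
  have := sw_char_sum q χ n
  rw [MulChar.sum_eq_zero_of_ne_one hχ] at this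
  simpa using this

lemma LFunction_trunc (q : ℕ) [NeZero q] (χ : DirichletCharacter ℂ q) (hχ : χ ≠ 1) (N : ℕ)
    (s : ℂ) (hs : 0 < s.re) :
    DirichletCharacter.LFunction χ s = ∑ n ∈ Finset.Icc 1 N, (χ n : ℂ) * (n : ℂ) ^ (-s) +
      s * swI (swTail N (fun n => χ n)) s := by
  have hopen : IsOpen {s : ℂ | 0 < s.re} := isOpen_lt continuous_const Complex.continuous_re
  have hconv : IsPreconnected {s : ℂ | 0 < s.re} := (convex_halfSpace_re_gt 0).isPreconnected
  have hK := swTail_bound N (fun n => (χ n : ℂ)) _ (sw_char_sum_nontriv q χ hχ)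
  have key : Set.EqOn (DirichletCharacter.LFunction χ)
    (fun s => ∑ n ∈ Finset.Icc 1 N, (χ n : ℂ) * (n : ℂ) ^ (-s) +
      s * swI (swTail N (fun n => χ n)) s) {s : ℂ | 0 < s.re} := by
    apply AnalyticOnNhd.eqOn_of_preconnected_of_eventuallyEq (𝕜 := ℂ) (z₀ := 2) _ _ hconv
    · simp
    · have : {s : ℂ | 1 < s.re} ∈ 𝓝 (2 : ℂ) :=
        (isOpen_lt continuous_const Complex.continuous_re).mem_nhds (by simp)
      filter_upwards [this] with s hs
      have hs' : 1 < s.re := hs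
      have hS : LSeriesSummable (fun n => (χ n : ℂ)) s := χ.LSeriesSummable_of_one_lt_re hs'
      rw [DirichletCharacter.LFunction_eq_LSeries χ hs', LSeries_trunc N _ s hS,
        LSeries_eq_swI _ _ hK s (by linarith) (swTail_summable hS)]
    · exact (DirichletCharacter.differentiable_LFunction hχ).differentiableOn.analyticOnNhd hopen
    · apply DifferentiableOn.analyticOnNhd _ hopen
      intro s hs
      apply DifferentiableAt.differentiableWithinAt
      apply DifferentiableAt.add
      · apply DifferentiableAt.fun_sum
        intro n hn
        have : (n : ℂ) ≠ 0 := by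
          have := (Finset.mem_Icc.1 hn).1
          exact_mod_cast (by omega : n ≠ 0)
        apply DifferentiableAt.const_mul
        exact DifferentiableAt.const_cpow differentiableAt_id.neg (Or.inl this)
      · exact differentiableAt_id.mul (swI_differentiableAt _ _ hK s hs)
  exact key hs

/-- finite sum bound -/
lemma sw_fin_sum (ε : ℝ) (hε : 0 < ε) (N : ℕ) (hN : 1 ≤ N) (f : ℕ → ℂ) (hf : ∀ n, ‖f n‖ ≤ 1) (s : ℂ)
    (hs : 1 - ε ≤ s.re) :
    ‖∑ n ∈ Finset.Icc 1 N, f n * (n : ℂ) ^ (-s)‖ ≤ (1 + 1 / ε) * (N : ℝ) ^ (2 * ε) := by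
  have hN0 : (1 : ℝ) ≤ N := by exact_mod_cast hN
  have h1 : ‖∑ n ∈ Finset.Icc 1 N, f n * (n : ℂ) ^ (-s)‖ ≤
      ∑ n ∈ Finset.Icc 1 N, (N : ℝ) ^ ε * (n : ℝ)⁻¹ := by
    refine (norm_sum_le _ _).trans (Finset.sum_le_sum fun n hn => ?_)
    have hn' := Finset.mem_Icc.1 hn
    have hn0 : (0 : ℝ) < n := by exact_mod_cast hn'.1
    have hn1 : (1 : ℝ) ≤ n := by exact_mod_cast hn'.1
    have hnN : (n : ℝ) ≤ N := by exact_mod_cast hn'.2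
    rw [norm_mul, Complex.norm_natCast_cpow_of_pos (by omega)]
    calc ‖f n‖ * (n : ℝ) ^ (-s).re ≤ 1 * (n : ℝ) ^ (ε - 1) := by
          gcongr
          · exact hf n
          · simp; linarith
      _ = (n : ℝ) ^ ε * (n : ℝ)⁻¹ := by
          rw [one_mul, Real.rpow_sub hn0, Real.rpow_one, div_eq_mul_inv]
      _ ≤ _ := by gcongr
  have h2 : ∑ n ∈ Finset.Icc 1 N, (n : ℝ)⁻¹ ≤ 1 + Real.log N := by
    have := harmonic_le_one_add_log N
    rw [harmonic_eq_sum_Icc] at this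
    push_cast at this
    exact this
  have h3 : Real.log N ≤ (N : ℝ) ^ ε / ε := Real.log_le_rpow_div (by positivity) hε
  have h4 : (1 : ℝ) ≤ (N : ℝ) ^ ε := Real.one_le_rpow hN0 hε.le
  refine h1.trans ?_
  rw [← Finset.mul_sum]
  have : (N : ℝ) ^ (2 * ε) = (N : ℝ) ^ ε * (N : ℝ) ^ ε := by
    rw [← Real.rpow_add (by positivity)]; ring_nf
  rw [this]
  calc (N : ℝ) ^ ε * ∑ n ∈ Finset.Icc 1 N, (n : ℝ)⁻¹ ≤ (N : ℝ) ^ ε * ((N : ℝ) ^ ε + (N : ℝ) ^ ε / ε) := by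
        gcongr; linarith
    _ = _ := by ring

/-- bound for nontrivial characters -/
lemma LFunction_bound_aux (ε : ℝ) (hε : 0 < ε) (hε2 : ε ≤ 1 / 2) (q : ℕ) [NeZero q]
    (χ : DirichletCharacter ℂ q) (hχ : χ ≠ 1) (s : ℂ) (hs : 1 - ε ≤ s.re) (hs3 : s.re ≤ 3) :
    ‖DirichletCharacter.LFunction χ s‖ ≤ (100 + 100 / ε) * ((q : ℝ) * (|s.im| + 2)) ^ (2 * ε) := by
  have hq : (1 : ℝ) ≤ q := by exact_mod_cast NeZero.one_le
  set Q : ℝ := (q : ℝ) * (|s.im| + 2) with hQ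
  have hQ2 : 2 ≤ Q := by
    have := abs_nonneg s.im
    nlinarith
  set N : ℕ := ⌈Q⌉₊ with hNdef
  have hNQ : Q ≤ N := Nat.le_ceil Q
  have hNQ2 : (N : ℝ) ≤ 2 * Q := by
    have := Nat.ceil_lt_add_one (a := Q) (by linarith)
    linarith
  have hN1 : 1 ≤ N := by
    have : (1 : ℝ) ≤ N := by linarith
    exact_mod_cast this
  have hN0 : (0 : ℝ) < N := by linarith
  have hsr : 0 < s.re := by linarith
  rw [LFunction_trunc q χ hχ N s hsr]
  have hK := swTail_bound N (fun n => (χ n : ℂ)) _ (sw_char_sum_nontriv q χ hχ)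
  have b1 := sw_fin_sum ε hε N hN1 (fun n => (χ n : ℂ)) (fun n => χ.norm_le_one _) s hs
  have b2 := swI_norm_le (swTail N (fun n => (χ n : ℂ))) _ N hN1 hK
    (fun k hk => by simp [swTail, hk]) s hsr
  have hsn : ‖s‖ ≤ |s.im| + 3 := by
    have := Complex.norm_le_abs_re_add_abs_im s
    rw [abs_of_pos hsr] at this
    linarith
  have hpow : (N : ℝ) ^ (2 * ε) ≤ 2 * Q ^ (2 * ε) := by
    calc (N : ℝ) ^ (2 * ε) ≤ (2 * Q) ^ (2 * ε) := by gcongr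
      _ = 2 ^ (2 * ε) * Q ^ (2 * ε) := Real.mul_rpow (by norm_num) (by linarith)
      _ ≤ 2 ^ (1 : ℝ) * Q ^ (2 * ε) := by
          gcongr
          · norm_num
          · linarith
      _ = _ := by norm_num
  have b3 : ‖s * swI (swTail N (fun n => (χ n : ℂ))) s‖ ≤ 64 * Q ^ (2 * ε) := by
    rw [norm_mul]
    have e1 : (N : ℝ) ^ (-s.re) ≤ (N : ℝ) ^ (ε) / N := by
      calc (N : ℝ) ^ (-s.re) ≤ (N : ℝ) ^ (ε - 1) := by
            apply Real.rpow_le_rpow_of_exponent_le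
            · exact_mod_cast hN1
            · linarith
        _ = _ := by rw [Real.rpow_sub hN0, Real.rpow_one]
    have e2 : (N : ℝ) ^ ε ≤ (N : ℝ) ^ (2 * ε) := by
      apply Real.rpow_le_rpow_of_exponent_le
      · exact_mod_cast hN1
      · linarith
    have e3 : ‖s‖ * q ≤ 2 * N := by
      have := abs_nonneg s.im
      calc ‖s‖ * q ≤ (|s.im| + 3) * q := by gcongr
        _ ≤ 2 * Q := by rw [hQ]; nlinarith
        _ ≤ 2 * N := by linarith
    calc ‖s‖ * ‖swI (swTail N (fun n => (χ n : ℂ))) s‖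
        ≤ ‖s‖ * (2 * (4 * q) * (N : ℝ) ^ (-s.re) / s.re) := by gcongr
      _ ≤ ‖s‖ * (2 * (4 * q) * ((N : ℝ) ^ (2 * ε) / N) / (1 / 2)) := by
          gcongr
          · exact e1.trans (by gcongr)
          · linarith
      _ = 16 * (‖s‖ * q) * ((N : ℝ) ^ (2 * ε) / N) := by ring
      _ ≤ 16 * (2 * N) * ((N : ℝ) ^ (2 * ε) / N) := by gcongr
      _ = 32 * (N : ℝ) ^ (2 * ε) := by field_simp; ring
      _ ≤ 64 * Q ^ (2 * ε) := by linarith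
  have hε' : 0 < 1 / ε := by positivity
  calc _ ≤ _ := norm_add_le _ _
    _ ≤ (1 + 1 / ε) * (N : ℝ) ^ (2 * ε) + 64 * Q ^ (2 * ε) := add_le_add b1 b3
    _ ≤ (1 + 1 / ε) * (2 * Q ^ (2 * ε)) + 64 * Q ^ (2 * ε) := by gcongr
    _ ≤ _ := by
      have : 0 < Q ^ (2 * ε) := by positivity
      have : 0 < (1 / ε) * Q ^ (2 * ε) := by positivity
      have e : (100 + 100 / ε) = 100 + 100 * (1 / ε) := by ring
      rw [e]
      nlinarith

end

section

open Complex Filter Topology MeasureTheory Asymptotics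

lemma zeta_tail (N : ℕ) (hN : 1 ≤ N) (s : ℂ) (hs : 1 < s.re) :
    ‖LSeries (swTail N (fun _ => 1)) s‖ ≤ 1 / ‖s - 1‖ + ‖s‖ / N := by
  have hN' : (0 : ℝ) < N := by exact_mod_cast hN
  have hN1 : (1 : ℝ) ≤ N := by exact_mod_cast hN
  have hS : LSeriesSummable (fun _ => (1 : ℂ)) s := by
    exact LSeriesSummable_one_iff.2 hs
  have hsum : ∀ n, ∑ k ∈ Finset.Icc 1 n, swTail N (fun _ => 1) k = ((n - N : ℕ) : ℂ) := by
    intro n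
    rw [swTail_sum]
    simp only [Finset.sum_const, Nat.card_Icc, nsmul_eq_mul, mul_one]
    rw [Nat.add_sub_cancel, Nat.add_sub_cancel, show n - N = n - min n N by omega,
      Nat.cast_sub (min_le_left _ _)]
  rw [LSeries_eq_mul_integral _ zero_le_one hs (swTail_summable hS)]
  swap
  · simp only [hsum, Real.rpow_one]
    refine IsBigO.of_bound 1 (Eventually.of_forall fun n => ?_)
    simp only [Complex.norm_natCast, Real.norm_natCast, one_mul]
    exact_mod_cast Nat.sub_le n N
  simp only [hsum]
  have e1 : ∫ t in Set.Ioi (1 : ℝ), ((⌊t⌋₊ - N : ℕ) : ℂ) * (t : ℂ) ^ (-(s + 1)) =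
      ∫ t in Set.Ioi (N : ℝ), ((⌊t⌋₊ - N : ℕ) : ℂ) * (t : ℂ) ^ (-(s + 1)) := by
    apply setIntegral_eq_of_subset_of_forall_sdiff_eq_zero measurableSet_Ioi
    · intro t ht
      simp only [Set.mem_Ioi] at *
      linarith
    · rintro t ⟨ht1, ht2⟩
      simp only [Set.mem_Ioi, not_lt] at *
      have h3 : ⌊t⌋₊ ≤ N := by
        have := Nat.floor_le_floor ht2
        simpa using this
      simp [Nat.sub_eq_zero_of_le h3]
  rw [e1]
  have i1 : IntegrableOn (fun t : ℝ => (t : ℂ) ^ (-s)) (Set.Ioi (N : ℝ)) :=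
    integrableOn_Ioi_cpow_of_lt (by simpa using hs) hN'
  have i2 : IntegrableOn (fun t : ℝ => (t : ℂ) ^ (-(s + 1))) (Set.Ioi (N : ℝ)) :=
    integrableOn_Ioi_cpow_of_lt (by simp; linarith) hN'
  have i3 : IntegrableOn (fun t : ℝ => t ^ (-s.re - 1)) (Set.Ioi (N : ℝ)) :=
    integrableOn_Ioi_rpow_of_lt (by linarith) hN'
  have bnd : ∀ t ∈ Set.Ioi (N : ℝ), ‖(((⌊t⌋₊ : ℝ) - t : ℝ) : ℂ) * (t : ℂ) ^ (-(s + 1))‖ ≤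
      t ^ (-s.re - 1) := by
    intro t ht
    have htp : 0 < t := lt_trans hN' ht
    rw [norm_mul, Complex.norm_cpow_eq_rpow_re_of_pos htp]
    have : (-(s + 1)).re = -s.re - 1 := by simp; ring
    rw [this]
    have h1 : ‖(((⌊t⌋₊ : ℝ) - t : ℝ) : ℂ)‖ ≤ 1 := by
      rw [Complex.norm_real, Real.norm_eq_abs, abs_le]
      constructor
      · linarith [Nat.lt_floor_add_one t]
      · linarith [Nat.floor_le htp.le]
    calc _ ≤ 1 * t ^ (-s.re - 1) := by gcongr
      _ = _ := one_mul _
  have i4 : IntegrableOn (fun t : ℝ => (((⌊t⌋₊ : ℝ) - t : ℝ) : ℂ) * (t : ℂ) ^ (-(s + 1)))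
      (Set.Ioi (N : ℝ)) := by
    refine Integrable.mono' i3 ?_ ?_
    · apply AEStronglyMeasurable.mul _ i2.aestronglyMeasurable
      apply Measurable.aestronglyMeasurable
      exact Complex.measurable_ofReal.comp
        ((measurable_from_nat.comp Nat.measurable_floor).sub measurable_id)
    · rw [ae_restrict_iff' measurableSet_Ioi]
      exact Eventually.of_forall bnd
  have e2 : ∫ t in Set.Ioi (N : ℝ), ((⌊t⌋₊ - N : ℕ) : ℂ) * (t : ℂ) ^ (-(s + 1)) =
      (∫ t in Set.Ioi (N : ℝ), (t : ℂ) ^ (-s)) - (∫ t in Set.Ioi (N : ℝ), N * (t : ℂ) ^ (-(s + 1)))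
      + ∫ t in Set.Ioi (N : ℝ), (((⌊t⌋₊ : ℝ) - t : ℝ) : ℂ) * (t : ℂ) ^ (-(s + 1)) := by
    have i5 : Integrable (fun t : ℝ => (t : ℂ) ^ (-s) - N * (t : ℂ) ^ (-(s + 1)))
      (volume.restrict (Set.Ioi (N : ℝ))) := Integrable.sub i1 (Integrable.const_mul i2 _)
    rw [← integral_sub i1 (i2.const_mul _), ← integral_add i5 i4]
    apply setIntegral_congr_fun measurableSet_Ioi
    intro t ht
    have htp : 0 < t := lt_trans hN' ht
    have h3 : N ≤ ⌊t⌋₊ := Nat.le_floor (le_of_lt ht)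
    have h4 : (t : ℂ) ^ (-s) = t * (t : ℂ) ^ (-(s + 1)) := by
      rw [show -s = 1 + (-(s + 1)) by ring, Complex.cpow_add _ _ (by exact_mod_cast htp.ne'),
        Complex.cpow_one]
    simp only [h4]
    rw [Nat.cast_sub h3]
    push_cast
    ring
  rw [e2, integral_const_mul, integral_Ioi_cpow_of_lt (by simpa using hs) hN',
    integral_Ioi_cpow_of_lt (by simp; linarith) hN', mul_add]
  have hs0 : s ≠ 0 := by rintro rfl; simp at hs; linarith
  have hs1 : s - 1 ≠ 0 := by
    intro h; have : s = 1 := by linear_combination h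
    rw [this] at hs; simp at hs
  have hNc : (N : ℂ) ≠ 0 := by exact_mod_cast hN'.ne'
  have e3 : s * (-((N : ℝ) : ℂ) ^ (-s + 1) / (-s + 1) -
      N * (-((N : ℝ) : ℂ) ^ (-(s + 1) + 1) / (-(s + 1) + 1))) = (N : ℂ) ^ (1 - s) / (s - 1) := by
    have h4 : (N : ℂ) ^ (1 - s) = N * (N : ℂ) ^ (-s) := by
      rw [show 1 - s = 1 + (-s) by ring, Complex.cpow_add _ _ hNc, Complex.cpow_one]
    have h5 : -s + 1 = -(s - 1) := by ring
    rw [show -(s + 1) + 1 = -s by ring, show (-s + 1 : ℂ) = 1 - s by ring]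
    push_cast
    rw [h4, show (1 - s : ℂ) = -(s - 1) by ring]
    field_simp
    ring
  rw [e3]
  refine (norm_add_le _ _).trans (add_le_add ?_ ?_)
  · rw [norm_div, Complex.norm_natCast_cpow_of_pos (by omega)]
    gcongr
    apply Real.rpow_le_one_of_one_le_of_nonpos hN1
    simp; linarith
  · rw [norm_mul, div_eq_mul_inv]
    gcongr
    have : ∫ t in Set.Ioi (N : ℝ), t ^ (-s.re - 1) = (N : ℝ) ^ (-s.re) / s.re := by
      rw [integral_Ioi_rpow_of_lt (by linarith) hN']
      have : -s.re - 1 + 1 = -s.re := by ring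
      rw [this]; field_simp
    calc _ ≤ ∫ t in Set.Ioi (N : ℝ), t ^ (-s.re - 1) := by
          apply norm_integral_le_of_norm_le i3
          rw [ae_restrict_iff' measurableSet_Ioi]
          exact Eventually.of_forall bnd
      _ = (N : ℝ) ^ (-s.re) / s.re := this
      _ ≤ (N : ℝ) ^ (-1 : ℝ) / 1 := by
        gcongr
      _ = (N : ℝ)⁻¹ := by rw [Real.rpow_neg_one, div_one]

lemma LFunction_triv_bound_aux (ε : ℝ) (hε : 0 < ε) (hε2 : ε ≤ 1 / 2) (q : ℕ) [NeZero q]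
    (χ : DirichletCharacter ℂ q) (s : ℂ) (hs : 1 < s.re) (hs3 : s.re ≤ 3) :
    ‖DirichletCharacter.LFunction χ s‖ ≤
      (200 + 200 / ε) * ((q : ℝ) * (|s.im| + 2)) ^ (2 * ε) * (1 + 1 / ‖s - 1‖) := by
  have hq : (1 : ℝ) ≤ q := by exact_mod_cast NeZero.one_le
  set Q : ℝ := (q : ℝ) * (|s.im| + 2) with hQ
  have hQ2 : 2 ≤ Q := by
    have := abs_nonneg s.im
    nlinarith
  set N : ℕ := ⌈Q⌉₊ with hNdef
  have hNQ : Q ≤ N := Nat.le_ceil Q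
  have hNQ2 : (N : ℝ) ≤ 2 * Q := by
    have := Nat.ceil_lt_add_one (a := Q) (by linarith)
    linarith
  have hN1 : 1 ≤ N := by
    have : (1 : ℝ) ≤ N := by linarith
    exact_mod_cast this
  have hN0 : (0 : ℝ) < N := by linarith
  have hsr : 0 < s.re := by linarith
  have hpow : (N : ℝ) ^ (2 * ε) ≤ 2 * Q ^ (2 * ε) := by
    calc (N : ℝ) ^ (2 * ε) ≤ (2 * Q) ^ (2 * ε) := by gcongr
      _ = 2 ^ (2 * ε) * Q ^ (2 * ε) := Real.mul_rpow (by norm_num) (by linarith)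
      _ ≤ 2 ^ (1 : ℝ) * Q ^ (2 * ε) := by
          gcongr
          · norm_num
          · linarith
      _ = _ := by norm_num
  set κ : ℂ := (∑ a : ZMod q, χ a) / q with hκ
  have hκ1 : ‖κ‖ ≤ 1 := by
    rw [hκ, norm_div]
    simp only [Complex.norm_natCast]
    rw [div_le_one (by linarith)]
    calc ‖∑ a : ZMod q, χ a‖ ≤ ∑ a : ZMod q, ‖χ a‖ := norm_sum_le _ _
      _ ≤ ∑ a : ZMod q, 1 := Finset.sum_le_sum fun a _ => χ.norm_le_one a
      _ = q := by simp
  have hS : LSeriesSummable (fun n => (χ n : ℂ)) s := χ.LSeriesSummable_of_one_lt_re hs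
  have hS1 : LSeriesSummable (fun _ => (1 : ℂ)) s := LSeriesSummable_one_iff.2 hs
  have hSk : LSeriesSummable (fun _ => κ) s := by
    have := hS1.smul κ
    convert this using 1
    funext n; simp
  have hg : LSeriesSummable (fun n => (χ n : ℂ) - κ) s := hS.sub hSk
  rw [DirichletCharacter.LFunction_eq_LSeries χ hs, LSeries_trunc N _ s hS]
  have e1 : swTail N (fun n => (χ n : ℂ)) =
      swTail N (fun n => (χ n : ℂ) - κ) + κ • swTail N (fun _ => 1) := by
    funext k; simp only [swTail, Pi.add_apply, Pi.smul_apply]; split_ifs <;> simp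
  rw [e1, LSeries_add (swTail_summable hg) ((swTail_summable hS1).smul κ), LSeries_smul]
  have hK := swTail_bound N (fun n => (χ n : ℂ) - κ) _ (sw_char_sum q χ)
  have b1 := sw_fin_sum ε hε N hN1 (fun n => (χ n : ℂ)) (fun n => χ.norm_le_one _) s (by linarith)
  have b2 := swI_norm_le (swTail N (fun n => (χ n : ℂ) - κ)) _ N hN1 hK
    (fun k hk => by simp [swTail, hk]) s hsr
  have b4 := zeta_tail N hN1 s hs
  have hsn : ‖s‖ ≤ |s.im| + 3 := by
    have := Complex.norm_le_abs_re_add_abs_im s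
    rw [abs_of_pos hsr] at this
    linarith
  have e3 : ‖s‖ * q ≤ 2 * N := by
    have := abs_nonneg s.im
    calc ‖s‖ * q ≤ (|s.im| + 3) * q := by gcongr
      _ ≤ 2 * Q := by rw [hQ]; nlinarith
      _ ≤ 2 * N := by linarith
  have b3 : ‖LSeries (swTail N (fun n => (χ n : ℂ) - κ)) s‖ ≤ 16 := by
    rw [LSeries_eq_swI _ _ hK s hsr (swTail_summable hg), norm_mul]
    have e1 : (N : ℝ) ^ (-s.re) ≤ (N : ℝ)⁻¹ := by
      rw [← Real.rpow_neg_one]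
      apply Real.rpow_le_rpow_of_exponent_le
      · exact_mod_cast hN1
      · linarith
    calc ‖s‖ * ‖swI (swTail N (fun n => (χ n : ℂ) - κ)) s‖
        ≤ ‖s‖ * (2 * (4 * q) * (N : ℝ) ^ (-s.re) / s.re) := by gcongr
      _ ≤ ‖s‖ * (2 * (4 * q) * (N : ℝ)⁻¹ / 1) := by gcongr
      _ = 8 * (‖s‖ * q) * (N : ℝ)⁻¹ := by ring
      _ ≤ 8 * (2 * N) * (N : ℝ)⁻¹ := by gcongr
      _ = 16 := by field_simp; ring
  have b5 : ‖κ * LSeries (swTail N (fun _ => 1)) s‖ ≤ 1 / ‖s - 1‖ + 2 := by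
    rw [norm_mul]
    calc _ ≤ 1 * (1 / ‖s - 1‖ + ‖s‖ / N) := by gcongr
      _ ≤ _ := by
        rw [one_mul]
        gcongr
        rw [div_le_iff₀ hN0]
        have := norm_nonneg s
        nlinarith
  have hε' : 0 < 1 / ε := by positivity
  have hQ1 : 1 ≤ Q ^ (2 * ε) := Real.one_le_rpow (by linarith) (by linarith)
  have hn : 0 ≤ 1 / ‖s - 1‖ := by positivity
  calc _ ≤ (1 + 1 / ε) * (N : ℝ) ^ (2 * ε) + (16 + (1 / ‖s - 1‖ + 2)) := 
        (norm_add_le _ _).trans (add_le_add b1 ((norm_add_le _ _).trans (add_le_add b3 b5)))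
    _ ≤ (1 + 1 / ε) * (2 * Q ^ (2 * ε)) + (18 + 1 / ‖s - 1‖) := by
        have : (1 + 1 / ε) * (N : ℝ) ^ (2 * ε) ≤ (1 + 1 / ε) * (2 * Q ^ (2 * ε)) := by gcongr
        linarith
    _ ≤ (200 + 200 * (1 / ε)) * Q ^ (2 * ε) * (1 + 1 / ‖s - 1‖) := by
      have h0 : 0 ≤ (1 / ε) * Q ^ (2 * ε) := by positivity
      have h1 : 0 ≤ (1 / ε) * Q ^ (2 * ε) * (1 / ‖s - 1‖) := by positivity
      have h2 : 0 ≤ Q ^ (2 * ε) * (1 / ‖s - 1‖) := by positivity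
      have h3 : 1 / ‖s - 1‖ ≤ Q ^ (2 * ε) * (1 / ‖s - 1‖) := le_mul_of_one_le_left hn hQ1
      nlinarith
    _ = _ := by ring

end

section

open Complex Filter Topology MeasureTheory Asymptotics

lemma LF_deriv_bound (j : ℕ) (ε : ℝ) (hε : 0 < ε) : ∃ C : ℝ, 1 ≤ C ∧ ∀ (q : ℕ) [NeZero q]
    (χ : DirichletCharacter ℂ q), χ ≠ 1 → ∀ s : ℂ, 1 ≤ s.re → s.re ≤ 2 →
    ‖iteratedDeriv j (DirichletCharacter.LFunction χ) s‖ ≤ C * ((q : ℝ) * (|s.im| + 2)) ^ ε := by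
  set δ : ℝ := min (ε / 2) (1 / 2) with hδ
  have hδ0 : 0 < δ := by rw [hδ]; positivity
  have hδ1 : δ ≤ 1 / 2 := min_le_right _ _
  have hδ2 : 2 * δ ≤ ε := by have := min_le_left (ε / 2) (1 / 2); linarith
  refine ⟨max 1 (j.factorial * ((100 + 100 / δ) * 2) / δ ^ j), le_max_left _ _, ?_⟩
  intro q _ χ hχ s hs1 hs2
  have hq : (1 : ℝ) ≤ q := by exact_mod_cast NeZero.one_le
  set Q : ℝ := (q : ℝ) * (|s.im| + 2) with hQ
  have hQ2 : 2 ≤ Q := by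
    have := abs_nonneg s.im
    nlinarith
  have key := Complex.norm_iteratedDeriv_le_of_forall_mem_sphere_norm_le (c := s) (R := δ)
    (C := (100 + 100 / δ) * (2 * Q ^ ε)) (f := DirichletCharacter.LFunction χ) j hδ0
    (DirichletCharacter.differentiable_LFunction hχ).diffContOnCl ?_
  · refine key.trans ?_
    calc _ = (j.factorial * ((100 + 100 / δ) * 2) / δ ^ j) * Q ^ ε := by ring
      _ ≤ _ := by gcongr; exact le_max_right _ _
  · intro z hz
    rw [mem_sphere_iff_norm] at hz
    have h1 : |(z - s).re| ≤ δ := hz ▸ Complex.abs_re_le_norm _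
    have h2 : |(z - s).im| ≤ δ := hz ▸ Complex.abs_im_le_norm _
    rw [Complex.sub_re] at h1
    rw [Complex.sub_im] at h2
    have h1' := abs_le.1 h1
    refine (LFunction_bound_aux δ hδ0 hδ1 q χ hχ z (by linarith) (by linarith)).trans ?_
    have h3 : |z.im| ≤ |s.im| + δ := by
      have : z.im = s.im + (z.im - s.im) := by ring
      rw [this]
      exact (abs_add_le _ _).trans (by linarith)
    gcongr
    have h0 := abs_nonneg s.im
    calc ((q : ℝ) * (|z.im| + 2)) ^ (2 * δ) ≤ (2 * Q) ^ (2 * δ) := by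
          apply Real.rpow_le_rpow (by positivity) _ (by linarith)
          rw [hQ]
          nlinarith [abs_nonneg z.im]
      _ = 2 ^ (2 * δ) * Q ^ (2 * δ) := Real.mul_rpow (by norm_num) (by linarith)
      _ ≤ 2 ^ (1 : ℝ) * Q ^ ε := by
          gcongr
          · norm_num
          · linarith
          · linarith
      _ = _ := by norm_num

lemma LF_triv_bound (ε : ℝ) (hε : 0 < ε) : ∃ C : ℝ, 1 ≤ C ∧ ∀ (q : ℕ) [NeZero q]
    (χ : DirichletCharacter ℂ q), ∀ s : ℂ, 1 < s.re → s.re ≤ 2 →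
    ‖DirichletCharacter.LFunction χ s‖ ≤ C * ((q : ℝ) * (|s.im| + 2)) ^ ε * (1 + 1 / ‖s - 1‖) := by
  set δ : ℝ := min (ε / 2) (1 / 2) with hδ
  have hδ0 : 0 < δ := by rw [hδ]; positivity
  have hδ1 : δ ≤ 1 / 2 := min_le_right _ _
  have hδ2 : 2 * δ ≤ ε := by have := min_le_left (ε / 2) (1 / 2); linarith
  refine ⟨(200 + 200 / δ), by have : 0 < 200 / δ := by positivity
                              linarith, ?_⟩
  intro q _ χ s hs1 hs2
  have hq : (1 : ℝ) ≤ q := by exact_mod_cast NeZero.one_le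
  refine (LFunction_triv_bound_aux δ hδ0 hδ1 q χ s hs1 (by linarith)).trans ?_
  gcongr
  have := abs_nonneg s.im
  nlinarith

/-- The statement of Siegel's theorem. -/
def SiegelStatement : Prop := ∀ ε : ℝ, 0 < ε → ∃ c : ℝ, 0 < c ∧ ∀ (q : ℕ) [NeZero q]
    (χ : DirichletCharacter ℂ q), χ.IsPrimitive → χ ≠ 1 → χ ^ 2 = 1 →
      c ≤ (q : ℝ) ^ ε * ‖DirichletCharacter.LFunction χ 1‖

lemma LF_lower_aux (q : ℕ) [NeZero q] (χ : DirichletCharacter ℂ q) (hχ : χ ≠ 1) (t E : ℝ)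
    (hE : 1 ≤ E)
    (H1 : ∀ x : ℝ, 0 < x → x ≤ 1 → ‖DirichletCharacter.LFunctionTrivChar q (1 + x)‖ ≤ E * (1 + 1 / x))
    (H2 : ∀ s : ℂ, 1 ≤ s.re → s.re ≤ 2 → |s.im| ≤ |t| → ‖deriv (DirichletCharacter.LFunction χ) s‖ ≤ E)
    (H3 : χ ^ 2 ≠ 1 → ∀ x : ℝ, 0 < x → x ≤ 1 →
      ‖DirichletCharacter.LFunction (χ ^ 2) (1 + x + 2 * I * t)‖ ≤ E)
    (H3' : χ ^ 2 = 1 → ∀ x : ℝ, 0 < x → x ≤ 1 →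
      ‖DirichletCharacter.LFunction (χ ^ 2) (1 + x + 2 * I * t)‖ ≤ E * (1 + 1 / ‖(x + 2 * I * t : ℂ)‖))
    (H4 : χ ^ 2 = 1 → 1 ≤ E * ‖DirichletCharacter.LFunction χ 1‖)
    (x : ℝ) (hx : 0 < x) (hx1 : x ≤ 1) :
    1 / (640 * E ^ 10) ≤ ‖DirichletCharacter.LFunction χ (1 + x + I * t)‖ := by
  have hE0 : 0 < E := by linarith
  set y : ℝ := 1 / (4 * E ^ 2) with hy
  have hy0 : 0 < y := by positivity
  set x0 : ℝ := 1 / (640 * E ^ 10) with hx0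
  have hx00 : 0 < x0 := by positivity
  have hx01 : x0 ≤ 1 := by
    rw [hx0, div_le_one (by positivity)]
    have := one_le_pow₀ hE (n := 10)
    linarith
  have hx0y : x0 ≤ y := by
    rw [hx0, hy]
    apply one_div_le_one_div_of_le (by positivity)
    have := pow_le_pow_right₀ hE (show 2 ≤ 10 by norm_num)
    have : 0 < E ^ 2 := by positivity
    linarith
  have hx0E : x0 * (640 * E ^ 10) = 1 := by rw [hx0]; field_simp
  have hyE : y * (4 * E ^ 2) = 1 := by rw [hy]; field_simp
  -- 3-4-1
  have L341 : ∀ x : ℝ, 0 < x → x ≤ 1 → (χ ^ 2 = 1 → y ≤ x ∨ y ≤ |t|) →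
      x ^ 3 ≤ 40 * E ^ 6 * ‖DirichletCharacter.LFunction χ (1 + x + I * t)‖ ^ 4 := by
    intro x hx hx1 hc
    have h := DirichletCharacter.norm_LFunction_product_ge_one χ hx t
    rw [norm_mul, norm_mul, norm_pow, norm_pow] at h
    have b1 : ‖DirichletCharacter.LFunctionTrivChar q (1 + x)‖ ≤ 2 * E / x := by
      refine (H1 x hx hx1).trans ?_
      have : 1 ≤ 1 / x := by rw [le_div_iff₀ hx]; linarith
      calc E * (1 + 1 / x) ≤ E * (1 / x + 1 / x) := by gcongr
        _ = _ := by ring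
    have b3 : ‖DirichletCharacter.LFunction (χ ^ 2) (1 + x + 2 * I * t)‖ ≤ 5 * E ^ 3 := by
      have hE3 : E ≤ E ^ 3 := le_self_pow₀ hE (by norm_num)
      by_cases h2 : χ ^ 2 = 1
      · refine (H3' h2 x hx hx1).trans ?_
        have hn : y ≤ ‖(x + 2 * I * t : ℂ)‖ := by
          rcases hc h2 with h | h
          · have := Complex.abs_re_le_norm (x + 2 * I * t : ℂ)
            simp at this
            linarith [le_abs_self x]
          · have := Complex.abs_im_le_norm (x + 2 * I * t : ℂ)
            simp [abs_mul] at this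
            linarith [abs_nonneg t]
        have : 1 / ‖(x + 2 * I * t : ℂ)‖ ≤ 4 * E ^ 2 := by
          have : 4 * E ^ 2 = 1 / y := by rw [hy]; field_simp
          rw [this]
          exact one_div_le_one_div_of_le hy0 hn
        calc _ ≤ E * (E ^ 2 + 4 * E ^ 2) := by
              gcongr
              exact one_le_pow₀ hE
          _ = _ := by ring
      · exact (H3 h2 x hx hx1).trans (by linarith)
    set a := ‖DirichletCharacter.LFunction χ (1 + x + I * t)‖
    have ha : 0 ≤ a := norm_nonneg _
    have : 1 ≤ (2 * E / x) ^ 3 * a ^ 4 * (5 * E ^ 3) := by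
      refine h.le.trans ?_
      gcongr
    have e : (2 * E / x) ^ 3 * a ^ 4 * (5 * E ^ 3) = 40 * E ^ 6 * a ^ 4 / x ^ 3 := by
      field_simp; ring
    rw [e, le_div_iff₀ (by positivity)] at this
    linarith
  -- conclusion from large x
  have big : ∀ x : ℝ, x0 ≤ x → x ≤ 1 → (χ ^ 2 = 1 → y ≤ x ∨ y ≤ |t|) →
      2 * x0 * E ≤ ‖DirichletCharacter.LFunction χ (1 + x + I * t)‖ := by
    intro x hx hx1 hc
    have h := L341 x (by linarith) hx1 hc
    set a := ‖DirichletCharacter.LFunction χ (1 + x + I * t)‖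
    have ha : 0 ≤ a := norm_nonneg _
    by_contra hcon
    push Not at hcon
    have h4 : a ^ 4 < (2 * x0 * E) ^ 4 := pow_lt_pow_left₀ hcon ha (by norm_num)
    have h5 : x0 ^ 3 ≤ x ^ 3 := by gcongr
    have h6 : 40 * E ^ 6 * a ^ 4 < 40 * E ^ 6 * (2 * x0 * E) ^ 4 := by gcongr
    have h7 : 40 * E ^ 6 * (2 * x0 * E) ^ 4 = x0 ^ 3 := by
      calc 40 * E ^ 6 * (2 * x0 * E) ^ 4 = x0 ^ 3 * (x0 * (640 * E ^ 10)) := by ring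
        _ = _ := by rw [hx0E, mul_one]
    linarith
  have hxE : x0 ≤ 2 * x0 * E := by nlinarith
  have mv : ∀ a b : ℂ, 1 ≤ a.re → a.re ≤ 2 → |a.im| ≤ |t| → 1 ≤ b.re → b.re ≤ 2 → |b.im| ≤ |t| →
      ‖DirichletCharacter.LFunction χ b - DirichletCharacter.LFunction χ a‖ ≤ E * ‖b - a‖ := by
    intro a b ha1 ha2 ha3 hb1 hb2 hb3
    have hconv : Convex ℝ ({s : ℂ | 1 ≤ s.re} ∩ {s : ℂ | s.re ≤ 2} ∩ ({s : ℂ | -|t| ≤ s.im} ∩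
      {s : ℂ | s.im ≤ |t|})) :=
      ((convex_halfSpace_re_ge 1).inter (convex_halfSpace_re_le 2)).inter
      ((convex_halfSpace_im_ge _).inter (convex_halfSpace_im_le _))
    refine hconv.norm_image_sub_le_of_norm_deriv_le (𝕜 := ℂ) ?_ ?_ ?_ ?_
    · intro s _
      exact DirichletCharacter.differentiable_LFunction hχ s
    · rintro s ⟨⟨h1, h2⟩, h3, h4⟩
      exact H2 s h1 h2 (abs_le.2 ⟨h3, h4⟩)
    · exact ⟨⟨ha1, ha2⟩, abs_le.1 ha3⟩
    · exact ⟨⟨hb1, hb2⟩, abs_le.1 hb3⟩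
  by_cases hc : χ ^ 2 = 1 → y ≤ |t|
  · rcases le_total x0 x with h | h
    · exact hxE.trans (big x h hx1 fun h => Or.inr (hc h))
    · have h1 := big x0 le_rfl hx01 fun h => Or.inr (hc h)
      have h2 := mv (1 + x + I * t) (1 + x0 + I * t) (by simp; linarith) (by simp; linarith) (by simp)
        (by simp; linarith) (by simp; linarith) (by simp)
      have h3 : ‖((1 + x0 + I * t) - (1 + x + I * t) : ℂ)‖ ≤ x0 := by
        have : ((1 + x0 + I * t) - (1 + x + I * t) : ℂ) = ((x0 - x : ℝ) : ℂ) := by push_cast; ring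
        rw [this, Complex.norm_real, Real.norm_eq_abs, abs_of_nonneg (by linarith)]
        linarith
      have h4 := norm_sub_norm_le (DirichletCharacter.LFunction χ (1 + x0 + I * t))
        (DirichletCharacter.LFunction χ (1 + x + I * t))
      have h5 : E * ‖((1 + x0 + I * t) - (1 + x + I * t) : ℂ)‖ ≤ E * x0 := by gcongr
      nlinarith
  · push Not at hc
    obtain ⟨hc2, hct⟩ := hc
    rcases le_total y x with h | h
    · exact hxE.trans (big x (hx0y.trans h) hx1 fun _ => Or.inl h)
    · have h2 := mv (1 + x + I * t) 1 (by simp; linarith) (by simp; linarith) (by simp)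
        (by simp) (by simp) (by simp)
      have h3 : ‖(1 - (1 + x + I * t) : ℂ)‖ ≤ 2 * y := by
        have : (1 - (1 + x + I * t) : ℂ) = -(x + I * t) := by ring
        rw [this, norm_neg]
        refine (norm_add_le _ _).trans ?_
        simp [abs_of_pos hx]
        linarith
      have h4 := norm_sub_norm_le (DirichletCharacter.LFunction χ 1)
        (DirichletCharacter.LFunction χ (1 + x + I * t))
      have h5 : E * ‖(1 - (1 + x + I * t) : ℂ)‖ ≤ E * (2 * y) := by gcongr
      have h6 := H4 hc2
      have h7 : E * (E * (2 * y)) = 1 / 2 := by linear_combination hyE / 2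
      set a := ‖DirichletCharacter.LFunction χ (1 + x + I * t)‖
      set b := ‖DirichletCharacter.LFunction χ 1‖
      have h8 : 1 / 2 ≤ E * a := by
        have : b ≤ a + E * (2 * y) := by linarith
        have : E * b ≤ E * (a + E * (2 * y)) := by gcongr
        linarith
      have h9 : E * x0 ≤ 1 / 2 := by
        have : E ≤ E ^ 10 := le_self_pow₀ hE (by norm_num)
        nlinarith
      exact le_of_mul_le_mul_left (h9.trans h8) hE0

lemma LF_lower (HS : SiegelStatement) (ε : ℝ) (hε : 0 < ε) : ∃ C : ℝ, 1 ≤ C ∧ ∀ (q : ℕ) [NeZero q]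
    (χ : DirichletCharacter ℂ q), χ.IsPrimitive → χ ≠ 1 → ∀ s : ℂ, 1 < s.re → s.re ≤ 2 →
    1 ≤ C * ((q : ℝ) * (|s.im| + 2)) ^ ε * ‖DirichletCharacter.LFunction χ s‖ := by
  set δ : ℝ := ε / 10 with hδ
  have hδ0 : 0 < δ := by positivity
  obtain ⟨C0, hC0, B0⟩ := LF_deriv_bound 0 δ hδ0
  obtain ⟨C1, hC1, B1⟩ := LF_deriv_bound 1 δ hδ0
  obtain ⟨C2, hC2, B2⟩ := LF_triv_bound δ hδ0
  obtain ⟨c, hc, B3⟩ := HS δ hδ0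
  set K : ℝ := 2 ^ δ * (C0 + C1 + C2 + 1 / c) with hK
  have h2δ : (1 : ℝ) ≤ 2 ^ δ := Real.one_le_rpow (by norm_num) hδ0.le
  have hci : 0 < 1 / c := by positivity
  have hK1 : 1 ≤ K := by nlinarith
  refine ⟨640 * K ^ 10, ?_, ?_⟩
  · have := one_le_pow₀ hK1 (n := 10)
    linarith
  intro q _ χ hprim hχ s hs1 hs2
  have hq : (1 : ℝ) ≤ q := by exact_mod_cast NeZero.one_le
  set t : ℝ := s.im with ht
  have ht0 := abs_nonneg t
  set Q : ℝ := (q : ℝ) * (|t| + 2) with hQ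
  have hQ2 : 2 ≤ Q := by nlinarith
  have hQq : (q : ℝ) ≤ Q := by nlinarith
  have hQδ : 1 ≤ Q ^ δ := Real.one_le_rpow (by linarith) hδ0.le
  set E : ℝ := K * Q ^ δ with hE
  have hE1 : 1 ≤ E := by nlinarith
  have hcomp : ∀ C : ℝ, 0 ≤ C → C ≤ C0 + C1 + C2 + 1 / c → ∀ r : ℝ, |r| ≤ 2 * |t| →
      C * ((q : ℝ) * (|r| + 2)) ^ δ ≤ E := by
    intro C hC hC' r hr
    have : ((q : ℝ) * (|r| + 2)) ^ δ ≤ 2 ^ δ * Q ^ δ := by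
      rw [← Real.mul_rpow (by norm_num) (by linarith)]
      apply Real.rpow_le_rpow (by positivity) _ hδ0.le
      rw [hQ]; nlinarith
    calc C * ((q : ℝ) * (|r| + 2)) ^ δ ≤ (C0 + C1 + C2 + 1 / c) * (2 ^ δ * Q ^ δ) := by gcongr
      _ = E := by rw [hE, hK]; ring
  have key := LF_lower_aux q χ hχ t E hE1 ?_ ?_ ?_ ?_ ?_ (s.re - 1) (by linarith) (by linarith)
  · have e : (1 + ((s.re - 1 : ℝ) : ℂ) + I * t : ℂ) = s := by
      apply Complex.ext <;> simp [ht]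
    rw [e, div_le_iff₀ (by positivity)] at key
    have e2 : E ^ 10 = K ^ 10 * Q ^ ε := by
      rw [hE, mul_pow]; congr 1
      rw [← Real.rpow_natCast, ← Real.rpow_mul (by linarith), hδ]; congr 1; push_cast; ring
    rw [e2] at key
    linarith
  · intro x hx hx1
    have := B2 q (1 : DirichletCharacter ℂ q) (1 + x) (by simp; linarith) (by simp; linarith)
    refine this.trans ?_
    have e : ‖(1 + x - 1 : ℂ)‖ = x := by
      rw [add_sub_cancel_left, Complex.norm_real, Real.norm_eq_abs, abs_of_pos hx]
    rw [e]
    gcongr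
    apply hcomp C2 (by linarith) (by linarith)
    simp [ht0]
  · intro z hz1 hz2 hz3
    have := B1 q χ hχ z hz1 hz2
    rw [iteratedDeriv_one] at this
    exact this.trans (hcomp C1 (by linarith) (by linarith) _ (by linarith))
  · intro h2 x hx hx1
    have := B0 q (χ ^ 2) h2 (1 + x + 2 * I * t) (by simp; linarith) (by simp; linarith)
    rw [iteratedDeriv_zero] at this
    refine this.trans (hcomp C0 (by linarith) (by linarith) _ ?_)
    simp [abs_mul]
  · intro h2 x hx hx1
    have := B2 q (χ ^ 2) (1 + x + 2 * I * t) (by simp; linarith) (by simp; linarith)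
    refine this.trans ?_
    rw [show (1 + x + 2 * I * t - 1 : ℂ) = x + 2 * I * t by ring]
    gcongr
    apply hcomp C2 (by linarith) (by linarith)
    simp [abs_mul]
  · intro h2
    have := B3 q χ hprim hχ h2
    have h3 : (q : ℝ) ^ δ ≤ Q ^ δ := by gcongr
    have hE' : 1 / c * Q ^ δ ≤ E := by
      rw [hE]
      gcongr
      nlinarith
    have h4 : c ≤ Q ^ δ * ‖DirichletCharacter.LFunction χ 1‖ := this.trans (by gcongr)
    calc 1 = 1 / c * c := by field_simp
      _ ≤ 1 / c * (Q ^ δ * ‖DirichletCharacter.LFunction χ 1‖) := by gcongr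
      _ = (1 / c * Q ^ δ) * ‖DirichletCharacter.LFunction χ 1‖ := by ring
      _ ≤ _ := by gcongr

end

section

open Complex Filter Topology

lemma zeta_entire : ∃ Z : ℂ → ℂ, Differentiable ℂ Z ∧ Z 1 = 1 ∧
    ∀ s, s ≠ 1 → Z s = (s - 1) * riemannZeta s := by
  refine ⟨DirichletCharacter.LFunctionTrivChar₁ 1,
    DirichletCharacter.differentiable_LFunctionTrivChar₁ 1, ?_, ?_⟩
  · simp [DirichletCharacter.LFunctionTrivChar₁]
  · intro s hs
    simp [DirichletCharacter.LFunctionTrivChar₁, hs, DirichletCharacter.LFunctionTrivChar]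

lemma iteratedDeriv_inv_sub_one (m : ℕ) (c : ℂ) :
    iteratedDeriv m (fun s : ℂ => c / (s - 1)) 2 = c * ((-1) ^ m * m.factorial) := by
  have h1 : (fun s : ℂ => c / (s - 1)) = fun s => c * (1 * s - 1)⁻¹ := by
    ext s; rw [one_mul, div_eq_mul_inv]
  rw [h1, iteratedDeriv_const_mul_field, iteratedDeriv_eq_iterate, iter_deriv_inv_linear_sub]
  norm_num

lemma estermann_tail (t : ℕ → ℝ) (S K c x l : ℝ) (hS : HasSum t S) (hx0 : 0 < x) (hx1 : x < 1)
    (f : ℕ → ℝ) (hf : ∀ m, 0 ≤ f m) (hf0 : c ≤ f 0)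
    (ht : ∀ m, t m = (1 + x) ^ m * (f m - l)) (hK : ∀ m, |t m| ≤ K * (3 / 4) ^ m) (M : ℕ)
    (hM : 1 ≤ M) :
    c - l * ((1 + x) ^ M - 1) / x - 4 * K * (3 / 4) ^ M ≤ S := by
  have h1 := hS.summable.sum_add_tsum_nat_add M
  rw [hS.tsum_eq] at h1
  have h2 : c - l * ((1 + x) ^ M - 1) / x ≤ ∑ i ∈ Finset.range M, t i := by
    have : ∀ i ∈ Finset.range M, (if i = 0 then c else 0) - l * (1 + x) ^ i ≤ t i := by
      intro i _
      rw [ht]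
      split_ifs with h
      · subst h; simp; linarith
      · have := mul_nonneg (pow_nonneg (by linarith : (0:ℝ) ≤ 1 + x) i) (hf i)
        linarith
    have h3 := Finset.sum_le_sum this
    rw [Finset.sum_sub_distrib, ← Finset.mul_sum, geom_sum_eq (by linarith)] at h3
    rw [Finset.sum_ite_eq' , if_pos (Finset.mem_range.2 (by omega))] at h3
    have e : l * ((1 + x) ^ M - 1) / x = l * (((1 + x) ^ M - 1) / (1 + x - 1)) := by
      rw [add_sub_cancel_left]; ring
    rw [e]
    exact h3
  have h4 : -(4 * K * (3 / 4) ^ M) ≤ ∑' i, t (i + M) := by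
    have hg : HasSum (fun i : ℕ => K * (3 / 4 : ℝ) ^ (i + M)) (4 * K * (3 / 4) ^ M) := by
      have := (hasSum_geometric_of_lt_one (r := (3 / 4 : ℝ)) (by norm_num) (by norm_num)).mul_left
        (K * (3 / 4) ^ M)
      have e1 : (fun i : ℕ => K * (3 / 4 : ℝ) ^ (i + M)) =
          fun i : ℕ => K * (3 / 4) ^ M * (3 / 4) ^ i := by
        ext i
        rw [pow_add]
        ring
      have e2 : 4 * K * (3 / 4) ^ M = K * (3 / 4) ^ M * (1 - 3 / 4 : ℝ)⁻¹ := by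
        norm_num
        ring
      rw [e1, e2]
      exact this
    have := Summable.tsum_le_tsum (f := fun i : ℕ => -(K * (3 / 4 : ℝ) ^ (i + M)))
      (g := fun i => t (i + M)) (fun i => (abs_le.1 (hK (i + M))).1) hg.neg.summable ((summable_nat_add_iff M).2 hS.summable)
    rw [hg.neg.tsum_eq] at this
    exact this
  linarith

lemma estermann : ∃ C₀ : ℝ, 1 ≤ C₀ ∧ ∀ (G : ℂ → ℂ) (K : ℝ), Differentiable ℂ G → 1 ≤ K →
    (∀ z ∈ Metric.sphere (2 : ℂ) (3 / 2), ‖G z‖ ≤ K) →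
    (∀ m : ℕ, 0 ≤ ((-1) ^ m * iteratedDeriv m (fun s => riemannZeta s * G s) 2).re) →
    1 / 25 ≤ (riemannZeta 2 * G 2).re → ∀ β : ℝ, 7 / 8 ≤ β → β < 1 →
    (riemannZeta β * G β).re ≤ 0 →
    1 - β ≤ (C₀ * K) ^ (4 * (1 - β)) * C₀ * ‖G 1‖ := by
  obtain ⟨Z, hZ, hZ1, hZs⟩ := zeta_entire
  obtain ⟨Cz, hCz⟩ : ∃ Cz : ℝ, ∀ z ∈ Metric.sphere (2 : ℂ) (3 / 2), ‖riemannZeta z‖ ≤ Cz := by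
    have := (isCompact_sphere (2 : ℂ) (3 / 2)).exists_bound_of_continuousOn
      (f := riemannZeta) (fun z hz => ?_)
    · exact this
    · refine (differentiableAt_riemannZeta ?_).continuousAt.continuousWithinAt
      rintro rfl
      rw [mem_sphere_iff_norm] at hz
      norm_num at hz
  set C1 := max Cz 0 + 2 with hC1
  have hC1' : 2 ≤ C1 := by rw [hC1]; linarith [le_max_right Cz 0]
  refine ⟨200 * C1, by linarith, ?_⟩
  intro G K hG hK1 hGK halt h2 β hβ hβ1 hβ0
  set W : ℂ → ℂ := fun s => Z s * G s with hW
  have hWd : Differentiable ℂ W := hZ.mul hG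
  set H : ℂ → ℂ := dslope W 1 with hH
  have hHd : Differentiable ℂ H := by
    rw [← differentiableOn_univ]
    rw [Complex.differentiableOn_dslope univ_mem]
    exact hWd.differentiableOn
  have hHs : ∀ s, s ≠ 1 → H s = riemannZeta s * G s - G 1 / (s - 1) := by
    intro s hs
    rw [hH, dslope_of_ne _ hs, slope_def_field, hW]
    simp only [hZs s hs, hZ1]
    have : s - 1 ≠ 0 := sub_ne_zero.2 hs
    field_simp
  have hG1 : ‖G 1‖ ≤ K := by
    refine Complex.norm_le_of_forall_mem_frontier_norm_le (U := Metric.ball (2 : ℂ) (3 / 2))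
      Metric.isBounded_ball hG.diffContOnCl ?_ ?_
    · rw [frontier_ball _ (by norm_num)]; exact hGK
    · apply subset_closure
      rw [mem_ball_iff_norm]; norm_num
  have hHb : ∀ z ∈ Metric.sphere (2 : ℂ) (3 / 2), ‖H z‖ ≤ C1 * K := by
    intro z hz
    have hz' := hz
    rw [mem_sphere_iff_norm] at hz'
    have hz1 : 1 / 2 ≤ ‖z - 1‖ := by
      have := norm_sub_norm_le (z - 2) (-1)
      have e : z - 2 - -1 = z - 1 := by ring
      rw [e, hz', norm_neg, norm_one] at this
      linarith
    have hne : z ≠ 1 := by rintro rfl; norm_num at hz1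
    rw [hHs z hne]
    refine (norm_sub_le _ _).trans ?_
    rw [norm_mul, norm_div]
    have a1 : ‖riemannZeta z‖ * ‖G z‖ ≤ max Cz 0 * K :=
      mul_le_mul ((hCz z hz).trans (le_max_left _ _)) (hGK z hz) (norm_nonneg _) (le_max_right _ _)
    have a2 : ‖G 1‖ / ‖z - 1‖ ≤ 2 * K := by
      rw [div_le_iff₀ (by linarith)]
      nlinarith
    rw [hC1]; linarith
  have hnear : ∀ᶠ s in 𝓝 (2 : ℂ), s ≠ 1 := isOpen_ne.mem_nhds (by norm_num)
  have hder : ∀ m, iteratedDeriv m H 2 = iteratedDeriv m (fun s => riemannZeta s * G s) 2 -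
      G 1 * ((-1) ^ m * m.factorial) := by
    intro m
    have e : H =ᶠ[𝓝 2] (fun s => riemannZeta s * G s) - fun s => G 1 / (s - 1) := by
      filter_upwards [hnear] with s hs
      simp [hHs s hs]
    rw [e.iteratedDeriv_eq, iteratedDeriv_sub, iteratedDeriv_inv_sub_one]
    · apply AnalyticAt.contDiffAt
      apply DifferentiableOn.analyticAt (s := {s | s ≠ 1}) _ hnear
      intro s hs
      exact ((differentiableAt_riemannZeta hs).mul (hG s)).differentiableWithinAt
    · apply AnalyticAt.contDiffAt
      apply DifferentiableOn.analyticAt (s := {s | s ≠ 1}) _ hnear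
      intro s hs
      have : s - 1 ≠ 0 := sub_ne_zero.2 hs
      fun_prop (disch := assumption)
  set x := 1 - β with hx
  have hsum := Complex.hasSum_taylorSeries_of_entire hHd 2 (β : ℂ)
  have hsum' := Complex.hasSum_re hsum
  set f : ℕ → ℝ := fun m => ((m.factorial : ℝ))⁻¹ *
    ((-1) ^ m * iteratedDeriv m (fun s => riemannZeta s * G s) 2).re with hf
  have ht : ∀ m, ((m.factorial : ℂ)⁻¹ • ((β : ℂ) - 2) ^ m • iteratedDeriv m H 2).re =
      (1 + x) ^ m * (f m - (G 1).re) := by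
    intro m
    have hm : (m.factorial : ℝ) ≠ 0 := by positivity
    have e1 : ((m.factorial : ℂ)⁻¹ • ((β : ℂ) - 2) ^ m • iteratedDeriv m H 2) =
        (((m.factorial : ℝ)⁻¹ * (1 + x) ^ m : ℝ) : ℂ) * ((-1) ^ m * iteratedDeriv m H 2) := by
      rw [hx]
      push_cast
      have : ((β : ℂ) - 2) = (-1) * (1 + (1 - β)) := by ring
      rw [this, mul_pow, smul_eq_mul, smul_eq_mul]
      ring
    have e2 : (-1 : ℂ) ^ m * iteratedDeriv m H 2 =
      (-1) ^ m * iteratedDeriv m (fun s => riemannZeta s * G s) 2 - ((m.factorial : ℝ) : ℂ) * G 1 := by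
      rw [hder]
      have : ((-1 : ℂ) ^ m) * (-1) ^ m = 1 := by rw [← mul_pow]; simp
      linear_combination (-(G 1) * (m.factorial : ℂ)) * this
    rw [e1, Complex.re_ofReal_mul, e2, Complex.sub_re, Complex.re_ofReal_mul, hf]
    field_simp
  have htb : ∀ m, |((m.factorial : ℂ)⁻¹ • ((β : ℂ) - 2) ^ m • iteratedDeriv m H 2).re| ≤
      C1 * K * (3 / 4) ^ m := by
    intro m
    refine (Complex.abs_re_le_norm _).trans ?_
    have := Complex.norm_iteratedDeriv_le_of_forall_mem_sphere_norm_le m (by norm_num)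
      hHd.diffContOnCl hHb
    rw [norm_smul, norm_smul, norm_inv, norm_pow]
    have e1 : ‖(β : ℂ) - 2‖ ≤ 9 / 8 := by
      have : (β : ℂ) - 2 = ((β - 2 : ℝ) : ℂ) := by push_cast; ring
      rw [this, Complex.norm_real, Real.norm_eq_abs, abs_le]
      constructor <;> linarith
    have hm : (0 : ℝ) < (m.factorial : ℝ) := by positivity
    simp only [RCLike.norm_natCast]
    calc _ ≤ ((m.factorial : ℝ))⁻¹ * ((9 / 8) ^ m * ((m.factorial : ℝ) * (C1 * K) / (3 / 2) ^ m)) := by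
          gcongr
      _ = C1 * K * ((9 / 8) ^ m / (3 / 2) ^ m) := by field_simp
      _ = _ := by rw [← div_pow]; norm_num
  set K2 := 200 * C1 * K with hK2
  have hK2' : 400 ≤ K2 := by rw [hK2]; nlinarith
  have hlog : (1 : ℝ) / 4 < Real.log (4 / 3) := by
    rw [Real.lt_log_iff_exp_lt (by norm_num)]
    have := Real.exp_bound' (x := 1 / 4) (by norm_num) (by norm_num) (n := 4) (by norm_num)
    refine this.trans_lt ?_
    norm_num [Finset.sum_range_succ, Nat.factorial]
  set M := ⌈4 * Real.log K2⌉₊ with hM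
  have hlogK : 0 < Real.log K2 := Real.log_pos (by linarith)
  have hM1 : 1 ≤ M := Nat.ceil_pos.2 (by linarith)
  have hM2 : (M : ℝ) ≤ 4 * Real.log K2 + 1 := (Nat.ceil_lt_add_one (by linarith)).le
  have hM3 : 4 * Real.log K2 ≤ M := Nat.le_ceil _
  have hpow : (3 / 4 : ℝ) ^ M ≤ 1 / K2 := by
    have : K2 ≤ (4 / 3 : ℝ) ^ M := by
      rw [← Real.log_le_log_iff (by linarith) (by positivity), Real.log_pow]
      nlinarith
    have e : (3 / 4 : ℝ) ^ M = 1 / (4 / 3 : ℝ) ^ M := by rw [one_div, ← inv_pow]; norm_num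
    rw [e]
    exact one_div_le_one_div_of_le (by linarith) this
  have key := estermann_tail _ _ (C1 * K) (1 / 25) x (G 1).re hsum' (by linarith) (by linarith) f
    (fun m => mul_nonneg (by positivity) (halt m)) (by simpa [hf] using h2) ht htb M hM1
  have hβne : (β : ℂ) ≠ 1 := by exact_mod_cast hβ1.ne
  have hHβ : (H β).re = (riemannZeta β * G β).re + (G 1).re / x := by
    have hx0 : x ≠ 0 := by rw [hx]; linarith
    rw [hHs _ hβne, Complex.sub_re]
    have : (G 1 / ((β : ℂ) - 1)) = ((-(1 / x) : ℝ) : ℂ) * G 1 := by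
      rw [hx]; push_cast
      have h1 : (β : ℂ) - 1 ≠ 0 := sub_ne_zero.2 hβne
      have h2 : 1 - (β : ℂ) ≠ 0 := sub_ne_zero.2 hβne.symm
      field_simp
      ring
    rw [this, Complex.re_ofReal_mul]
    ring
  have hx0 : 0 < x := by linarith
  have h5 : 4 * (C1 * K) * (3 / 4) ^ M ≤ 1 / 50 := by
    have : 4 * (C1 * K) * (3 / 4) ^ M ≤ 4 * (C1 * K) * (1 / K2) := by gcongr
    refine this.trans (le_of_eq ?_)
    rw [hK2]; field_simp; norm_num
  have h6 : 1 / 50 ≤ (G 1).re * (1 + x) ^ M / x := by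
    have e : (G 1).re * ((1 + x) ^ M - 1) / x = (G 1).re * (1 + x) ^ M / x - (G 1).re / x := by ring
    linarith
  have h7 : (1 + x) ^ M ≤ K2 ^ (4 * x) * 3 := by
    calc (1 + x) ^ M ≤ (Real.exp x) ^ M := by
          gcongr
          linarith [Real.add_one_le_exp x]
      _ = Real.exp (M * x) := by rw [← Real.exp_nat_mul]
      _ ≤ Real.exp (Real.log K2 * (4 * x) + 1) := by
          apply Real.exp_le_exp.2
          nlinarith
      _ = K2 ^ (4 * x) * Real.exp 1 := by
          rw [Real.exp_add, Real.rpow_def_of_pos (by linarith)]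
      _ ≤ _ := by
          gcongr
          linarith [Real.exp_one_lt_d9]
  rw [le_div_iff₀ hx0] at h6
  have h8 : (G 1).re * (1 + x) ^ M ≤ ‖G 1‖ * (K2 ^ (4 * x) * 3) :=
    mul_le_mul ((le_abs_self _).trans (Complex.abs_re_le_norm _)) h7 (by positivity) (norm_nonneg _)
  have h9 : 0 ≤ ‖G 1‖ * K2 ^ (4 * x) := by positivity
  nlinarith

end

section

open Complex Filter Topology ComplexOrder

lemma alt_of_logDeriv (d : ℕ → ℂ) (hd : 0 ≤ d) (hs : ∀ s : ℂ, 1 < s.re → LSeriesSummable d s)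
    (F : ℂ → ℂ) (hF : ∀ s : ℂ, 1 < s.re → HasDerivAt F (-LSeries d s * F s) s)
    (h2 : 0 ≤ F 2) (m : ℕ) : 0 ≤ (-1) ^ m * iteratedDeriv m F 2 := by
  have hopen : IsOpen {s : ℂ | 1 < s.re} := isOpen_lt continuous_const continuous_re
  have hmem : {s : ℂ | 1 < s.re} ∈ 𝓝 (2 : ℂ) := hopen.mem_nhds (by norm_num)
  have habs : LSeries.abscissaOfAbsConv d < ((2 : ℝ) : EReal) := by
    have h1 : LSeries.abscissaOfAbsConv d ≤ (1 : ℝ) :=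
      LSeries.abscissaOfAbsConv_le_of_forall_lt_LSeriesSummable (fun y hy => hs y (by simpa using hy))
    exact lt_of_le_of_lt h1 (by exact_mod_cast one_lt_two)
  have hFa : AnalyticAt ℂ F 2 := by
    apply DifferentiableOn.analyticAt (s := {s : ℂ | 1 < s.re}) _ hmem
    intro s hs'
    exact (hF s hs').differentiableAt.differentiableWithinAt
  have hDa : AnalyticAt ℂ (LSeries d) 2 := by
    apply DifferentiableOn.analyticAt (s := {s : ℂ | 1 < s.re}) _ hmem
    intro s hs'
    refine (LSeries_differentiableOn d).differentiableAt ?_ |>.differentiableWithinAt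
    have h1 : LSeries.abscissaOfAbsConv d ≤ (1 : ℝ) :=
      LSeries.abscissaOfAbsConv_le_of_forall_lt_LSeriesSummable (fun y hy => hs y (by simpa using hy))
    refine (isOpen_lt continuous_const (continuous_coe_real_ereal.comp continuous_re)).mem_nhds ?_
    exact lt_of_le_of_lt h1 (EReal.coe_lt_coe_iff.2 hs')
  have hD : ∀ i : ℕ, 0 ≤ (-1) ^ i * iteratedDeriv i (LSeries d) 2 := by
    intro i
    have := LSeries.iteratedDeriv_alternating hd (x := 2) habs i
    simpa using this
  induction m using Nat.strong_induction_on with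
  | _ m ih =>
    rcases m with _ | m
    · simpa using h2
    · have e : deriv F =ᶠ[𝓝 2] fun s => -(LSeries d s * F s) := by
        filter_upwards [hmem] with s hs'
        rw [(hF s hs').deriv]; ring
      rw [iteratedDeriv_succ', e.iteratedDeriv_eq, iteratedDeriv_fun_neg,
        iteratedDeriv_fun_mul hDa.contDiffAt hFa.contDiffAt]
      have : (-1 : ℂ) ^ (m + 1) * -∑ i ∈ Finset.range (m + 1), ((m.choose i : ℕ) : ℂ) *
          iteratedDeriv i (LSeries d) 2 * iteratedDeriv (m - i) F 2 =
          ∑ i ∈ Finset.range (m + 1), ((m.choose i : ℕ) : ℂ) *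
          (((-1) ^ i * iteratedDeriv i (LSeries d) 2) * ((-1) ^ (m - i) * iteratedDeriv (m - i) F 2)) := by
        rw [pow_succ, mul_neg_one, neg_mul_neg, Finset.mul_sum]
        apply Finset.sum_congr rfl
        intro i hi
        have hi' : i ≤ m := by simpa [Nat.lt_succ_iff] using hi
        have : (-1 : ℂ) ^ m = (-1) ^ i * (-1) ^ (m - i) := by rw [← pow_add]; congr 1; omega
        rw [this]; ring
      rw [this]
      apply Finset.sum_nonneg
      intro i hi
      refine mul_nonneg (by exact_mod_cast Nat.zero_le _) (mul_nonneg (hD i) (ih _ ?_))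
      omega

lemma quad_values {q : ℕ} (χ : DirichletCharacter ℂ q) (h : χ ^ 2 = 1) (a : ZMod q) :
    χ a = 0 ∨ χ a = 1 ∨ χ a = -1 := by
  by_cases ha : IsUnit a
  · right
    have : χ a ^ 2 = 1 := by
      rw [← MulChar.pow_apply' _ two_ne_zero, h, MulChar.one_apply ha]
    have : (χ a - 1) * (χ a + 1) = 0 := by linear_combination this
    rcases mul_eq_zero.1 this with h | h
    · left; linear_combination h
    · right; linear_combination h
  · left; exact χ.map_nonunit ha

lemma quad_conj {q : ℕ} (χ : DirichletCharacter ℂ q) (h : χ ^ 2 = 1) (a : ZMod q) :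
    (starRingEnd ℂ) (χ a) = χ a := by
  rcases quad_values χ h a with h | h | h <;> simp [h]

lemma LF_real {q : ℕ} [NeZero q] (χ : DirichletCharacter ℂ q) (h : χ ^ 2 = 1) (h1 : χ ≠ 1)
    (σ : ℝ) (hσ : 0 < σ) : (DirichletCharacter.LFunction χ σ).im = 0 := by
  rw [LFunction_trunc q χ h1 0 σ (by simpa using hσ)]
  rw [← Complex.conj_eq_iff_im]
  simp only [Finset.Icc_eq_empty_of_lt zero_lt_one, Finset.sum_empty, zero_add, map_mul,
    Complex.conj_ofReal]
  congr 1
  rw [swI, ← integral_conj]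
  apply MeasureTheory.setIntegral_congr_fun measurableSet_Ioi
  intro t ht
  have ht0 : (0 : ℝ) ≤ t := by have : (1 : ℝ) < t := ht; linarith
  simp only [map_mul, map_sum]
  congr 1
  · apply Finset.sum_congr rfl
    intro k _
    unfold swTail
    split_ifs <;> simp [quad_conj χ h]
  · have : (t : ℂ) ^ (-((σ : ℂ) + 1)) = ((t ^ (-(σ + 1)) : ℝ) : ℂ) := by
      rw [Complex.ofReal_cpow ht0]; push_cast; rfl
    rw [this, Complex.conj_ofReal]

lemma LF_sphere {q : ℕ} [NeZero q] (χ : DirichletCharacter ℂ q) (h1 : χ ≠ 1)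
    (s : ℂ) (hs : s ∈ Metric.sphere (2 : ℂ) (3 / 2)) :
    ‖DirichletCharacter.LFunction χ s‖ ≤ 100 * q := by
  rw [mem_sphere_iff_norm] at hs
  have hq : (1 : ℝ) ≤ q := by exact_mod_cast NeZero.one_le
  have hre : 1 / 2 ≤ s.re := by
    have := Complex.abs_re_le_norm (s - 2)
    rw [hs] at this
    have := (abs_le.1 this).1
    simp at this
    linarith
  have hns : ‖s‖ ≤ 7 / 2 := by
    calc ‖s‖ = ‖(s - 2) + 2‖ := by ring_nf
      _ ≤ ‖s - 2‖ + ‖(2 : ℂ)‖ := norm_add_le _ _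
      _ = _ := by rw [hs]; norm_num
  rw [LFunction_trunc q χ h1 1 s (by linarith)]
  have hb := swI_norm_le (swTail 1 fun n => χ n) (2 * (4 * q)) 1 le_rfl
    (swTail_bound 1 _ _ (sw_char_sum_nontriv q χ h1)) (by intro k hk; simp [swTail, hk]) s
    (by linarith)
  have hb2 : ‖swI (swTail 1 fun n => χ n) s‖ ≤ 16 * q := by
    refine hb.trans ?_
    rw [Nat.cast_one, Real.one_rpow, div_le_iff₀ (by linarith)]
    nlinarith
  refine (norm_add_le _ _).trans ?_
  rw [norm_mul]
  have : ‖s‖ * ‖swI (swTail 1 fun n => χ n) s‖ ≤ 7 / 2 * (16 * q) :=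
    mul_le_mul hns hb2 (norm_nonneg _) (by norm_num)
  simp
  linarith

lemma LF_two_ge {q : ℕ} [NeZero q] (χ : DirichletCharacter ℂ q) :
    7 / 20 ≤ (DirichletCharacter.LFunction χ 2).re := by
  have h2 : (1 : ℝ) < (2 : ℂ).re := by norm_num
  rw [DirichletCharacter.LFunction_eq_LSeries χ h2, LSeries]
  have hs : Summable (fun n => LSeries.term (fun x => χ x) 2 n) :=
    DirichletCharacter.LSeriesSummable_of_one_lt_re χ h2
  rw [Complex.re_tsum hs]
  have hs' := (Complex.hasSum_re hs.hasSum).summable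
  have hz : HasSum (fun n : ℕ => 1 / (n : ℝ) ^ 2) (Real.pi ^ 2 / 6) := hasSum_zeta_two
  have h3 : ∀ n : ℕ, (if n = 1 then 2 else 0) - 1 / (n : ℝ) ^ 2 ≤
      (LSeries.term (fun x => χ x) 2 n).re := by
    intro n
    rcases eq_or_ne n 0 with rfl | hn
    · simp
    · by_cases h : n = 1
      · subst h; simp [LSeries.term]; norm_num
      · rw [if_neg h]
        have : ‖LSeries.term (fun x => χ x) 2 n‖ ≤ 1 / (n : ℝ) ^ 2 := by
          rw [LSeries.norm_term_eq, if_neg hn]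
          have e : (2 : ℂ).re = ((2 : ℕ) : ℝ) := by simp
          rw [e, Real.rpow_natCast]
          gcongr
          exact χ.norm_le_one _
        have h4 := (Complex.abs_re_le_norm _).trans this
        have := (abs_le.1 h4).1
        linarith
  have h5 := hasSum_le h3 ((hasSum_ite_eq 1 (2 : ℝ)).sub hz) hs'.hasSum
  have h6 : Real.pi ^ 2 < 9.9 := by nlinarith [Real.pi_lt_d4, Real.pi_pos]
  linarith

lemma LF_hasDeriv {q : ℕ} [NeZero q] (χ : DirichletCharacter ℂ q) (s : ℂ) (hs : 1 < s.re) :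
    HasDerivAt (DirichletCharacter.LFunction χ)
      (-LSeries ((fun n : ℕ => χ n) * fun n => (ArithmeticFunction.vonMangoldt n : ℂ)) s *
        DirichletCharacter.LFunction χ s) s := by
  have hne : s ≠ 1 := by rintro rfl; simp at hs
  have h1 : DifferentiableAt ℂ (DirichletCharacter.LFunction χ) s :=
    DirichletCharacter.differentiableAt_LFunction χ s (.inl hne)
  have h0 := DirichletCharacter.LFunction_ne_zero_of_one_le_re χ (.inr hne) hs.le
  refine h1.hasDerivAt.congr_deriv ?_
  rw [DirichletCharacter.LSeries_twist_vonMangoldt_eq χ hs,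
    ← DirichletCharacter.LFunction_eq_LSeries χ hs,
    ← DirichletCharacter.deriv_LFunction_eq_deriv_LSeries χ hs]
  field_simp

lemma zeta_hasDeriv (s : ℂ) (hs : 1 < s.re) :
    HasDerivAt riemannZeta
      (-LSeries (fun n => (ArithmeticFunction.vonMangoldt n : ℂ)) s * riemannZeta s) s := by
  have hne : s ≠ 1 := by rintro rfl; simp at hs
  have h1 : DifferentiableAt ℂ riemannZeta s := differentiableAt_riemannZeta hne
  have h0 := riemannZeta_ne_zero_of_one_le_re hs.le
  refine h1.hasDerivAt.congr_deriv ?_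
  rw [ArithmeticFunction.LSeries_vonMangoldt_eq_deriv_riemannZeta_div hs]
  field_simp

end

section

open Complex Filter Topology ComplexOrder

lemma vM_nonneg_mul {c : ℂ} (hc : 0 ≤ c) (n : ℕ) :
    0 ≤ c * (ArithmeticFunction.vonMangoldt n : ℂ) :=
  mul_nonneg hc (by exact_mod_cast ArithmeticFunction.vonMangoldt_nonneg)

lemma LF_two_real {q : ℕ} [NeZero q] (χ : DirichletCharacter ℂ q) (h : χ ^ 2 = 1) (h1 : χ ≠ 1) :
    ∃ r : ℝ, 7 / 20 ≤ r ∧ DirichletCharacter.LFunction χ 2 = r := by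
  refine ⟨_, LF_two_ge χ, ?_⟩
  have := LF_real χ h h1 2 (by norm_num)
  apply Complex.ext
  · simp
  · simpa using this

lemma zeta_two_real : ∃ r : ℝ, 1 ≤ r ∧ riemannZeta 2 = r := by
  refine ⟨Real.pi ^ 2 / 6, ?_, ?_⟩
  · nlinarith [Real.pi_gt_three]
  · rw [riemannZeta_two]; push_cast; rfl

lemma twist_summable {q : ℕ} (χ : DirichletCharacter ℂ q) (s : ℂ) (hs : 1 < s.re) :
    LSeriesSummable ((fun n : ℕ => χ n) * fun n => (ArithmeticFunction.vonMangoldt n : ℂ)) s :=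
  DirichletCharacter.LSeriesSummable_twist_vonMangoldt χ hs

lemma siegel_alt1 {q : ℕ} [NeZero q] (χ : DirichletCharacter ℂ q) (h : χ ^ 2 = 1) (h1 : χ ≠ 1) :
    (∀ m : ℕ, 0 ≤ ((-1) ^ m * iteratedDeriv m
      (fun s => riemannZeta s * DirichletCharacter.LFunction χ s) 2).re) ∧
    1 / 25 ≤ (riemannZeta 2 * DirichletCharacter.LFunction χ 2).re := by
  obtain ⟨r, hr, er⟩ := LF_two_real χ h h1
  obtain ⟨z, hz, ez⟩ := zeta_two_real
  have hzr : (riemannZeta 2 * DirichletCharacter.LFunction χ 2) = ((z * r : ℝ) : ℂ) := by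
    rw [er, ez]; push_cast; rfl
  refine ⟨fun m => ?_, ?_⟩
  · have := alt_of_logDeriv ((fun n => (ArithmeticFunction.vonMangoldt n : ℂ)) +
      ((fun n : ℕ => χ n) * fun n => (ArithmeticFunction.vonMangoldt n : ℂ))) ?_ ?_
      (fun s => riemannZeta s * DirichletCharacter.LFunction χ s) ?_ ?_ m
    · exact (Complex.le_def.1 this).1
    · intro n
      have e : ((fun n => (ArithmeticFunction.vonMangoldt n : ℂ)) +
        ((fun n : ℕ => χ n) * fun n => (ArithmeticFunction.vonMangoldt n : ℂ))) n =
        (1 + χ n) * (ArithmeticFunction.vonMangoldt n : ℂ) := by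
        simp only [Pi.add_apply, Pi.mul_apply]; ring
      rw [e]
      apply vM_nonneg_mul
      rcases quad_values χ h n with e | e | e <;> rw [e] <;> norm_num
    · intro s hs
      exact (ArithmeticFunction.LSeriesSummable_vonMangoldt hs).add (twist_summable χ s hs)
    · intro s hs
      refine ((zeta_hasDeriv s hs).mul (LF_hasDeriv χ s hs)).congr_deriv ?_
      rw [LSeries_add (ArithmeticFunction.LSeriesSummable_vonMangoldt hs) (twist_summable χ s hs)]
      ring
    · show 0 ≤ riemannZeta 2 * DirichletCharacter.LFunction χ 2
      rw [hzr]
      have : 0 ≤ z * r := by positivity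
      exact_mod_cast this
  · rw [hzr, Complex.ofReal_re]; nlinarith

lemma siegel_alt2 {q₁ q₂ q : ℕ} [NeZero q₁] [NeZero q₂] [NeZero q] (χ₁ : DirichletCharacter ℂ q₁)
    (χ₂ : DirichletCharacter ℂ q₂) (χ : DirichletCharacter ℂ q) (hm : ∀ n : ℕ, χ n = χ₁ n * χ₂ n)
    (h₁ : χ₁ ^ 2 = 1) (h₁' : χ₁ ≠ 1) (h₂ : χ₂ ^ 2 = 1) (h₂' : χ₂ ≠ 1) (h : χ ^ 2 = 1)
    (h' : χ ≠ 1) :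
    (∀ m : ℕ, 0 ≤ ((-1) ^ m * iteratedDeriv m
      (fun s => riemannZeta s * (DirichletCharacter.LFunction χ₁ s * DirichletCharacter.LFunction χ₂ s
        * DirichletCharacter.LFunction χ s)) 2).re) ∧
    1 / 25 ≤ (riemannZeta 2 * (DirichletCharacter.LFunction χ₁ 2 * DirichletCharacter.LFunction χ₂ 2
        * DirichletCharacter.LFunction χ 2)).re := by
  obtain ⟨r, hr, er⟩ := LF_two_real χ h h'
  obtain ⟨r₁, hr₁, er₁⟩ := LF_two_real χ₁ h₁ h₁'
  obtain ⟨r₂, hr₂, er₂⟩ := LF_two_real χ₂ h₂ h₂'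
  obtain ⟨z, hz, ez⟩ := zeta_two_real
  have hzr : (riemannZeta 2 * (DirichletCharacter.LFunction χ₁ 2 * DirichletCharacter.LFunction χ₂ 2
        * DirichletCharacter.LFunction χ 2)) = ((z * (r₁ * r₂ * r) : ℝ) : ℂ) := by
    rw [er, er₁, er₂, ez]; push_cast; rfl
  refine ⟨fun m => ?_, ?_⟩
  · have := alt_of_logDeriv (((fun n => (ArithmeticFunction.vonMangoldt n : ℂ)) +
      ((fun n : ℕ => χ₁ n) * fun n => (ArithmeticFunction.vonMangoldt n : ℂ))) +
      (((fun n : ℕ => χ₂ n) * fun n => (ArithmeticFunction.vonMangoldt n : ℂ)) +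
      ((fun n : ℕ => χ n) * fun n => (ArithmeticFunction.vonMangoldt n : ℂ)))) ?_ ?_
      (fun s => riemannZeta s * (DirichletCharacter.LFunction χ₁ s * DirichletCharacter.LFunction χ₂ s
        * DirichletCharacter.LFunction χ s)) ?_ ?_ m
    · exact (Complex.le_def.1 this).1
    · intro n
      have e : (((fun n => (ArithmeticFunction.vonMangoldt n : ℂ)) +
      ((fun n : ℕ => χ₁ n) * fun n => (ArithmeticFunction.vonMangoldt n : ℂ))) +
      (((fun n : ℕ => χ₂ n) * fun n => (ArithmeticFunction.vonMangoldt n : ℂ)) +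
      ((fun n : ℕ => χ n) * fun n => (ArithmeticFunction.vonMangoldt n : ℂ)))) n =
        ((1 + χ₁ n) * (1 + χ₂ n)) * (ArithmeticFunction.vonMangoldt n : ℂ) := by
        simp only [Pi.add_apply, Pi.mul_apply, hm]; ring
      rw [e]
      apply vM_nonneg_mul
      apply mul_nonneg
      · rcases quad_values χ₁ h₁ n with e | e | e <;> rw [e] <;> norm_num
      · rcases quad_values χ₂ h₂ n with e | e | e <;> rw [e] <;> norm_num
    · intro s hs
      exact ((ArithmeticFunction.LSeriesSummable_vonMangoldt hs).add (twist_summable χ₁ s hs)).add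
        ((twist_summable χ₂ s hs).add (twist_summable χ s hs))
    · intro s hs
      refine ((zeta_hasDeriv s hs).mul (((LF_hasDeriv χ₁ s hs).mul (LF_hasDeriv χ₂ s hs)).mul
        (LF_hasDeriv χ s hs))).congr_deriv ?_
      rw [LSeries_add ((ArithmeticFunction.LSeriesSummable_vonMangoldt hs).add (twist_summable χ₁ s hs))
        ((twist_summable χ₂ s hs).add (twist_summable χ s hs)),
        LSeries_add (ArithmeticFunction.LSeriesSummable_vonMangoldt hs) (twist_summable χ₁ s hs),
        LSeries_add (twist_summable χ₂ s hs) (twist_summable χ s hs)]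
      simp only [Pi.mul_apply]
      ring
    · show 0 ≤ (riemannZeta 2 * (DirichletCharacter.LFunction χ₁ 2 * DirichletCharacter.LFunction χ₂ 2
        * DirichletCharacter.LFunction χ 2))
      rw [hzr]
      have : 0 ≤ z * (r₁ * r₂ * r) := by positivity
      exact_mod_cast this
  · rw [hzr, Complex.ofReal_re]
    calc (1 : ℝ) / 25 ≤ 1 * ((7 / 20) * (7 / 20) * (7 / 20)) := by norm_num
      _ ≤ _ := by gcongr

lemma prod_char {q₁ q₂ : ℕ} [NeZero q₁] [NeZero q₂] (χ₁ : DirichletCharacter ℂ q₁)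
    (χ₂ : DirichletCharacter ℂ q₂) (hp₁ : χ₁.IsPrimitive) (hp₂ : χ₂.IsPrimitive)
    (hne : q₁ ≠ q₂) (h₁ : χ₁ ^ 2 = 1) (h₂ : χ₂ ^ 2 = 1) :
    ∃ χ : DirichletCharacter ℂ (q₁ * q₂), (∀ n : ℕ, χ n = χ₁ n * χ₂ n) ∧ χ ^ 2 = 1 ∧ χ ≠ 1 := by
  refine ⟨DirichletCharacter.changeLevel (dvd_mul_right q₁ q₂) χ₁ *
    DirichletCharacter.changeLevel (dvd_mul_left q₂ q₁) χ₂, ?_, ?_, ?_⟩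
  · intro n
    by_cases hn : IsCoprime (n : ℤ) ((q₁ * q₂ : ℕ) : ℤ)
    · have e1 := DirichletCharacter.changeLevel_eq_cast_of_dvd' χ₁ (dvd_mul_right q₁ q₂) hn
      have e2 := DirichletCharacter.changeLevel_eq_cast_of_dvd' χ₂ (dvd_mul_left q₂ q₁) hn
      rw [MulChar.mul_apply]
      push_cast at e1 e2
      rw [e1, e2]
    · have hn' : ¬ (n.Coprime (q₁ * q₂)) := by rwa [← Nat.isCoprime_iff_coprime]
      have e0 : ¬ IsUnit ((n : ZMod (q₁ * q₂))) := by rwa [ZMod.isUnit_iff_coprime]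
      rw [MulChar.mul_apply, MulChar.map_nonunit _ e0, zero_mul]
      rw [Nat.coprime_mul_iff_right, not_and_or] at hn'
      rcases hn' with h | h
      · have : ¬ IsUnit ((n : ZMod q₁)) := by rwa [ZMod.isUnit_iff_coprime]
        rw [MulChar.map_nonunit _ this, zero_mul]
      · have : ¬ IsUnit ((n : ZMod q₂)) := by rwa [ZMod.isUnit_iff_coprime]
        rw [MulChar.map_nonunit _ this, mul_zero]
  · rw [mul_pow, ← map_pow, ← map_pow, h₁, h₂, map_one, map_one, one_mul]
  · intro h
    have h3 : DirichletCharacter.changeLevel (dvd_mul_right q₁ q₂) χ₁ =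
        DirichletCharacter.changeLevel (dvd_mul_left q₂ q₁) χ₂ := by
      have e : DirichletCharacter.changeLevel (dvd_mul_left q₂ q₁) χ₂ *
          DirichletCharacter.changeLevel (dvd_mul_left q₂ q₁) χ₂ = 1 := by
        rw [← map_mul, ← sq, h₂, map_one]
      calc _ = DirichletCharacter.changeLevel (dvd_mul_right q₁ q₂) χ₁ *
        (DirichletCharacter.changeLevel (dvd_mul_left q₂ q₁) χ₂ *
          DirichletCharacter.changeLevel (dvd_mul_left q₂ q₁) χ₂) := by rw [e, mul_one]
        _ = _ := by rw [← mul_assoc, h, one_mul]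
    have h4 := DirichletCharacter.factorsThrough_gcd χ₁ χ₂ h3
    have h5 : q₁ ≤ q₁.gcd q₂ := by
      have : χ₁.conductor ≤ _ := Nat.sInf_le ((DirichletCharacter.mem_conductorSet_iff _).2 h4)
      rwa [hp₁] at this
    have h6 : q₁ ∣ q₂ := by
      have : q₁.gcd q₂ = q₁ := le_antisymm (Nat.le_of_dvd (NeZero.pos q₁) (Nat.gcd_dvd_left _ _)) h5
      exact Nat.gcd_eq_left_iff_dvd.1 this
    have h7 : DirichletCharacter.changeLevel h6 χ₁ = χ₂ := by
      apply DirichletCharacter.changeLevel_injective (dvd_mul_left q₂ q₁)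
      rw [← DirichletCharacter.changeLevel_trans]
      exact h3
    have h8 : χ₂.conductor ≤ q₁ := Nat.sInf_le ((DirichletCharacter.mem_conductorSet_iff _).2
      ⟨h6, χ₁, h7.symm⟩)
    rw [hp₂] at h8
    exact hne (le_antisymm (Nat.le_of_dvd (NeZero.pos q₂) h6) h8)

lemma zeta_neg_near_one : ∃ η : ℝ, 0 < η ∧ ∀ β : ℝ, 1 - η < β → β < 1 →
    (riemannZeta β).re < 0 := by
  obtain ⟨Z, hZ, hZ1, hZs⟩ := zeta_entire
  have hc : Continuous fun β : ℝ => (Z β).re :=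
    Complex.continuous_re.comp (hZ.continuous.comp Complex.continuous_ofReal)
  have : ∀ᶠ β : ℝ in 𝓝 (1 : ℝ), 0 < (Z (β : ℂ)).re := by
    apply hc.continuousAt.eventually (lt_mem_nhds _)
    simp [hZ1]
  obtain ⟨η, hη, h⟩ := Metric.eventually_nhds_iff.1 this
  refine ⟨η, hη, fun β h1 h2 => ?_⟩
  have h3 := h (y := β) (by rw [Real.dist_eq, abs_lt]; constructor <;> linarith)
  rw [hZs β (by exact_mod_cast h2.ne)] at h3
  have e : ((β : ℂ) - 1) = ((β - 1 : ℝ) : ℂ) := by push_cast; rfl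
  rw [e, Complex.re_ofReal_mul] at h3
  by_contra h4
  push Not at h4
  nlinarith

lemma LF_pos_of_no_zero {q : ℕ} [NeZero q] (χ : DirichletCharacter ℂ q) (h : χ ^ 2 = 1) (h1 : χ ≠ 1)
    (β : ℝ) (hβ : 0 < β) (hβ2 : β ≤ 2)
    (hz : ∀ σ : ℝ, β ≤ σ → σ < 1 → DirichletCharacter.LFunction χ σ ≠ 0) :
    0 < (DirichletCharacter.LFunction χ β).re := by
  by_contra hneg
  push Not at hneg
  have hc : Continuous fun σ : ℝ => (DirichletCharacter.LFunction χ σ).re :=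
    Complex.continuous_re.comp
      ((DirichletCharacter.differentiable_LFunction h1).continuous.comp Complex.continuous_ofReal)
  have h2 := LF_two_ge χ
  obtain ⟨σ, hσ, hσ0⟩ := intermediate_value_Icc hβ2 hc.continuousOn
    (show (0 : ℝ) ∈ Set.Icc _ _ from ⟨hneg, by push_cast; linarith⟩)
  have hσz : DirichletCharacter.LFunction χ σ = 0 := by
    apply Complex.ext
    · simpa using hσ0
    · simpa using LF_real χ h h1 σ (hβ.trans_le hσ.1)
  rcases lt_or_ge σ 1 with h3 | h3
  · exact hz σ hσ.1 h3 hσz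
  · exact DirichletCharacter.LFunction_ne_zero_of_one_le_re χ (.inl h1) (by simpa using h3) hσz

theorem siegel : SiegelStatement := by
  intro ε hε
  obtain ⟨C₀, hC₀, hest⟩ := estermann
  obtain ⟨η₀, hη₀, hζ⟩ := zeta_neg_near_one
  set η : ℝ := min (min η₀ (1 / 8)) (ε / 16) with hη
  have hη0 : 0 < η := by rw [hη]; positivity
  have hη1 : η ≤ η₀ := (min_le_left _ _).trans (min_le_left _ _)
  have hη2 : η ≤ 1 / 8 := (min_le_left _ _).trans (min_le_right _ _)
  have hη3 : η ≤ ε / 16 := min_le_right _ _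
  by_cases hcase : ∃ (q₁ : ℕ) (_ : NeZero q₁) (χ₁ : DirichletCharacter ℂ q₁) (β : ℝ),
      χ₁.IsPrimitive ∧ χ₁ ≠ 1 ∧ χ₁ ^ 2 = 1 ∧ 1 - η < β ∧ β < 1 ∧
      DirichletCharacter.LFunction χ₁ β = 0
  · obtain ⟨q₁, _, χ₁, β, hp₁, hne₁, hsq₁, hβ1, hβ2, hβ0⟩ := hcase
    obtain ⟨C₁, hC₁, hup⟩ := LF_deriv_bound 0 (ε / 2) (by positivity)
    have hq₁ : (1 : ℝ) ≤ q₁ := by exact_mod_cast NeZero.one_le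
    -- finite exceptional modulus
    obtain ⟨c', hc', hfin⟩ : ∃ c' : ℝ, 0 < c' ∧ ∀ χ : DirichletCharacter ℂ q₁, χ ≠ 1 →
        c' ≤ ‖DirichletCharacter.LFunction χ 1‖ := by
      classical
      obtain ⟨χ', h'⟩ := Finite.exists_min (fun χ : DirichletCharacter ℂ q₁ =>
        if χ = 1 then (1 : ℝ) else ‖DirichletCharacter.LFunction χ 1‖)
      refine ⟨_, ?_, fun χ hχ => (h' χ).trans (by rw [if_neg hχ])⟩
      split_ifs with h
      · norm_num
      · exact norm_pos_iff.2 (DirichletCharacter.LFunction_apply_one_ne_zero h)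
    set x := 1 - β with hx
    have hx0 : 0 < x := by linarith
    have hL1 : 0 < ‖DirichletCharacter.LFunction χ₁ 1‖ :=
      norm_pos_iff.2 (DirichletCharacter.LFunction_apply_one_ne_zero hne₁)
    set D : ℝ := (C₀ * (10 ^ 6 * q₁ ^ 2)) ^ (4 * x) * C₀ * ‖DirichletCharacter.LFunction χ₁ 1‖ *
      (C₁ * (q₁ * 2) ^ (ε / 2)) with hD
    have hD0 : 0 < D := by positivity
    refine ⟨min c' (x / D), by positivity, ?_⟩
    intro q _ χ hp hne hsq
    have hq : (1 : ℝ) ≤ q := by exact_mod_cast NeZero.one_le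
    by_cases hqq : q₁ = q
    · subst hqq
      have h1 : (1 : ℝ) ≤ (q₁ : ℝ) ^ ε := Real.one_le_rpow hq₁ hε.le
      refine (min_le_left _ _).trans ((hfin χ hne).trans ?_)
      exact le_mul_of_one_le_left (norm_nonneg _) h1
    · obtain ⟨ψ, hψm, hψ2, hψ1⟩ := prod_char χ₁ χ hp₁ hp hqq hsq₁ hsq
      have : NeZero (q₁ * q) := ⟨mul_ne_zero (NeZero.ne _) (NeZero.ne _)⟩
      obtain ⟨halt, hge⟩ := siegel_alt2 χ₁ χ ψ hψm hsq₁ hne₁ hsq hne hψ2 hψ1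
      have key := hest (fun s => DirichletCharacter.LFunction χ₁ s * DirichletCharacter.LFunction χ s
        * DirichletCharacter.LFunction ψ s) (10 ^ 6 * q₁ ^ 2 * q ^ 2)
        (((DirichletCharacter.differentiable_LFunction hne₁).mul
          (DirichletCharacter.differentiable_LFunction hne)).mul
          (DirichletCharacter.differentiable_LFunction hψ1)) ?_ ?_ halt hge β (by linarith) hβ2
          (by simp [hβ0])
      · have hψb := hup (q₁ * q) ψ hψ1 1 (by simp) (by simp)
        simp only [iteratedDeriv_zero, Complex.one_im, abs_zero, zero_add] at hψb
        simp only [norm_mul] at key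
        rw [← hx] at key
        have e1 : (C₀ * (10 ^ 6 * (q₁ : ℝ) ^ 2 * (q : ℝ) ^ 2)) ^ (4 * x) =
            (C₀ * (10 ^ 6 * q₁ ^ 2)) ^ (4 * x) * (q : ℝ) ^ (8 * x) := by
          rw [← mul_assoc, Real.mul_rpow (by positivity) (by positivity), ← Real.rpow_natCast (q : ℝ) 2,
            ← Real.rpow_mul (by positivity) _ (4 * x)]
          congr 2
          push_cast; ring
        have e2 : (q : ℝ) ^ (8 * x) ≤ (q : ℝ) ^ (ε / 2) :=
          Real.rpow_le_rpow_of_exponent_le hq (by linarith)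
        have e3 : (((q₁ * q : ℕ) : ℝ) * 2) ^ (ε / 2) = (q₁ * 2) ^ (ε / 2) * (q : ℝ) ^ (ε / 2) := by
          rw [← Real.mul_rpow (by positivity) (by positivity)]
          congr 1; push_cast; ring
        rw [e3] at hψb
        rw [e1] at key
        have e4 : (q : ℝ) ^ ε = (q : ℝ) ^ (ε / 2) * (q : ℝ) ^ (ε / 2) := by
          rw [← Real.rpow_add (by linarith)]; congr 1; ring
        refine (min_le_right _ _).trans ?_
        rw [div_le_iff₀ hD0]
        refine key.trans ?_
        calc _ ≤ (C₀ * (10 ^ 6 * q₁ ^ 2)) ^ (4 * x) * (q : ℝ) ^ (ε / 2) * C₀ *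
            (‖DirichletCharacter.LFunction χ₁ 1‖ * ‖DirichletCharacter.LFunction χ 1‖ *
            (C₁ * ((q₁ * 2) ^ (ε / 2) * (q : ℝ) ^ (ε / 2)))) := by gcongr
          _ = _ := by rw [hD, e4]; ring
      · have : (1 : ℝ) ≤ (q₁ : ℝ) ^ 2 := one_le_pow₀ hq₁
        have : (1 : ℝ) ≤ (q : ℝ) ^ 2 := one_le_pow₀ hq
        nlinarith
      · intro z hz
        simp only [norm_mul]
        have a1 := LF_sphere χ₁ hne₁ z hz
        have a2 := LF_sphere χ hne z hz
        have a3 := LF_sphere ψ hψ1 z hz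
        calc _ ≤ (100 * (q₁ : ℝ)) * (100 * q) * (100 * ((q₁ * q : ℕ) : ℝ)) := by gcongr
          _ = _ := by push_cast; ring
  · push Not at hcase
    set β : ℝ := 1 - η / 2 with hβ
    set D : ℝ := (C₀ * 100) ^ (4 * (1 - β)) * C₀ with hD
    have hD0 : 0 < D := by positivity
    refine ⟨(1 - β) / D, div_pos (by linarith) hD0, ?_⟩
    intro q _ χ hp hne hsq
    have hq : (1 : ℝ) ≤ q := by exact_mod_cast NeZero.one_le
    obtain ⟨halt, hge⟩ := siegel_alt1 χ hsq hne
    have hpos := LF_pos_of_no_zero χ hsq hne β (by linarith) (by linarith)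
      (fun σ h1 h2 => hcase q ‹_› χ σ hp hne hsq (by linarith) h2)
    have him := LF_real χ hsq hne β (by linarith)
    have key := hest (DirichletCharacter.LFunction χ) (100 * q)
      (DirichletCharacter.differentiable_LFunction hne) (by linarith) (LF_sphere χ hne)
      halt hge β (by linarith) (by linarith) (by
        rw [Complex.mul_re, him, mul_zero, sub_zero]
        exact (mul_neg_of_neg_of_pos (hζ β (by linarith) (by linarith)) hpos).le)
    rw [div_le_iff₀ hD0]
    refine key.trans ?_
    have e2 : (q : ℝ) ^ (4 * (1 - β)) ≤ (q : ℝ) ^ ε :=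
      Real.rpow_le_rpow_of_exponent_le hq (by linarith)
    rw [← mul_assoc, Real.mul_rpow (by positivity) (by positivity)]
    calc _ ≤ (C₀ * 100) ^ (4 * (1 - β)) * (q : ℝ) ^ ε * C₀ * ‖DirichletCharacter.LFunction χ 1‖ := by
          gcongr
      _ = _ := by rw [hD]; ring

end

section

open Complex Filter Topology

/-- The twisted von Mangoldt function. -/
noncomputable def tvM {q : ℕ} (χ : DirichletCharacter ℂ q) : ℕ → ℂ :=
  (fun n : ℕ => χ n) * fun n => (ArithmeticFunction.vonMangoldt n : ℂ)

lemma tvM_abscissa {q : ℕ} (χ : DirichletCharacter ℂ q) (s : ℂ) (hs : 1 < s.re) :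
    LSeries.abscissaOfAbsConv (tvM χ) < s.re := by
  have h1 : LSeries.abscissaOfAbsConv (tvM χ) ≤ (1 : ℝ) :=
    LSeries.abscissaOfAbsConv_le_of_forall_lt_LSeriesSummable
      (fun y hy => twist_summable χ y (by simpa using hy))
  exact lt_of_le_of_lt h1 (EReal.coe_lt_coe_iff.2 hs)

lemma tvM_analytic {q : ℕ} (χ : DirichletCharacter ℂ q) (s : ℂ) (hs : 1 < s.re) :
    AnalyticAt ℂ (LSeries (tvM χ)) s :=
  LSeries_analyticOnNhd (tvM χ) s (tvM_abscissa χ s hs)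

lemma logDeriv_bound (k : ℕ) : ∀ ε : ℝ, 0 < ε → ∃ C : ℝ, 1 ≤ C ∧ ∀ (q : ℕ) [NeZero q]
    (χ : DirichletCharacter ℂ q), χ.IsPrimitive → χ ≠ 1 → ∀ s : ℂ, 1 < s.re → s.re ≤ 2 →
    ‖iteratedDeriv k (LSeries (tvM χ)) s‖ ≤ C * ((q : ℝ) * (|s.im| + 2)) ^ ε := by
  induction k using Nat.strong_induction_on with
  | _ k ih =>
    intro ε hε
    obtain ⟨C₁, hC₁, hlow⟩ := LF_lower siegel (ε / 3) (by positivity)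
    have hup := fun j => LF_deriv_bound j (ε / 3) (by positivity)
    choose U hU1 hU using hup
    have hih : ∀ i : ℕ, ∃ C : ℝ, 1 ≤ C ∧ (i < k → ∀ (q : ℕ) [NeZero q]
      (χ : DirichletCharacter ℂ q), χ.IsPrimitive → χ ≠ 1 → ∀ s : ℂ, 1 < s.re → s.re ≤ 2 →
      ‖iteratedDeriv i (LSeries (tvM χ)) s‖ ≤ C * ((q : ℝ) * (|s.im| + 2)) ^ (ε / 3)) := by
      intro i
      by_cases hi : i < k
      · obtain ⟨C, h1, h2⟩ := ih i hi (ε / 3) (by positivity)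
        exact ⟨C, h1, fun _ => h2⟩
      · exact ⟨1, le_rfl, fun h => absurd h hi⟩
    choose V hV1 hV using hih
    set W : ℝ := U (k + 1) + ∑ i ∈ Finset.range k, (k.choose i : ℝ) * V i * U (k - i) with hW
    have hVUnn : 0 ≤ ∑ i ∈ Finset.range k, (k.choose i : ℝ) * V i * U (k - i) := by
      apply Finset.sum_nonneg
      intro i _
      have := hV1 i
      have := hU1 (k - i)
      positivity
    have hW1 : 1 ≤ W := by rw [hW]; linarith [hU1 (k + 1)]
    refine ⟨C₁ * W, one_le_mul_of_one_le_of_one_le hC₁ hW1, ?_⟩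
    intro q _ χ hp hne s hs1 hs2
    have hq : (1 : ℝ) ≤ q := by exact_mod_cast NeZero.one_le
    set Q : ℝ := (q : ℝ) * (|s.im| + 2) with hQ
    have hQ1 : 1 ≤ Q := by nlinarith [abs_nonneg s.im]
    set Y := Q ^ (ε / 3) with hY
    have hY1 : 1 ≤ Y := Real.one_le_rpow hQ1 (by positivity)
    have hY3 : Q ^ ε = Y * Y * Y := by
      rw [hY, ← Real.rpow_add (by linarith), ← Real.rpow_add (by linarith)]; congr 1; ring
    have hopen : {s : ℂ | 1 < s.re} ∈ 𝓝 s :=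
      (isOpen_lt continuous_const continuous_re).mem_nhds hs1
    have hLan : AnalyticAt ℂ (DirichletCharacter.LFunction χ) s :=
      (DirichletCharacter.differentiable_LFunction hne).analyticAt s
    have e : deriv (DirichletCharacter.LFunction χ) =ᶠ[𝓝 s]
        fun z => -(LSeries (tvM χ) z * DirichletCharacter.LFunction χ z) := by
      filter_upwards [hopen] with z hz
      rw [(LF_hasDeriv χ z hz).deriv, tvM]
      ring
    have h1 := e.iteratedDeriv_eq k
    rw [← iteratedDeriv_succ', iteratedDeriv_fun_neg,
      iteratedDeriv_fun_mul (tvM_analytic χ s hs1).contDiffAt hLan.contDiffAt,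
      Finset.sum_range_succ] at h1
    simp only [Nat.choose_self, Nat.cast_one, one_mul, Nat.sub_self, iteratedDeriv_zero] at h1
    set f := iteratedDeriv k (LSeries (tvM χ)) s with hf
    set L := DirichletCharacter.LFunction χ s with hL
    have h2 : f * L = -(iteratedDeriv (k + 1) (DirichletCharacter.LFunction χ) s +
      ∑ i ∈ Finset.range k, (k.choose i : ℂ) * iteratedDeriv i (LSeries (tvM χ)) s *
        iteratedDeriv (k - i) (DirichletCharacter.LFunction χ) s) := by
      linear_combination h1
    have h3 : ‖f‖ * ‖L‖ ≤ W * (Y * Y) := by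
      rw [← norm_mul, h2, norm_neg]
      refine (norm_add_le _ _).trans ?_
      have a1 : ‖iteratedDeriv (k + 1) (DirichletCharacter.LFunction χ) s‖ ≤ U (k + 1) * (Y * Y) := by
        refine (hU (k + 1) q χ hne s hs1.le hs2).trans ?_
        have := hU1 (k + 1)
        gcongr
        exact le_mul_of_one_le_left (by linarith) hY1
      have a2 : ‖∑ i ∈ Finset.range k, (k.choose i : ℂ) * iteratedDeriv i (LSeries (tvM χ)) s *
        iteratedDeriv (k - i) (DirichletCharacter.LFunction χ) s‖ ≤
        ∑ i ∈ Finset.range k, (k.choose i : ℝ) * V i * U (k - i) * (Y * Y) := by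
        refine (norm_sum_le _ _).trans (Finset.sum_le_sum ?_)
        intro i hi
        rw [norm_mul, norm_mul, RCLike.norm_natCast]
        have b1 := hV i (Finset.mem_range.1 hi) q χ hp hne s hs1 hs2
        have b2 := hU (k - i) q χ hne s hs1.le hs2
        have := hV1 i
        have := hU1 (k - i)
        calc _ ≤ (k.choose i : ℝ) * (V i * Y) * (U (k - i) * Y) := by gcongr
          _ = _ := by ring
      rw [← Finset.sum_mul] at a2
      rw [hW]; linarith
    have h4 := hlow q χ hp hne s hs1 hs2
    have h5 : ‖f‖ ≤ ‖f‖ * (C₁ * Y * ‖L‖) := le_mul_of_one_le_right (norm_nonneg _) h4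
    calc ‖f‖ ≤ C₁ * Y * (‖f‖ * ‖L‖) := by linarith
      _ ≤ C₁ * Y * (W * (Y * Y)) := by gcongr
      _ = _ := by rw [hY3]; ring

/-- Coefficients `χ(n) Λ(n) (log n)^k`. -/
noncomputable def tvMk {q : ℕ} (k : ℕ) (χ : DirichletCharacter ℂ q) (n : ℕ) : ℂ :=
  (Real.log n : ℂ) ^ k * (χ n * (ArithmeticFunction.vonMangoldt n : ℂ))

lemma logMul_iter (f : ℕ → ℂ) (k : ℕ) (n : ℕ) :
    (LSeries.logMul^[k] f) n = (Real.log n : ℂ) ^ k * f n := by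
  induction k with
  | zero => simp
  | succ k ih =>
    rw [Function.iterate_succ_apply', LSeries.logMul, ih, ← Complex.natCast_log]
    ring

lemma tvMk_eq {q : ℕ} (k : ℕ) (χ : DirichletCharacter ℂ q) :
    LSeries.logMul^[k] (tvM χ) = tvMk k χ := by
  ext n; rw [logMul_iter]; rfl

lemma tvMk_summable {q : ℕ} (k : ℕ) (χ : DirichletCharacter ℂ q) (s : ℂ) (hs : 1 < s.re) :
    LSeriesSummable (tvMk k χ) s := by
  rw [← tvMk_eq]
  apply LSeriesSummable_of_abscissaOfAbsConv_lt_re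
  rw [LSeries.absicssaOfAbsConv_logPowMul]
  exact tvM_abscissa χ s hs

lemma tvMk_bound (k : ℕ) (ε : ℝ) (hε : 0 < ε) : ∃ C : ℝ, 1 ≤ C ∧ ∀ (q : ℕ) [NeZero q]
    (χ : DirichletCharacter ℂ q), χ.IsPrimitive → χ ≠ 1 → ∀ s : ℂ, 1 < s.re → s.re ≤ 2 →
    ‖LSeries (tvMk k χ) s‖ ≤ C * ((q : ℝ) * (|s.im| + 2)) ^ ε := by
  obtain ⟨C, hC, h⟩ := logDeriv_bound k ε hε
  refine ⟨C, hC, ?_⟩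
  intro q _ χ hp hne s hs1 hs2
  have := h q χ hp hne s hs1 hs2
  rw [LSeries_iteratedDeriv k (tvM_abscissa χ s hs1), norm_mul, norm_pow, norm_neg, norm_one,
    one_pow, one_mul, tvMk_eq] at this
  exact this

end

section

open Complex Filter Topology MeasureTheory Set

/-- Riesz weight. -/
noncomputable def rzw (t : ℝ) : ℂ :=
  (Set.Ioc (0 : ℝ) 1).indicator (fun _ => (1 : ℂ)) t - (Set.Ioc (0 : ℝ) 1).indicator (fun t => (t : ℂ) ^ (1 : ℂ)) t

lemma rzw_mellin (s : ℂ) (hs : 0 < s.re) : HasMellin rzw s (1 / (s * (s + 1))) := by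
  have h1 := hasMellin_one_Ioc hs
  have h2 := hasMellin_cpow_Ioc 1 (s := s) (by simp; linarith)
  have h3 := hasMellin_sub h1.1 h2.1
  rw [h1.2, h2.2] at h3
  have e : (1 / s - 1 / (s + 1)) = 1 / (s * (s + 1)) := by
    have a1 : s ≠ 0 := by rintro rfl; simp at hs
    have a2 : s + 1 ≠ 0 := by
      intro h
      have := congrArg Complex.re h
      simp at this
      linarith
    field_simp
    ring
  rw [e] at h3
  exact h3

lemma rzw_of_le {t : ℝ} (h0 : 0 < t) (h1 : t ≤ 1) : rzw t = 1 - t := by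
  simp [rzw, h0, h1]

lemma rzw_of_gt {t : ℝ} (h1 : 1 < t) : rzw t = 0 := by
  simp [rzw, not_le.2 h1]

lemma rzw_cont {t : ℝ} (h0 : 0 < t) : ContinuousAt rzw t := by
  have : rzw =ᶠ[𝓝 t] fun t => (max 0 (1 - t) : ℝ) := by
    filter_upwards [lt_mem_nhds h0] with u hu
    rcases le_or_gt u 1 with h | h
    · rw [rzw_of_le hu h, max_eq_right (by linarith)]; push_cast; rfl
    · rw [rzw_of_gt h, max_eq_left (by linarith)]; simp
  refine ContinuousAt.congr ?_ this.symm
  fun_prop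

lemma perron_weight_bound (c t : ℝ) (hc : 1 ≤ c) :
    ‖1 / (((c : ℂ) + t * I) * ((c : ℂ) + t * I + 1))‖ ≤ 4 * (1 + |t|) ^ (-2 : ℝ) := by
  have h1 : (1 + |t|) / 2 ≤ ‖(c : ℂ) + t * I‖ := by
    have a := Complex.abs_re_le_norm ((c : ℂ) + t * I)
    have b := Complex.abs_im_le_norm ((c : ℂ) + t * I)
    simp at a b
    rw [abs_of_pos (by linarith)] at a
    linarith
  have h2 : (1 + |t|) / 2 ≤ ‖(c : ℂ) + t * I + 1‖ := by
    have a := Complex.abs_re_le_norm ((c : ℂ) + t * I + 1)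
    have b := Complex.abs_im_le_norm ((c : ℂ) + t * I + 1)
    simp at a b
    rw [abs_of_pos (by linarith)] at a
    linarith
  have h0 := abs_nonneg t
  rw [norm_div, norm_one, norm_mul, Real.rpow_neg (by linarith)]
  have e : (4 : ℝ) * ((1 + |t|) ^ (2 : ℝ))⁻¹ = 1 / ((1 + |t|) / 2 * ((1 + |t|) / 2)) := by
    rw [show (2 : ℝ) = ((2 : ℕ) : ℝ) by norm_num, Real.rpow_natCast]
    field_simp
    norm_num
  rw [e]
  apply one_div_le_one_div_of_le (by positivity)
  exact mul_le_mul h1 h2 (by linarith) (norm_nonneg _)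

lemma perron_weight_meas (c : ℝ) (hc : 1 ≤ c) :
    Continuous fun t : ℝ => 1 / (((c : ℂ) + t * I) * ((c : ℂ) + t * I + 1)) := by
  apply Continuous.div continuous_const (by fun_prop)
  intro t h
  rcases mul_eq_zero.1 h with h | h
  · have := congrArg Complex.re h
    simp at this; linarith
  · have := congrArg Complex.re h
    simp at this; linarith

lemma perron_weight_int (c : ℝ) (hc : 1 ≤ c) :
    Integrable fun t : ℝ => 1 / (((c : ℂ) + t * I) * ((c : ℂ) + t * I + 1)) := by
  have h : Integrable fun t : ℝ => 4 * (1 + ‖t‖) ^ (-2 : ℝ) :=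
    (integrable_one_add_norm (by simp)).const_mul 4
  refine h.mono' (perron_weight_meas c hc).aestronglyMeasurable ?_
  filter_upwards with t
  exact perron_weight_bound c t hc

lemma rzw_inv (c : ℝ) (hc : 1 ≤ c) (u : ℝ) (hu : 0 < u) :
    ∫ t : ℝ, (u : ℂ) ^ (-((c : ℂ) + t * I)) * (1 / (((c : ℂ) + t * I) * ((c : ℂ) + t * I + 1))) =
      2 * Real.pi * rzw u := by
  have hm : ∀ t : ℝ, mellin rzw ((c : ℂ) + t * I) =
      1 / (((c : ℂ) + t * I) * ((c : ℂ) + t * I + 1)) := fun t =>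
    (rzw_mellin _ (by simp; linarith)).2
  have h := mellinInv_mellin_eq c rzw hu (rzw_mellin c (by simp; linarith)).1 ?_ (rzw_cont hu)
  · rw [← h, mellinInv]
    simp only [hm, smul_eq_mul]
    rw [Complex.real_smul, ← mul_assoc]
    have : (2 * (Real.pi : ℂ)) * ((1 / (2 * Real.pi) : ℝ) : ℂ) = 1 := by
      push_cast
      have : (Real.pi : ℂ) ≠ 0 := by exact_mod_cast Real.pi_ne_zero
      field_simp
    rw [this, one_mul]
  · unfold Complex.VerticalIntegrable
    simp only [hm]
    exact perron_weight_int c hc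

lemma perron : ∃ K₀ : ℝ, 0 ≤ K₀ ∧ ∀ (a : ℕ → ℂ) (c x M : ℝ), 1 ≤ c → LSeriesSummable a c → 0 < x →
    0 ≤ M → (∀ t : ℝ, ‖LSeries a (c + t * I)‖ ≤ M * (|t| + 2) ^ (1 / 2 : ℝ)) →
    ‖∑ n ∈ Finset.Icc 1 ⌊x⌋₊, a n * (1 - n / x)‖ ≤ K₀ * M * x ^ c := by
  have hIntg : Integrable fun t : ℝ => 8 * (1 + ‖t‖) ^ (-(3 / 2) : ℝ) :=
    (integrable_one_add_norm (by norm_num)).const_mul 8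
  refine ⟨∫ t : ℝ, 8 * (1 + ‖t‖) ^ (-(3 / 2) : ℝ), integral_nonneg (fun t => by positivity), ?_⟩
  intro a c x M hc hsum hx hM hb
  set g : ℕ → ℝ → ℂ := fun n t => LSeries.term a (c + t * I) n * (x : ℂ) ^ ((c : ℂ) + t * I) *
    (1 / (((c : ℂ) + t * I) * ((c : ℂ) + t * I + 1))) with hg
  have hxn : ∀ t : ℝ, ‖(x : ℂ) ^ ((c : ℂ) + t * I)‖ = x ^ c := by
    intro t
    rw [Complex.norm_cpow_eq_rpow_re_of_pos hx]; simp
  have hgn : ∀ n t, ‖g n t‖ = ‖LSeries.term a c n‖ * x ^ c *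
      ‖1 / (((c : ℂ) + t * I) * ((c : ℂ) + t * I + 1))‖ := by
    intro n t
    rw [hg]
    simp only [norm_mul, hxn]
    congr 2
    rw [LSeries.norm_term_eq, LSeries.norm_term_eq]
    simp
  have hgform : ∀ n : ℕ, n ≠ 0 → ∀ t : ℝ, g n t = a n * (((n / x : ℝ) : ℂ) ^ (-((c : ℂ) + t * I)) *
      (1 / (((c : ℂ) + t * I) * ((c : ℂ) + t * I + 1)))) := by
    intro n hn t
    simp only [hg]
    rw [LSeries.term_of_ne_zero hn]
    have hn0 : (0 : ℝ) < n := by exact_mod_cast Nat.pos_of_ne_zero hn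
    have : (((n / x : ℝ) : ℂ) ^ (-((c : ℂ) + t * I))) =
        (x : ℂ) ^ ((c : ℂ) + t * I) / (n : ℂ) ^ ((c : ℂ) + t * I) := by
      rw [Complex.cpow_neg]
      rw [Complex.ofReal_div, Complex.div_cpow_ofReal_nonneg hn0.le hx.le, inv_div]
      norm_num
    rw [this]
    ring
  have hgint : ∀ n, Integrable (g n) := by
    intro n
    rcases eq_or_ne n 0 with rfl | hn
    · simp [hg]
    · have hn0 : (0 : ℝ) < n := by exact_mod_cast Nat.pos_of_ne_zero hn
      refine ((perron_weight_int c hc).norm.const_mul (‖LSeries.term a c n‖ * x ^ c)).mono' ?_ ?_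
      · have : g n = fun t : ℝ => a n * (((n / x : ℝ) : ℂ) ^ (-((c : ℂ) + t * I)) *
            (1 / (((c : ℂ) + t * I) * ((c : ℂ) + t * I + 1)))) := by
          ext t; exact hgform n hn t
        rw [this]
        apply Continuous.aestronglyMeasurable
        refine continuous_const.mul (Continuous.mul ?_ (perron_weight_meas c hc))
        apply Continuous.const_cpow (by fun_prop)
        left
        have : (n / x : ℝ) ≠ 0 := by positivity
        exact_mod_cast this
      · filter_upwards with t
        exact (hgn n t).le
  have hgsum : Summable fun n => ∫ t, ‖g n t‖ := by
    simp only [hgn, integral_const_mul]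
    exact (hsum.norm.mul_right (x ^ c)).mul_right _
  have key := hasSum_integral_of_summable_integral_norm hgint hgsum
  have hval : ∀ n : ℕ, ∫ t, g n t = if n = 0 then 0 else a n * (2 * Real.pi * rzw (n / x)) := by
    intro n
    split_ifs with hn
    · simp [hg, hn]
    · have hn0 : (0 : ℝ) < n := by exact_mod_cast Nat.pos_of_ne_zero hn
      simp only [hgform n hn]
      rw [integral_const_mul, rzw_inv c hc _ (by positivity)]
  have hfin : ∑' n, ∫ t, g n t = (2 * Real.pi) * ∑ n ∈ Finset.Icc 1 ⌊x⌋₊, a n * (1 - n / x) := by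
    rw [tsum_eq_sum (s := Finset.Icc 1 ⌊x⌋₊)]
    · rw [Finset.mul_sum]
      apply Finset.sum_congr rfl
      intro n hn
      rw [Finset.mem_Icc] at hn
      have hn0 : n ≠ 0 := by omega
      have hn1 : (0 : ℝ) < n := by exact_mod_cast hn.1
      have hnx : (n : ℝ) ≤ x := (Nat.le_floor_iff hx.le).1 hn.2
      rw [hval, if_neg hn0, rzw_of_le (by positivity) ((div_le_one hx).2 hnx)]
      push_cast
      ring
    · intro n hn
      rw [hval]
      split_ifs with h0
      · rfl
      · rw [Finset.mem_Icc, not_and] at hn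
        have h1 := hn (by omega)
        have h2 : x < n := by
          rw [not_le] at h1
          exact (Nat.floor_lt hx.le).1 h1
        rw [rzw_of_gt ((one_lt_div hx).2 h2)]
        simp
  have hts : ∀ t : ℝ, ∑' n, g n t = LSeries a (c + t * I) * (x : ℂ) ^ ((c : ℂ) + t * I) *
    (1 / (((c : ℂ) + t * I) * ((c : ℂ) + t * I + 1))) := by
    intro t
    simp only [hg]
    rw [tsum_mul_right, tsum_mul_right, LSeries]
  have hbound : ‖∫ t, ∑' n, g n t‖ ≤ (∫ t : ℝ, 8 * (1 + ‖t‖) ^ (-(3 / 2) : ℝ)) * M * x ^ c := by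
    have := norm_integral_le_of_norm_le (f := fun t => ∑' n, g n t)
      (hIntg.mul_const (M * x ^ c)) ?_
    · rw [integral_mul_const] at this
      rw [mul_assoc]
      exact this
    · filter_upwards with t
      rw [hts, norm_mul, norm_mul, hxn]
      have h0 := abs_nonneg t
      have e1 : (|t| + 2) ^ (1 / 2 : ℝ) ≤ 2 * (1 + |t|) ^ (1 / 2 : ℝ) := by
        calc (|t| + 2) ^ (1 / 2 : ℝ) ≤ (2 ^ (2 : ℝ) * (1 + |t|)) ^ (1 / 2 : ℝ) := by
              apply Real.rpow_le_rpow (by positivity) _ (by norm_num)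
              norm_num; linarith
          _ = _ := by
              rw [Real.mul_rpow (by positivity) (by positivity), ← Real.rpow_mul (by norm_num)]
              norm_num
      have e2 : (1 + |t|) ^ (-(3 / 2) : ℝ) = (1 + |t|) ^ (1 / 2 : ℝ) * (1 + |t|) ^ (-2 : ℝ) := by
        rw [← Real.rpow_add (by linarith)]; norm_num
      rw [Real.norm_eq_abs, e2]
      calc _ ≤ (M * (2 * (1 + |t|) ^ (1 / 2 : ℝ))) * x ^ c * (4 * (1 + |t|) ^ (-2 : ℝ)) := by
            have := perron_weight_bound c t hc
            have := (hb t).trans (mul_le_mul_of_nonneg_left e1 hM)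
            gcongr
        _ = _ := by ring
  have h1 := key.tsum_eq
  rw [hfin] at h1
  rw [← h1, norm_mul] at hbound
  have h2 : (1 : ℝ) ≤ ‖(2 * Real.pi : ℂ)‖ := by
    rw [norm_mul, Complex.norm_real, Real.norm_eq_abs, abs_of_pos Real.pi_pos]
    have := Real.pi_gt_three
    norm_num
    linarith
  calc _ ≤ ‖(2 * Real.pi : ℂ)‖ * ‖∑ n ∈ Finset.Icc 1 ⌊x⌋₊, a n * (1 - n / x)‖ :=
        le_mul_of_one_le_left (norm_nonneg _) h2
    _ ≤ _ := hbound

end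

section

open Complex Filter Topology

lemma tvMk_norm_le {q : ℕ} (k : ℕ) (χ : DirichletCharacter ℂ q) (n : ℕ) :
    ‖tvMk k χ n‖ ≤ Real.log n ^ (k + 1) := by
  rw [tvMk, norm_mul, norm_mul, norm_pow, Complex.norm_real, Complex.norm_real]
  have h1 : ‖χ n‖ ≤ 1 := χ.norm_le_one _
  have h2 : ‖ArithmeticFunction.vonMangoldt n‖ ≤ Real.log n := by
    rw [Real.norm_of_nonneg ArithmeticFunction.vonMangoldt_nonneg]
    exact ArithmeticFunction.vonMangoldt_le_log
  rw [Real.norm_of_nonneg (Real.log_natCast_nonneg n), pow_succ]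
  have h0 := Real.log_natCast_nonneg n
  gcongr
  calc _ ≤ 1 * Real.log n := by gcongr
    _ = _ := one_mul _

lemma smooth_bound (k : ℕ) : ∃ K : ℝ, 0 ≤ K ∧ ∀ (q : ℕ) [NeZero q]
    (χ : DirichletCharacter ℂ q), χ.IsPrimitive → χ ≠ 1 → ∀ x : ℝ, 3 ≤ x →
    ‖∑ n ∈ Finset.Icc 1 ⌊x⌋₊, tvMk k χ n * (x - n)‖ ≤ K * (q : ℝ) ^ (1 / 2 : ℝ) * x ^ 2 := by
  obtain ⟨C, hC, h⟩ := tvMk_bound k (1 / 2) (by norm_num)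
  obtain ⟨K₀, hK₀, hP⟩ := perron
  refine ⟨K₀ * C * Real.exp 1, by positivity, ?_⟩
  intro q _ χ hp hne x hx
  have hx0 : 0 < x := by linarith
  have hlog : 1 ≤ Real.log x := by
    rw [Real.le_log_iff_exp_le hx0]
    linarith [Real.exp_one_lt_three]
  have hinv : 1 / Real.log x ≤ 1 := by
    rw [div_le_one (by linarith)]; exact hlog
  have hinv0 : 0 < 1 / Real.log x := by positivity
  set c : ℝ := 1 + 1 / Real.log x with hc
  have := hP (tvMk k χ) c x (C * (q : ℝ) ^ (1 / 2 : ℝ)) (by linarith)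
    (tvMk_summable k χ c (by simp; linarith)) hx0 (by positivity) (by
      intro t
      refine (h q χ hp hne (c + t * I) (by simp; linarith) (by simp; linarith)).trans ?_
      rw [Real.mul_rpow (by positivity) (by positivity)]
      simp [mul_assoc])
  have e1 : ∑ n ∈ Finset.Icc 1 ⌊x⌋₊, tvMk k χ n * (x - n) =
      x * ∑ n ∈ Finset.Icc 1 ⌊x⌋₊, tvMk k χ n * (1 - n / x) := by
    rw [Finset.mul_sum]
    refine Finset.sum_congr rfl fun n _ => ?_
    have : (x : ℂ) ≠ 0 := by exact_mod_cast hx0.ne'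
    field_simp
  rw [e1, norm_mul, Complex.norm_real, Real.norm_of_nonneg hx0.le]
  have e2 : x ^ c = x * Real.exp 1 := by
    rw [hc, Real.rpow_add hx0, Real.rpow_one, Real.rpow_def_of_pos hx0 (1 / Real.log x)]
    congr 2
    field_simp
  rw [e2] at this
  calc _ ≤ x * (K₀ * (C * (q : ℝ) ^ (1 / 2 : ℝ)) * (x * Real.exp 1)) := by gcongr
    _ = _ := by ring

lemma unsmooth_bound (j : ℕ) : ∃ K x₀ : ℝ, 0 ≤ K ∧ ∀ (q : ℕ) [NeZero q]
    (χ : DirichletCharacter ℂ q), χ.IsPrimitive → χ ≠ 1 → ∀ x : ℝ, x₀ ≤ x →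
    ‖∑ n ∈ Finset.Icc 1 ⌊x⌋₊, tvMk (2 * j + 1) χ n‖ ≤
      K * (q : ℝ) ^ (1 / 2 : ℝ) * x * Real.log x ^ (j + 1) := by
  obtain ⟨K, hK, h⟩ := smooth_bound (2 * j + 1)
  have hev : ∀ᶠ x : ℝ in atTop, Real.log x ^ (j + 1) ≤ x := by
    have := (Real.isLittleO_pow_log_id_atTop (n := j + 1)).bound (c := 1) one_pos
    filter_upwards [this, eventually_ge_atTop 1] with x hx h1
    have := (le_abs_self _).trans hx
    simpa [abs_of_nonneg (zero_le_one.trans h1)] using this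
  obtain ⟨x₀, hx₀⟩ := (hev.and (eventually_ge_atTop 3)).exists_forall_of_atTop
  refine ⟨5 * K + 2 * 4 ^ (j + 1), x₀, by positivity, ?_⟩
  intro q _ χ hp hne x hx
  obtain ⟨hLx, hx3⟩ := hx₀ x hx
  have hx0 : 0 < x := by linarith
  have hlog : 1 ≤ Real.log x := by
    rw [Real.le_log_iff_exp_le hx0]
    linarith [Real.exp_one_lt_three]
  set L := Real.log x with hL
  have hLj : 1 ≤ L ^ (j + 1) := one_le_pow₀ hlog
  set y : ℝ := x / L ^ (j + 1) with hy
  have hy1 : 1 ≤ y := by rw [hy, le_div_iff₀ (by positivity), one_mul]; exact hLx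
  have hyx : y ≤ x := div_le_self hx0.le hLj
  have hy0 : 0 < y := by linarith
  set a := tvMk (2 * j + 1) χ with ha
  have h1 := h q χ hp hne x hx3
  have h2 := h q χ hp hne (x + y) (by linarith)
  have hsub : Finset.Icc 1 ⌊x⌋₊ ⊆ Finset.Icc 1 ⌊x + y⌋₊ :=
    Finset.Icc_subset_Icc le_rfl (Nat.floor_mono (by linarith))
  have hq1 : (1 : ℝ) ≤ (q : ℝ) ^ (1 / 2 : ℝ) := by
    apply Real.one_le_rpow _ (by norm_num)
    exact_mod_cast Nat.one_le_iff_ne_zero.2 (NeZero.ne q)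
  set Q := (q : ℝ) ^ (1 / 2 : ℝ) with hQ
  have hdec : (y : ℂ) * ∑ n ∈ Finset.Icc 1 ⌊x⌋₊, a n =
      (∑ n ∈ Finset.Icc 1 ⌊x + y⌋₊, a n * (((x + y : ℝ) : ℂ) - n)) -
      (∑ n ∈ Finset.Icc 1 ⌊x⌋₊, a n * (x - n)) -
      ∑ n ∈ Finset.Icc 1 ⌊x + y⌋₊ \ Finset.Icc 1 ⌊x⌋₊, a n * (((x + y : ℝ) : ℂ) - n) := by
    rw [← Finset.sum_sdiff hsub, Finset.mul_sum]
    have : ∀ A B C D : ℂ, D = B - C → D = A + B - C - A := by intros; subst_vars; ring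
    apply this
    rw [← Finset.sum_sub_distrib]
    refine Finset.sum_congr rfl fun n _ => ?_
    push_cast; ring
  have hdiff : ‖∑ n ∈ Finset.Icc 1 ⌊x + y⌋₊ \ Finset.Icc 1 ⌊x⌋₊, a n * (((x + y : ℝ) : ℂ) - n)‖
      ≤ (2 * y) * ((2 * L) ^ (2 * j + 2) * y) := by
    have hcard : ((Finset.Icc 1 ⌊x + y⌋₊ \ Finset.Icc 1 ⌊x⌋₊).card : ℝ) ≤ 2 * y := by
      rw [Finset.card_sdiff_of_subset hsub, Nat.card_Icc, Nat.card_Icc, Nat.cast_sub (by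
        have := Nat.floor_mono (show x ≤ x + y by linarith); omega)]
      push_cast
      have a1 := Nat.floor_le (show 0 ≤ x + y by linarith)
      have a2 := Nat.lt_floor_add_one x
      linarith
    refine (norm_sum_le_of_le (f := fun n : ℕ => a n * (((x + y : ℝ) : ℂ) - n)) _
      (n := fun _ => (2 * L) ^ (2 * j + 2) * y) ?_).trans ?_
    · intro n hn
      rw [Finset.mem_sdiff, Finset.mem_Icc, Finset.mem_Icc, not_and, not_le] at hn
      have hn1 : (n : ℝ) ≤ x + y := (Nat.le_floor_iff (by linarith)).1 hn.1.2
      have hn2 : x < n := (Nat.floor_lt hx0.le).1 (hn.2 hn.1.1)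
      have hn0 : (0 : ℝ) < n := by linarith
      rw [norm_mul]
      have b1 : ‖a n‖ ≤ (2 * L) ^ (2 * j + 2) := by
        refine (tvMk_norm_le _ χ n).trans ?_
        apply pow_le_pow_left₀ (Real.log_natCast_nonneg n)
        calc Real.log n ≤ Real.log (x ^ 2) := Real.log_le_log hn0 (by nlinarith)
          _ = 2 * L := by rw [Real.log_pow, hL]; norm_num
      have b2 : ‖((x + y : ℝ) : ℂ) - n‖ ≤ y := by
        rw [← Complex.ofReal_natCast, ← Complex.ofReal_sub, Complex.norm_real, Real.norm_eq_abs,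
          abs_le]
        constructor <;> linarith
      gcongr
    · rw [Finset.sum_const, nsmul_eq_mul]
      gcongr
  have hfin : y * ‖∑ n ∈ Finset.Icc 1 ⌊x⌋₊, a n‖ ≤
      K * Q * (x + y) ^ 2 + K * Q * x ^ 2 + (2 * y) * ((2 * L) ^ (2 * j + 2) * y) := by
    calc y * ‖∑ n ∈ Finset.Icc 1 ⌊x⌋₊, a n‖ = ‖(y : ℂ) * ∑ n ∈ Finset.Icc 1 ⌊x⌋₊, a n‖ := by
          rw [norm_mul, Complex.norm_real, Real.norm_of_nonneg hy0.le]
      _ ≤ _ := by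
          rw [hdec]
          refine (norm_sub_le _ _).trans (add_le_add ((norm_sub_le _ _).trans (add_le_add h2 h1))
            hdiff)
  have hxy : x = y * L ^ (j + 1) := by rw [hy]; field_simp
  have hmain : y * ‖∑ n ∈ Finset.Icc 1 ⌊x⌋₊, a n‖ ≤
      y * ((5 * K + 2 * 4 ^ (j + 1)) * Q * x * L ^ (j + 1)) := by
    refine hfin.trans ?_
    have e1 : (2 * L) ^ (2 * j + 2) = 4 ^ (j + 1) * (L ^ (j + 1)) ^ 2 := by
      rw [show 2 * j + 2 = 2 * (j + 1) by ring, pow_mul, mul_pow, mul_pow, ← pow_mul, ← pow_mul L,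
        mul_comm 2 (j + 1), mul_comm (j + 1) 2, pow_mul]
      norm_num
      ring
    have e2 : K * Q * (x + y) ^ 2 ≤ K * Q * (2 * x) ^ 2 := by
      gcongr; linarith
    rw [e1]
    have e3 : y * ((5 * K + 2 * 4 ^ (j + 1)) * Q * x * L ^ (j + 1)) =
       5 * K * Q * x ^ 2 + 2 * 4 ^ (j + 1) * Q * x ^ 2 := by
      conv_rhs => rw [show x ^ 2 = (y * L ^ (j + 1)) * x by rw [← hxy, sq]]
      ring
    have e4 : 2 * y * (4 ^ (j + 1) * (L ^ (j + 1)) ^ 2 * y) = 2 * 4 ^ (j + 1) * 1 * x ^ 2 := by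
      rw [hxy]; ring
    have e5 : (2 * 4 ^ (j + 1) * 1 * x ^ 2 : ℝ) ≤ 2 * 4 ^ (j + 1) * Q * x ^ 2 := by gcongr
    rw [e3, e4]
    nlinarith
  exact le_of_mul_le_mul_left hmain hy0

lemma abel_ineq (f : ℕ → ℂ) (w : ℕ → ℝ) (B : ℝ) (n : ℕ) (hB : ∀ m ≤ n, ‖∑ i ∈ Finset.range m, f i‖ ≤ B)
    (hw : ∀ i < n, w (i + 1) ≤ w i) (hn : 0 ≤ w n) :
    ‖∑ i ∈ Finset.range n, w i * f i‖ ≤ B * w 0 := by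
  have key : ∀ m ≤ n, ‖∑ i ∈ Finset.range m, w i * f i - w m * ∑ i ∈ Finset.range m, f i‖ ≤
      B * (w 0 - w m) := by
    intro m
    induction m with
    | zero => simp
    | succ m ih =>
      intro hm
      have h1 := ih (by omega)
      have h2 : ∑ i ∈ Finset.range (m + 1), w i * f i - w (m + 1) * ∑ i ∈ Finset.range (m + 1), f i
        = (∑ i ∈ Finset.range m, w i * f i - w m * ∑ i ∈ Finset.range m, f i) +
          ((w m - w (m + 1) : ℝ) : ℂ) * ∑ i ∈ Finset.range (m + 1), f i := by
        rw [Finset.sum_range_succ, Finset.sum_range_succ]; push_cast; ring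
      rw [h2]
      refine (norm_add_le _ _).trans ?_
      rw [norm_mul, Complex.norm_real, Real.norm_of_nonneg (by linarith [hw m (by omega)])]
      have h3 := mul_le_mul_of_nonneg_left (hB (m + 1) hm)
        (show 0 ≤ w m - w (m + 1) by linarith [hw m (by omega)])
      nlinarith
  have h1 := key n le_rfl
  have h2 := norm_sub_norm_le (∑ i ∈ Finset.range n, w i * f i) (w n * ∑ i ∈ Finset.range n, f i)
  rw [norm_mul, Complex.norm_real, Real.norm_of_nonneg hn] at h2
  have h3 := mul_le_mul_of_nonneg_left (hB n le_rfl) hn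
  nlinarith

end

section

open Complex Filter Topology

lemma log_pow_le_eventually (k : ℕ) (c : ℝ) (hc : 0 < c) :
    ∀ᶠ x : ℝ in atTop, Real.log x ^ k ≤ c * x := by
  have := (Real.isLittleO_pow_log_id_atTop (n := k)).bound (c := c) hc
  filter_upwards [this, eventually_ge_atTop 1] with x hx h1
  have := (le_abs_self _).trans hx
  simpa [abs_of_nonneg (zero_le_one.trans h1)] using this

lemma sqrt_log_pow_le_eventually (k : ℕ) (c : ℝ) (hc : 0 < c) :
    ∀ᶠ x : ℝ in atTop, √x * Real.log x ^ k ≤ c * x := by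
  have h := (log_pow_le_eventually k (c / 2 ^ k) (by positivity))
  filter_upwards [Real.tendsto_sqrt_atTop.eventually h, eventually_ge_atTop 1] with x hx h1
  have e : Real.log x = 2 * Real.log √x := by rw [Real.log_sqrt (by linarith)]; ring
  rw [e, mul_pow]
  calc √x * (2 ^ k * Real.log √x ^ k) ≤ √x * (2 ^ k * (c / 2 ^ k * √x)) := by gcongr
    _ = c * (√x * √x) := by field_simp
    _ = c * x := by rw [Real.mul_self_sqrt (by linarith)]

/-- Weighted character value at primes. -/
noncomputable def pfw {q : ℕ} (k : ℕ) (χ : DirichletCharacter ℂ q) (n : ℕ) : ℂ :=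
  if n.Prime then (Real.log n : ℂ) ^ k * χ n else 0

lemma pfw_sum_bound (j : ℕ) : ∃ K x₀ : ℝ, 0 ≤ K ∧ ∀ (q : ℕ) [NeZero q]
    (χ : DirichletCharacter ℂ q), χ.IsPrimitive → χ ≠ 1 → ∀ x : ℝ, x₀ ≤ x →
    ‖∑ n ∈ Finset.range (⌊x⌋₊ + 1), pfw (2 * j + 2) χ n‖ ≤
      K * (q : ℝ) ^ (1 / 2 : ℝ) * x * Real.log x ^ (j + 1) := by
  obtain ⟨K, x₀, hK, h⟩ := unsmooth_bound j
  obtain ⟨x₁, hx₁⟩ := ((sqrt_log_pow_le_eventually (2 * j + 2) (1 / 2) (by norm_num)).and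
    (eventually_ge_atTop (max x₀ 3))).exists_forall_of_atTop
  refine ⟨K + 1, x₁, by positivity, ?_⟩
  intro q _ χ hp hne x hx
  obtain ⟨hsq, hxm⟩ := hx₁ x hx
  have hx0' : x₀ ≤ x := (le_max_left _ _).trans hxm
  have hx3 : 3 ≤ x := (le_max_right _ _).trans hxm
  have hx0 : 0 < x := by linarith
  have hlog : 1 ≤ Real.log x := by
    rw [Real.le_log_iff_exp_le hx0]
    linarith [Real.exp_one_lt_three]
  have h1 := h q χ hp hne x hx0'
  have e1 : Finset.Icc 1 ⌊x⌋₊ = Finset.Ioc 0 ⌊x⌋₊ := by ext n; simp; omega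
  have e2 : ∑ n ∈ Finset.range (⌊x⌋₊ + 1), pfw (2 * j + 2) χ n =
      ∑ n ∈ Finset.Ioc 0 ⌊x⌋₊, pfw (2 * j + 2) χ n := by
    symm
    apply Finset.sum_subset
    · intro n hn; simp at hn ⊢; omega
    · intro n hn hn'
      have : n = 0 := by simp at hn hn'; omega
      simp [this, pfw, Nat.not_prime_zero]
  have e3 : ∑ n ∈ Finset.Ioc 0 ⌊x⌋₊, pfw (2 * j + 2) χ n =
      ∑ n ∈ Finset.Icc 1 ⌊x⌋₊, tvMk (2 * j + 1) χ n -
      ∑ n ∈ (Finset.Ioc 0 ⌊x⌋₊).filter (fun n => ¬ n.Prime), tvMk (2 * j + 1) χ n := by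
    rw [e1, Finset.sum_filter, ← Finset.sum_sub_distrib]
    refine Finset.sum_congr rfl fun n _ => ?_
    by_cases hn : n.Prime
    · simp only [pfw, hn, tvMk, not_true, if_true, if_false,
        ArithmeticFunction.vonMangoldt_apply_prime hn]
      ring
    · simp [pfw, hn]
  have e4 : ‖∑ n ∈ (Finset.Ioc 0 ⌊x⌋₊).filter (fun n => ¬ n.Prime), tvMk (2 * j + 1) χ n‖ ≤
      x := by
    calc _ ≤ ∑ n ∈ (Finset.Ioc 0 ⌊x⌋₊).filter (fun n => ¬ n.Prime),
          Real.log x ^ (2 * j + 1) * ArithmeticFunction.vonMangoldt n := by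
          apply norm_sum_le_of_le
          intro n hn
          simp only [Finset.mem_filter, Finset.mem_Ioc] at hn
          have hnx : (n : ℝ) ≤ x := (Nat.le_floor_iff hx0.le).1 hn.1.2
          have hn0 : (0 : ℝ) < n := by exact_mod_cast hn.1.1
          rw [tvMk, norm_mul, norm_mul, norm_pow, Complex.norm_real, Complex.norm_real,
            Real.norm_of_nonneg (Real.log_natCast_nonneg n),
            Real.norm_of_nonneg ArithmeticFunction.vonMangoldt_nonneg]
          have a1 : ‖χ n‖ ≤ 1 := χ.norm_le_one _
          have a2 := Real.log_natCast_nonneg n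
          have a3 := Real.log_le_log hn0 hnx
          have a4 : 0 ≤ ArithmeticFunction.vonMangoldt n := ArithmeticFunction.vonMangoldt_nonneg
          gcongr
          nlinarith
      _ = Real.log x ^ (2 * j + 1) * (Chebyshev.psi x - Chebyshev.theta x) := by
          rw [Chebyshev.psi_sub_theta_eq_sum_not_prime, Finset.mul_sum]
      _ ≤ Real.log x ^ (2 * j + 1) * (2 * √x * Real.log x) := by
          gcongr
          exact Chebyshev.psi_sub_theta_le (by linarith)
      _ = 2 * (√x * Real.log x ^ (2 * j + 2)) := by ring
      _ ≤ x := by linarith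
  have hq1 : (1 : ℝ) ≤ (q : ℝ) ^ (1 / 2 : ℝ) := by
    apply Real.one_le_rpow _ (by norm_num)
    exact_mod_cast Nat.one_le_iff_ne_zero.2 (NeZero.ne q)
  rw [e2, e3]
  calc _ ≤ K * (q : ℝ) ^ (1 / 2 : ℝ) * x * Real.log x ^ (j + 1) + x :=
        (norm_sub_le _ _).trans (add_le_add h1 e4)
    _ ≤ K * (q : ℝ) ^ (1 / 2 : ℝ) * x * Real.log x ^ (j + 1) +
        1 * (q : ℝ) ^ (1 / 2 : ℝ) * x * Real.log x ^ (j + 1) := by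
        gcongr
        have : 1 ≤ Real.log x ^ (j + 1) := one_le_pow₀ hlog
        calc x = 1 * 1 * x * 1 := by ring
          _ ≤ _ := by gcongr
    _ = _ := by ring

lemma prime_char_sum (j : ℕ) : ∃ K x₀ : ℝ, 0 ≤ K ∧ ∀ (q : ℕ) [NeZero q]
    (χ : DirichletCharacter ℂ q), χ.IsPrimitive → χ ≠ 1 → ∀ x : ℝ, x₀ ≤ x →
    ‖∑ p ∈ primesUpTo x, χ p‖ ≤ K * (q : ℝ) ^ (1 / 2 : ℝ) * x / Real.log x ^ (j + 1) := by
  obtain ⟨K, x₀, hK, h⟩ := pfw_sum_bound j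
  obtain ⟨x₁, hx₁⟩ := ((sqrt_log_pow_le_eventually (j + 1) (1 / 2) (by norm_num)).and
    ((eventually_ge_atTop ((|x₀| + 2) ^ 2)).and (eventually_ge_atTop 3))).exists_forall_of_atTop
  refine ⟨1 + 2 * 4 ^ (j + 1) * K, x₁, by positivity, ?_⟩
  intro q _ χ hp hne x hx
  obtain ⟨hsq, hxx, hx3⟩ := hx₁ x hx
  have hx0 : 0 < x := by linarith
  have hlog : 1 ≤ Real.log x := by
    rw [Real.le_log_iff_exp_le hx0]
    linarith [Real.exp_one_lt_three]
  set L := Real.log x with hL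
  have hq1 : (1 : ℝ) ≤ (q : ℝ) ^ (1 / 2 : ℝ) := by
    apply Real.one_le_rpow _ (by norm_num)
    exact_mod_cast Nat.one_le_iff_ne_zero.2 (NeZero.ne q)
  set Q := (q : ℝ) ^ (1 / 2 : ℝ) with hQ
  have hs : |x₀| + 2 ≤ √x := Real.le_sqrt_of_sq_le hxx
  have hsx : √x ≤ x := by
    rw [Real.sqrt_le_left (by linarith)]; nlinarith
  set M := ⌊√x⌋₊ with hM
  have hMs : (M : ℝ) ≤ √x := Nat.floor_le (Real.sqrt_nonneg x)
  have hMs' : √x < M + 1 := Nat.lt_floor_add_one _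
  have hMx₀ : x₀ ≤ M := by linarith [le_abs_self x₀]
  have hM1 : (1 : ℝ) ≤ M := by linarith [abs_nonneg x₀]
  set N := ⌊x⌋₊ with hN
  have hMN : M ≤ N := Nat.floor_mono hsx
  have hNx : (N : ℝ) ≤ x := Nat.floor_le hx0.le
  obtain ⟨d, hd⟩ := Nat.exists_eq_add_of_le hMN
  set g : ℕ → ℂ := fun n => if n.Prime then χ n else 0 with hg
  have e0 : ∑ p ∈ primesUpTo x, χ p = ∑ n ∈ Finset.range (M + 1), g n +
      ∑ i ∈ Finset.range d, g (M + 1 + i) := by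
    rw [primesUpTo, Finset.sum_filter, ← Finset.sum_range_add, ← hN, hd]
    congr 2
    ring
  have b1 : ‖∑ n ∈ Finset.range (M + 1), g n‖ ≤ 2 * √x := by
    calc _ ≤ ∑ n ∈ Finset.range (M + 1), (1 : ℝ) := by
          apply norm_sum_le_of_le
          intro n _
          simp only [hg]
          split_ifs
          · exact χ.norm_le_one _
          · simp
      _ ≤ _ := by simp; linarith
  set f : ℕ → ℂ := fun i => pfw (2 * j + 2) χ (M + 1 + i) with hf
  set w : ℕ → ℝ := fun i => 1 / Real.log ((M + 1 + i : ℕ) : ℝ) ^ (2 * j + 2) with hw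
  have hlogpos : ∀ i : ℕ, 0 < Real.log ((M + 1 + i : ℕ) : ℝ) := by
    intro i
    apply Real.log_pos
    push_cast
    have : (0 : ℝ) ≤ i := Nat.cast_nonneg i
    linarith
  have e1 : ∑ i ∈ Finset.range d, g (M + 1 + i) = ∑ i ∈ Finset.range d, w i * f i := by
    refine Finset.sum_congr rfl fun i _ => ?_
    simp only [hg, hf, hw, pfw]
    split_ifs
    · have h0 : (Real.log ((M + 1 + i : ℕ) : ℝ) : ℂ) ≠ 0 := by exact_mod_cast (hlogpos i).ne'
      rw [Complex.ofReal_div, Complex.ofReal_pow]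
      simp only [Complex.ofReal_one]
      field_simp
    · simp
  have hF : ∀ m ≤ d, ‖∑ n ∈ Finset.range (M + 1 + m), pfw (2 * j + 2) χ n‖ ≤
      K * Q * x * L ^ (j + 1) := by
    intro m hm
    have a1 := h q χ hp hne ((M + m : ℕ) : ℝ) (by push_cast; linarith [Nat.cast_nonneg (α := ℝ) m])
    rw [Nat.floor_natCast, show M + m + 1 = M + 1 + m by ring] at a1
    refine a1.trans ?_
    have a2 : ((M + m : ℕ) : ℝ) ≤ x := le_trans (by exact_mod_cast (by omega)) hNx
    have a3 : (0 : ℝ) < ((M + m : ℕ) : ℝ) := by push_cast; linarith [Nat.cast_nonneg (α := ℝ) m]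
    have a4 : Real.log ((M + m : ℕ) : ℝ) ≤ L := Real.log_le_log a3 a2
    have a5 : 0 ≤ Real.log ((M + m : ℕ) : ℝ) := Real.log_natCast_nonneg _
    gcongr
  have b2 : ‖∑ i ∈ Finset.range d, w i * f i‖ ≤ (2 * (K * Q * x * L ^ (j + 1))) * w 0 := by
    apply abel_ineq
    · intro m hm
      have : ∑ i ∈ Finset.range m, f i = ∑ n ∈ Finset.range (M + 1 + m), pfw (2 * j + 2) χ n -
          ∑ n ∈ Finset.range (M + 1 + 0), pfw (2 * j + 2) χ n := by
        rw [Finset.sum_range_add, add_zero]; ring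
      rw [this]
      refine (norm_sub_le _ _).trans ((add_le_add (hF m hm) (hF 0 (by omega))).trans ?_)
      linarith
    · intro i _
      simp only [hw]
      apply one_div_le_one_div_of_le (pow_pos (hlogpos i) _)
      apply pow_le_pow_left₀ (hlogpos i).le
      apply Real.log_le_log
      · exact_mod_cast (by omega)
      · exact_mod_cast (by omega)
    · simp only [hw]
      have := hlogpos d
      positivity
  have b3 : w 0 ≤ 4 ^ (j + 1) / L ^ (2 * j + 2) := by
    have c1 : L / 2 ≤ Real.log ((M + 1 + 0 : ℕ) : ℝ) := by
      rw [hL, ← Real.log_sqrt hx0.le]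
      apply Real.log_le_log (by positivity)
      push_cast; linarith
    simp only [hw]
    have c2 : (4 : ℝ) ^ (j + 1) / L ^ (2 * j + 2) = 1 / (L / 2) ^ (2 * j + 2) := by
      rw [div_pow, show 2 * j + 2 = 2 * (j + 1) by ring, pow_mul 2]
      norm_num
    rw [c2]
    apply one_div_le_one_div_of_le (by positivity)
    apply pow_le_pow_left₀ (by positivity) c1
  rw [e0, e1]
  calc _ ≤ 2 * √x + (2 * (K * Q * x * L ^ (j + 1))) * (4 ^ (j + 1) / L ^ (2 * j + 2)) := by
        refine (norm_add_le _ _).trans (add_le_add b1 (b2.trans ?_))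
        gcongr
    _ ≤ x / L ^ (j + 1) + (2 * (K * Q * x * L ^ (j + 1))) * (4 ^ (j + 1) / L ^ (2 * j + 2)) := by
        gcongr
        rw [le_div_iff₀ (by positivity)]
        linarith
    _ = (1 + 2 * 4 ^ (j + 1) * K * Q) * x / L ^ (j + 1) := by
        rw [show 2 * j + 2 = (j + 1) + (j + 1) by ring, pow_add]
        field_simp
        ring
    _ ≤ _ := by
        gcongr
        nlinarith

lemma prime_char_sum' (j : ℕ) : ∃ K x₀ : ℝ, 0 ≤ K ∧ ∀ (q : ℕ) [NeZero q]
    (χ : DirichletCharacter ℂ q), χ ≠ 1 → ∀ x : ℝ, x₀ ≤ x →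
    ‖∑ p ∈ primesUpTo x, χ p‖ ≤ K * q * x / Real.log x ^ (j + 1) + q := by
  obtain ⟨K, x₀, hK, h⟩ := prime_char_sum j
  refine ⟨K, max x₀ 3, hK, ?_⟩
  intro q _ χ hne x hx
  have hx0' : x₀ ≤ x := (le_max_left _ _).trans hx
  have hx3 : 3 ≤ x := (le_max_right _ _).trans hx
  have hx0 : 0 < x := by linarith
  have hlog : 0 < Real.log x := Real.log_pos (by linarith)
  haveI : NeZero χ.conductor := ⟨χ.conductor_ne_zero⟩
  have hne' : χ.primitiveCharacter ≠ 1 := by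
    intro h1
    apply hne
    rw [← χ.changeLevel_primitiveCharacter, h1, DirichletCharacter.changeLevel_one]
  have h1 := h χ.conductor χ.primitiveCharacter χ.primitiveCharacter_isPrimitive hne' x hx0'
  have h2 : ‖∑ p ∈ primesUpTo x, χ p - ∑ p ∈ primesUpTo x, χ.primitiveCharacter p‖ ≤ q := by
    rw [← Finset.sum_sub_distrib]
    calc _ ≤ ∑ p ∈ primesUpTo x, if p ∈ q.primeFactors then (1 : ℝ) else 0 := by
          apply norm_sum_le_of_le
          intro p hp
          rw [primesUpTo, Finset.mem_filter] at hp
          split_ifs with hpq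
          · rw [Nat.mem_primeFactors] at hpq
            have : χ (p : ZMod q) = 0 := by
              apply χ.map_nonunit
              rw [ZMod.isUnit_iff_coprime, hp.2.coprime_iff_not_dvd, not_not]
              exact hpq.2.1
            rw [this, zero_sub, norm_neg]
            exact χ.primitiveCharacter.norm_le_one _
          · have hc : Nat.Coprime p q := by
              rw [hp.2.coprime_iff_not_dvd]
              intro hd
              exact hpq (Nat.mem_primeFactors.2 ⟨hp.2, hd, NeZero.ne q⟩)
            have := χ.primitiveCharacter_apply_of_isCoprime (a := (p : ℤ))
              (Nat.isCoprime_iff_coprime.2 hc)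
            simp only [Int.cast_natCast] at this
            rw [this]
            simp
      _ = (((primesUpTo x).filter (· ∈ q.primeFactors)).card : ℝ) := by
          rw [← Finset.sum_filter]; simp
      _ ≤ (q.primeFactors.card : ℝ) := by
          exact_mod_cast Finset.card_le_card (fun p hp => (Finset.mem_filter.1 hp).2)
      _ ≤ q := by
          have : q.primeFactors ⊆ Finset.Icc 1 q := by
            intro p hp
            rw [Nat.mem_primeFactors] at hp
            rw [Finset.mem_Icc]
            exact ⟨hp.1.one_lt.le, Nat.le_of_dvd (Nat.pos_of_ne_zero hp.2.2) hp.2.1⟩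
          have := Finset.card_le_card this
          simp only [Nat.card_Icc, Nat.add_sub_cancel] at this
          exact_mod_cast this
  have h3 : (χ.conductor : ℝ) ^ (1 / 2 : ℝ) ≤ q := by
    have a1 : (1 : ℝ) ≤ χ.conductor := by
      exact_mod_cast Nat.one_le_iff_ne_zero.2 χ.conductor_ne_zero
    have a2 : (χ.conductor : ℝ) ≤ q := by
      exact_mod_cast Nat.le_of_dvd (Nat.pos_of_ne_zero (NeZero.ne q)) χ.conductor_dvd_level
    calc (χ.conductor : ℝ) ^ (1 / 2 : ℝ) ≤ (χ.conductor : ℝ) ^ (1 : ℝ) :=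
          Real.rpow_le_rpow_of_exponent_le a1 (by norm_num)
      _ ≤ q := by rwa [Real.rpow_one]
  have h4 : ‖∑ p ∈ primesUpTo x, χ p‖ ≤ ‖∑ p ∈ primesUpTo x, χ.primitiveCharacter p‖ + q := by
    have := norm_le_norm_add_norm_sub' (∑ p ∈ primesUpTo x, χ p)
      (∑ p ∈ primesUpTo x, χ.primitiveCharacter p)
    linarith
  refine h4.trans ?_
  gcongr
  refine h1.trans ?_
  gcongr

theorem siegel_walfisz (A B : ℕ) : ∃ C x₀ : ℝ, 0 ≤ C ∧ ∀ x : ℝ, x₀ ≤ x → ∀ q : ℕ, 0 < q →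
    (q : ℝ) ≤ Real.log x ^ B → |chebErr x q 1| ≤ C * x / Real.log x ^ A := by
  obtain ⟨K, x₀, hK, h⟩ := prime_char_sum' (A + B)
  obtain ⟨x₁, hx₁⟩ := ((log_pow_le_eventually (A + B) 1 (by norm_num)).and
    (eventually_ge_atTop (max x₀ 3))).exists_forall_of_atTop
  refine ⟨K + 1, x₁, by positivity, ?_⟩
  intro x hx q hq hqB
  obtain ⟨hlp, hxm⟩ := hx₁ x hx
  have hx0' : x₀ ≤ x := (le_max_left _ _).trans hxm
  have hx3 : 3 ≤ x := (le_max_right _ _).trans hxm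
  have hx0 : 0 < x := by linarith
  have hlog : 1 ≤ Real.log x := by
    rw [Real.le_log_iff_exp_le hx0]
    linarith [Real.exp_one_lt_three]
  set L := Real.log x with hL
  haveI : NeZero q := ⟨hq.ne'⟩
  have hφ : (0 : ℝ) < q.totient := by exact_mod_cast Nat.totient_pos.2 hq
  set E := K * q * x / L ^ (A + B + 1) + q with hE
  have hE0 : 0 ≤ E := by positivity
  have o1 : (q.totient : ℂ) * primePiMod x q 1 = ∑ χ : DirichletCharacter ℂ q,
      ∑ p ∈ primesUpTo x, χ p := by
    rw [Finset.sum_comm]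
    simp only [DirichletCharacter.sum_characters_eq]
    rw [← Finset.sum_filter, Finset.sum_const, nsmul_eq_mul, primePiMod, mul_comm]
    congr 4
    ext p
    rw [← ZMod.natCast_eq_natCast_iff', Nat.cast_one]
  have o2 : ‖∑ p ∈ primesUpTo x, (1 : DirichletCharacter ℂ q) p - primePi x‖ ≤ E := by
    have : (primePi x : ℂ) = ∑ p ∈ primesUpTo x, 1 := by simp [primePi]
    rw [this, ← Finset.sum_sub_distrib]
    calc _ ≤ ∑ p ∈ primesUpTo x, if p ∈ q.primeFactors then (1 : ℝ) else 0 := by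
          apply norm_sum_le_of_le
          intro p hp
          rw [primesUpTo, Finset.mem_filter] at hp
          split_ifs with hpq
          · rw [Nat.mem_primeFactors] at hpq
            have : (1 : DirichletCharacter ℂ q) (p : ZMod q) = 0 := by
              apply MulChar.map_nonunit
              rw [ZMod.isUnit_iff_coprime, hp.2.coprime_iff_not_dvd, not_not]
              exact hpq.2.1
            rw [this]; simp
          · have hc : Nat.Coprime p q := by
              rw [hp.2.coprime_iff_not_dvd]
              intro hd
              exact hpq (Nat.mem_primeFactors.2 ⟨hp.2, hd, NeZero.ne q⟩)
            rw [MulChar.one_apply ((ZMod.isUnit_iff_coprime p q).2 hc)]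
            simp
      _ = (((primesUpTo x).filter (· ∈ q.primeFactors)).card : ℝ) := by
          rw [← Finset.sum_filter]; simp
      _ ≤ (q.primeFactors.card : ℝ) := by
          exact_mod_cast Finset.card_le_card (fun p hp => (Finset.mem_filter.1 hp).2)
      _ ≤ q := by
          have : q.primeFactors ⊆ Finset.Icc 1 q := by
            intro p hp
            rw [Nat.mem_primeFactors] at hp
            rw [Finset.mem_Icc]
            exact ⟨hp.1.one_lt.le, Nat.le_of_dvd (Nat.pos_of_ne_zero hp.2.2) hp.2.1⟩
          have := Finset.card_le_card this
          simp only [Nat.card_Icc, Nat.add_sub_cancel] at this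
          exact_mod_cast this
      _ ≤ E := by
          rw [hE]
          have : 0 ≤ K * q * x / L ^ (A + B + 1) := by positivity
          linarith
  classical
  have o3 : ‖(q.totient : ℂ) * primePiMod x q 1 - primePi x‖ ≤ q.totient * E := by
    have hsplit : (q.totient : ℂ) * primePiMod x q 1 - primePi x =
        ∑ χ : DirichletCharacter ℂ q, (∑ p ∈ primesUpTo x, χ p - if χ = 1 then (primePi x : ℂ) else 0) := by
      rw [o1, Finset.sum_sub_distrib]
      simp
    rw [hsplit]
    calc _ ≤ ∑ χ : DirichletCharacter ℂ q, E := by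
          apply norm_sum_le_of_le
          intro χ _
          split_ifs with hχ
          · rw [hχ]; exact o2
          · rw [sub_zero]
            exact h q χ hχ x hx0'
      _ = _ := by
          rw [Finset.sum_const, nsmul_eq_mul, Finset.card_univ, ← Nat.card_eq_fintype_card,
            DirichletCharacter.card_eq_totient_of_hasEnoughRootsOfUnity]
  have o4 : |(q.totient : ℝ) * primePiMod x q 1 - primePi x| ≤ q.totient * E := by
    rw [← Real.norm_eq_abs, ← Complex.norm_real]
    push_cast
    exact o3
  have o5 : |chebErr x q 1| ≤ E := by
    have : chebErr x q 1 = ((q.totient : ℝ) * primePiMod x q 1 - primePi x) / q.totient := by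
      rw [chebErr]; field_simp
    rw [this, abs_div, abs_of_pos hφ, div_le_iff₀ hφ, mul_comm E]
    exact o4
  refine o5.trans ?_
  rw [hE]
  have p1 : K * q * x / L ^ (A + B + 1) ≤ K * x / L ^ A := by
    rw [div_le_div_iff₀ (by positivity) (by positivity)]
    calc K * q * x * L ^ A ≤ K * (L ^ B) * x * L ^ A := by gcongr
      _ ≤ K * (L ^ B * L) * x * L ^ A := by
          gcongr
          exact le_mul_of_one_le_right (by positivity) hlog
      _ = _ := by ring
  have p2 : (q : ℝ) ≤ x / L ^ A := by
    rw [le_div_iff₀ (by positivity)]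
    calc (q : ℝ) * L ^ A ≤ L ^ B * L ^ A := by gcongr
      _ = L ^ (A + B) := by ring
      _ ≤ x := by linarith
  calc _ ≤ K * x / L ^ A + x / L ^ A := add_le_add p1 p2
    _ = _ := by ring

end

section

/-- Formal exponential `e^{aX}`. -/
noncomputable def pexp (a : ℝ) : PowerSeries ℝ := PowerSeries.mk fun k => a ^ k / (k.factorial : ℝ)

lemma pexp_eq (a : ℝ) : pexp a = PowerSeries.rescale a (PowerSeries.exp ℝ) := by
  ext k
  simp [pexp, PowerSeries.coeff_rescale, PowerSeries.coeff_exp, div_eq_mul_inv]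

lemma pexp_add (a b : ℝ) : pexp (a + b) = pexp a * pexp b := by
  rw [pexp_eq, pexp_eq, pexp_eq, PowerSeries.exp_mul_exp_eq_exp_add]

lemma pexp_zero : pexp 0 = 1 := by
  rw [pexp_eq]; simp

/-- Local factor. -/
noncomputable def rgs (p h : ℕ) : PowerSeries ℝ :=
  pexp (h * Real.log p) - pexp ((h - 1) * Real.log p)

lemma coeff_rgs (p h k : ℕ) : PowerSeries.coeff k (rgs p h) =
    ((h : ℝ) ^ k - ((h : ℝ) - 1) ^ k) * Real.log p ^ k / (k.factorial : ℝ) := by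
  simp only [rgs, pexp, map_sub, PowerSeries.coeff_mk, mul_pow]
  ring

/-- Multiplicative power series valued function. -/
noncomputable def rgf : ArithmeticFunction (PowerSeries ℝ) where
  toFun n := if n = 0 then 0 else ∏ p ∈ n.primeFactors, rgs p (n.factorization p)
  map_zero' := by simp

lemma rgf_apply {n : ℕ} (hn : n ≠ 0) : rgf n = ∏ p ∈ n.primeFactors, rgs p (n.factorization p) := by
  simp [rgf, hn]

lemma rho_eq (lam n : ℕ) (hn : n ≠ 0) :
    rho lam n = (lam.factorial : ℝ) * PowerSeries.coeff lam (rgf n) := by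
  classical
  rw [rho, rgf_apply hn, ← Finset.prod_coe_sort, PowerSeries.coeff_prod]
  congr 1
  refine Finset.sum_bij' (fun f _ => Finsupp.equivFunOnFinite.symm f) (fun l _ => ⇑l) ?_ ?_ ?_ ?_ ?_
  · intro f hf
    rw [Finset.mem_filter] at hf
    rw [Finset.mem_finsuppAntidiag]
    exact ⟨by simpa using hf.2, by simp⟩
  · intro l hl
    rw [Finset.mem_finsuppAntidiag] at hl
    rw [Finset.mem_filter, Fintype.mem_piFinset]
    refine ⟨fun p => ?_, hl.1⟩
    rw [Finset.mem_range, Nat.lt_succ_iff, ← hl.1]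
    exact Finset.single_le_sum (f := fun i => l i) (fun _ _ => Nat.zero_le _) (Finset.mem_univ p)
  · intro f _; ext; simp
  · intro l _; ext; simp
  · intro f _
    refine Finset.prod_congr rfl fun p _ => ?_
    rw [coeff_rgs]
    simp

lemma rgf_mult : rgf.IsMultiplicative := by
  rw [ArithmeticFunction.IsMultiplicative.iff_ne_zero]
  refine ⟨by simp [rgf_apply], ?_⟩
  intro m n hm hn hmn
  rw [rgf_apply hm, rgf_apply hn, rgf_apply (mul_ne_zero hm hn), hmn.primeFactors_mul,
    Finset.prod_union hmn.disjoint_primeFactors]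
  congr 1
  · refine Finset.prod_congr rfl fun p hp => ?_
    rw [Nat.factorization_eq_of_coprime_left hmn (by simpa using hp)]
  · refine Finset.prod_congr rfl fun p hp => ?_
    rw [Nat.factorization_eq_of_coprime_right hmn (by simpa using hp)]

/-- The function `n ↦ e^{(log n) X}`. -/
noncomputable def rge : ArithmeticFunction (PowerSeries ℝ) where
  toFun n := if n = 0 then 0 else pexp (Real.log n)
  map_zero' := by simp

lemma rge_mult : rge.IsMultiplicative := by
  rw [ArithmeticFunction.IsMultiplicative.iff_ne_zero]
  refine ⟨by simp [rge, pexp_zero], ?_⟩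
  intro m n hm hn _
  have hm' : (m : ℝ) ≠ 0 := by exact_mod_cast hm
  have hn' : (n : ℝ) ≠ 0 := by exact_mod_cast hn
  simp [rge, hm, hn, Real.log_mul hm' hn', pexp_add]

lemma rgf_prime_pow (p i : ℕ) (hp : p.Prime) : rgf (p ^ (i + 1)) = rgs p (i + 1) := by
  rw [rgf_apply (pow_ne_zero _ hp.ne_zero), Nat.primeFactors_prime_pow (by omega) hp]
  simp [hp.factorization_pow]

lemma rgf_zeta : (ArithmeticFunction.zeta : ArithmeticFunction (PowerSeries ℝ)) * rgf = rge := by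
  rw [ArithmeticFunction.IsMultiplicative.eq_iff_eq_on_prime_powers _
    (ArithmeticFunction.isMultiplicative_zeta.natCast.mul rgf_mult) _ rge_mult]
  intro p i hp
  rw [ArithmeticFunction.coe_zeta_mul_apply, Nat.sum_divisors_prime_pow hp]
  have hl : ∀ i : ℕ, rge (p ^ i) = pexp (i * Real.log p) := by
    intro i
    simp [rge, hp.ne_zero]
  rw [hl]
  induction i with
  | zero => simp [rgf_mult.1, pexp_zero]
  | succ i ih =>
    rw [Finset.sum_range_succ, ih, rgf_prime_pow p i hp, rgs]
    push_cast
    ring_nf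

lemma rho_sum (lam n : ℕ) (hn : n ≠ 0) :
    ∑ m ∈ n.divisors, rho lam m = Real.log n ^ lam := by
  have h := congrArg (fun f : ArithmeticFunction (PowerSeries ℝ) => PowerSeries.coeff lam (f n))
    rgf_zeta
  simp only [ArithmeticFunction.coe_zeta_mul_apply, map_sum] at h
  have h2 : PowerSeries.coeff lam (rge n) = Real.log n ^ lam / (lam.factorial : ℝ) := by
    simp [rge, hn, pexp]
  rw [h2] at h
  have h3 : ∑ m ∈ n.divisors, rho lam m =
      (lam.factorial : ℝ) * ∑ m ∈ n.divisors, PowerSeries.coeff lam (rgf m) := by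
    rw [Finset.mul_sum]
    exact Finset.sum_congr rfl fun m hm => rho_eq lam m (Nat.pos_of_mem_divisors hm).ne'
  rw [h3, h]
  have : (lam.factorial : ℝ) ≠ 0 := by exact_mod_cast lam.factorial_ne_zero
  field_simp

lemma rho_nonneg (lam n : ℕ) : 0 ≤ rho lam n := by
  rw [rho]
  refine mul_nonneg (by positivity) (Finset.sum_nonneg fun f _ => Finset.prod_nonneg fun p _ => ?_)
  have hp := p.2
  rw [Nat.mem_primeFactors] at hp
  have h1 : 1 ≤ n.factorization p := hp.1.factorization_pos_of_dvd hp.2.2 hp.2.1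
  have h1' : (1 : ℝ) ≤ n.factorization p := by exact_mod_cast h1
  have h2 : ((n.factorization (p : ℕ) : ℝ) - 1) ^ f p ≤ (n.factorization (p : ℕ) : ℝ) ^ f p :=
    pow_le_pow_left₀ (by linarith) (by linarith) _
  have h3 : 0 ≤ Real.log ((p : ℕ) : ℝ) := Real.log_natCast_nonneg _
  apply div_nonneg (mul_nonneg (by linarith) (by positivity)) (by positivity)

lemma rho_le (lam n : ℕ) (hn : n ≠ 0) : rho lam n ≤ Real.log n ^ lam := by
  rw [← rho_sum lam n hn]
  exact Finset.single_le_sum (fun m _ => rho_nonneg lam m) (Nat.mem_divisors_self n hn)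

lemma rho_one (lam : ℕ) (hlam : 0 < lam) : rho lam 1 = 0 := by
  have := rho_sum lam 1 one_ne_zero
  simpa [hlam.ne'] using this

lemma rho_prime (lam p : ℕ) (hlam : 0 < lam) (hp : p.Prime) : rho lam p = Real.log p ^ lam := by
  have := rho_sum lam p hp.ne_zero
  rwa [hp.divisors, Finset.sum_pair hp.one_lt.ne, rho_one lam hlam, zero_add] at this

lemma rho_eq_zero (lam n : ℕ) (h : lam < n.primeFactors.card) : rho lam n = 0 := by
  rw [rho, Finset.sum_eq_zero, mul_zero]
  intro f hf
  rw [Finset.mem_filter] at hf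
  by_contra hne
  rw [← ne_eq, Finset.prod_ne_zero_iff] at hne
  have h1 : ∀ p : n.primeFactors, 1 ≤ f p := by
    intro p
    by_contra h0
    have h0' : f p = 0 := by omega
    apply hne p (Finset.mem_univ p)
    rw [h0']; simp
  have h2 : ∑ p : n.primeFactors, 1 ≤ ∑ p, f p := Finset.sum_le_sum fun p _ => h1 p
  rw [hf.2] at h2
  simp at h2
  omega

end

section

/-- Bundled Lucas sequence recurrence. -/
structure IsLuc (a₁ a₂ : ℤ) (u : ℕ → ℤ) : Prop where
  h0 : u 0 = 0
  h1 : u 1 = 1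
  hrec : ∀ n : ℕ, u (n + 2) = a₁ * u (n + 1) + a₂ * u n

namespace IsLuc
variable {a₁ a₂ : ℤ} {u : ℕ → ℤ}

lemma add_formula (h : IsLuc a₁ a₂ u) (m n : ℕ) :
    u (m + n + 1) = u (m + 1) * u (n + 1) + a₂ * u m * u n := by
  suffices hh : u (m + n + 1) = u (m + 1) * u (n + 1) + a₂ * u m * u n ∧
      u (m + n + 2) = u (m + 1) * u (n + 2) + a₂ * u m * u (n + 1) from hh.1
  induction n with
  | zero =>
    simp only [add_zero, zero_add, h.h0, h.h1]
    refine ⟨by ring, ?_⟩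
    rw [h.hrec m]
    have := h.hrec 0
    simp only [zero_add, h.h0, h.h1] at this
    rw [this]; ring
  | succ n ih =>
    refine ⟨ih.2, ?_⟩
    have e1 := h.hrec (m + n + 1)
    have e2 := h.hrec (n + 1)
    have e3 := h.hrec n
    rw [show m + (n + 1) + 2 = m + n + 1 + 2 by ring, e1, show m + n + 1 + 1 = m + n + 2 by ring,
      ih.1, ih.2, show n + 1 + 2 = n + 1 + 2 by rfl, e2, show n + 1 + 1 = n + 2 by rfl, e3]
    ring

lemma norm_formula (h : IsLuc a₁ a₂ u) (n : ℕ) :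
    u (n + 1) ^ 2 - a₁ * u (n + 1) * u n - a₂ * u n ^ 2 = (-a₂) ^ n := by
  induction n with
  | zero => simp [h.h0, h.h1]
  | succ n ih =>
    rw [pow_succ (-a₂) n, ← ih, h.hrec n]
    ring

lemma coprime_succ (h : IsLuc a₁ a₂ u) {m : ℤ} (hm : IsCoprime m a₂) {n : ℕ} (hn : m ∣ u n) :
    IsCoprime m (u (n + 1)) := by
  obtain ⟨k, hk⟩ := hn
  have h1 : IsCoprime m (u (n + 1) ^ 2) := by
    have e : u (n + 1) ^ 2 = (-a₂) ^ n + m * (k * (a₁ * u (n + 1) + a₂ * u n)) := by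
      rw [← h.norm_formula n]
      linear_combination (a₁ * u (n + 1) + a₂ * u n) * hk
    rw [e]
    exact IsCoprime.add_mul_left_right (hm.neg_right.pow_right) _
  exact (IsCoprime.pow_right_iff (by norm_num)).1 h1

lemma dvd_add_iff (h : IsLuc a₁ a₂ u) {m : ℤ} (hm : IsCoprime m a₂) {a : ℕ} (ha : m ∣ u a)
    (b : ℕ) : m ∣ u (a + b) ↔ m ∣ u b := by
  rcases b with _ | b
  · simp [ha, h.h0]
  · rw [← add_assoc, h.add_formula]
    have h1 : m ∣ a₂ * u a * u b := (ha.mul_left a₂).mul_right _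
    rw [dvd_add_left h1]
    constructor
    · exact fun hh => (h.coprime_succ hm ha).dvd_of_dvd_mul_left hh
    · exact fun hh => hh.mul_left _

lemma exists_zero (h : IsLuc a₁ a₂ u) {m : ℕ} (hm0 : 0 < m) (hm : IsCoprime (m : ℤ) a₂) :
    ∃ n : ℕ, 0 < n ∧ n ≤ m ^ 2 ∧ (m : ℤ) ∣ u n := by
  haveI : NeZero m := ⟨hm0.ne'⟩
  set f : ZMod m × ZMod m → ZMod m × ZMod m := fun v => (v.2, a₁ * v.2 + a₂ * v.1) with hf
  obtain ⟨c, d, hcd⟩ := hm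
  have hunit : (d : ZMod m) * a₂ = 1 := by
    have := congrArg (fun z : ℤ => (z : ZMod m)) hcd
    simpa using this
  have hinj : Function.Injective f := by
    rintro ⟨x, y⟩ ⟨x', y'⟩ hxy
    simp only [hf, Prod.mk.injEq] at hxy
    obtain ⟨rfl, h2⟩ := hxy
    have h3 : (a₂ : ZMod m) * x = a₂ * x' := by linear_combination h2
    have h4 : x = x' := by linear_combination (d : ZMod m) * h3 + (x' - x) * hunit
    rw [h4]
  have hiter : ∀ n : ℕ, f^[n] (0, 1) = ((u n : ZMod m), (u (n + 1) : ZMod m)) := by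
    intro n
    induction n with
    | zero => simp [h.h0, h.h1]
    | succ n ih =>
      rw [Function.iterate_succ_apply', ih, h.hrec n]
      simp [hf]
  have hper := Function.isPeriodicPt_minimalPeriod f ((0, 1) : ZMod m × ZMod m)
  refine ⟨Function.minimalPeriod f (0, 1),
    Function.minimalPeriod_pos_of_mem_periodicPts (hinj.mem_periodicPts _), ?_, ?_⟩
  · refine Function.minimalPeriod_le_card.trans ?_
    simp [ZMod.card, sq]
  · have := hper.eq
    rw [hiter] at this
    exact (ZMod.intCast_zmod_eq_zero_iff_dvd _ _).1 (congrArg Prod.fst this)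

lemma zu_spec (h : IsLuc a₁ a₂ u) {m : ℕ} (hm0 : 0 < m) (hm : IsCoprime (m : ℤ) a₂) :
    0 < zu u m ∧ (m : ℤ) ∣ u (zu u m) := by
  obtain ⟨n, hn, _, hd⟩ := h.exists_zero hm0 hm
  exact Nat.sInf_mem (s := {n : ℕ | 0 < n ∧ (m : ℤ) ∣ u n}) ⟨n, hn, hd⟩

lemma zu_le (h : IsLuc a₁ a₂ u) {m : ℕ} (hm0 : 0 < m) (hm : IsCoprime (m : ℤ) a₂) :
    zu u m ≤ m ^ 2 := by
  obtain ⟨n, hn, hle, hd⟩ := h.exists_zero hm0 hm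
  exact (Nat.sInf_le (s := {n : ℕ | 0 < n ∧ (m : ℤ) ∣ u n}) ⟨hn, hd⟩).trans hle

lemma dvd_iff (h : IsLuc a₁ a₂ u) {m : ℕ} (hm0 : 0 < m) (hm : IsCoprime (m : ℤ) a₂) (n : ℕ) :
    (m : ℤ) ∣ u n ↔ zu u m ∣ n := by
  obtain ⟨hz, hd⟩ := h.zu_spec hm0 hm
  induction n using Nat.strong_induction_on with
  | _ n ih =>
    rcases lt_or_ge n (zu u m) with hlt | hge
    · rcases Nat.eq_zero_or_pos n with rfl | hpos
      · simp [h.h0]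
      · constructor
        · intro hh
          exact absurd (Nat.sInf_le (s := {n : ℕ | 0 < n ∧ (m : ℤ) ∣ u n}) ⟨hpos, hh⟩)
            (not_le.2 hlt)
        · intro hh
          exact absurd (Nat.le_of_dvd hpos hh) (not_le.2 hlt)
    · obtain ⟨k, rfl⟩ := Nat.exists_eq_add_of_le hge
      rw [h.dvd_add_iff hm hd, ih k (by omega)]
      exact (Nat.dvd_add_right dvd_rfl).symm

lemma coprime_of_dvd (h : IsLuc a₁ a₂ u) (hc : IsCoprime a₁ a₂) {m : ℤ} {n : ℕ} (hn : 0 < n)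
    (hd : m ∣ u n) : IsCoprime m a₂ := by
  obtain ⟨k, rfl⟩ : ∃ k, n = k + 1 := ⟨n - 1, by omega⟩
  have h1 : ∀ k : ℕ, IsCoprime (u (k + 1)) a₂ := by
    intro k
    induction k with
    | zero => simp [h.h1, isCoprime_one_left]
    | succ k ih =>
      rw [h.hrec]
      exact IsCoprime.add_mul_left_left (hc.mul_left ih) _
  exact (h1 k).of_isCoprime_of_dvd_left hd

lemma dvd_gu_iff (h : IsLuc a₁ a₂ u) (hc : IsCoprime a₁ a₂) {m n : ℕ} (hm0 : 0 < m) (hn : 0 < n) :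
    m ∣ gu u n ↔ (IsCoprime (m : ℤ) a₂ ∧ ellu u m ∣ n) := by
  have e : m ∣ gu u n ↔ (m ∣ n ∧ (m : ℤ) ∣ u n) := by
    rw [gu, ← Int.natCast_dvd_natCast, Int.dvd_coe_gcd_iff, Int.natCast_dvd_natCast]
  rw [e, ellu, Nat.lcm_dvd_iff]
  constructor
  · rintro ⟨h1, h2⟩
    have := h.coprime_of_dvd hc hn h2
    exact ⟨this, h1, (h.dvd_iff hm0 this n).1 h2⟩
  · rintro ⟨h1, h2, h3⟩
    exact ⟨h2, (h.dvd_iff hm0 h1 n).2 h3⟩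

lemma zu_dvd_zu (h : IsLuc a₁ a₂ u) {m n : ℕ} (hn0 : 0 < n) (hn : IsCoprime (n : ℤ) a₂)
    (hmn : m ∣ n) : zu u m ∣ zu u n := by
  have hm0 : 0 < m := Nat.pos_of_dvd_of_pos hmn hn0
  have hm : IsCoprime (m : ℤ) a₂ := hn.of_isCoprime_of_dvd_left (Int.natCast_dvd_natCast.2 hmn)
  rw [← h.dvd_iff hm0 hm]
  exact (Int.natCast_dvd_natCast.2 hmn).trans (h.zu_spec hn0 hn).2

lemma ellu_pos (h : IsLuc a₁ a₂ u) {m : ℕ} (hm0 : 0 < m) (hm : IsCoprime (m : ℤ) a₂) :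
    0 < ellu u m := Nat.lcm_pos hm0 (h.zu_spec hm0 hm).1

lemma ellu_le (h : IsLuc a₁ a₂ u) {m : ℕ} (hm0 : 0 < m) (hm : IsCoprime (m : ℤ) a₂) :
    ellu u m ≤ m ^ 3 := by
  calc ellu u m ≤ m * zu u m :=
        Nat.le_of_dvd (Nat.mul_pos hm0 (h.zu_spec hm0 hm).1) (Nat.lcm_dvd_mul _ _)
    _ ≤ m * m ^ 2 := Nat.mul_le_mul_left _ (h.zu_le hm0 hm)
    _ = m ^ 3 := by ring

lemma binet (h : IsLuc a₁ a₂ u) (K : Type*) [Field K] [IsAlgClosed K] :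
    ∃ α β : K, α ^ 2 = (a₁ : K) * α + a₂ ∧ β ^ 2 = (a₁ : K) * β + a₂ ∧ α * β = -a₂ ∧
      (α - β) ^ 2 = ((a₁ ^ 2 + 4 * a₂ : ℤ) : K) ∧ ∀ n, (α - β) * (u n : K) = α ^ n - β ^ n := by
  obtain ⟨α, hα⟩ := IsAlgClosed.exists_root
    (Polynomial.X ^ 2 + Polynomial.C (-(a₁ : K)) * Polynomial.X + Polynomial.C (-(a₂ : K))) (by
      have : (Polynomial.X ^ 2 + Polynomial.C (-(a₁ : K)) * Polynomial.X +
        Polynomial.C (-(a₂ : K))).degree = 2 := by compute_degree!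
      rw [this]; norm_num)
  have hα' : α ^ 2 = (a₁ : K) * α + a₂ := by
    simp [Polynomial.IsRoot.def] at hα
    linear_combination hα
  have hβ' : (a₁ - α) ^ 2 = (a₁ : K) * (a₁ - α) + a₂ := by linear_combination hα'
  refine ⟨α, a₁ - α, hα', hβ', by linear_combination -hα', ?_, ?_⟩
  · push_cast
    linear_combination 4 * hα'
  · intro n
    suffices hh : (α - (a₁ - α)) * (u n : K) = α ^ n - (a₁ - α) ^ n ∧
      (α - (a₁ - α)) * (u (n + 1) : K) = α ^ (n + 1) - (a₁ - α) ^ (n + 1) from hh.1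
    induction n with
    | zero => simp [h.h0, h.h1]
    | succ n ih =>
      refine ⟨ih.2, ?_⟩
      have e1 : α ^ (n + 1 + 1) = α ^ n * (a₁ * α + a₂) := by rw [← hα']; ring
      have e2 : (a₁ - α) ^ (n + 1 + 1) = (a₁ - α) ^ n * (a₁ * (a₁ - α) + a₂) := by
        rw [← hβ']; ring
      rw [e1, e2, h.hrec n]
      push_cast
      linear_combination (a₁ : K) * ih.2 + (a₂ : K) * ih.1

lemma not_dvd_zu (h : IsLuc a₁ a₂ u) {q : ℕ} (hq : q.Prime) (hc : IsCoprime (q : ℤ) a₂)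
    (hΔ : ¬ (q : ℤ) ∣ a₁ ^ 2 + 4 * a₂) : ¬ q ∣ zu u q := by
  haveI : Fact q.Prime := ⟨hq⟩
  rintro ⟨m, hm⟩
  obtain ⟨hz, hd⟩ := h.zu_spec hq.pos hc
  obtain ⟨α, β, -, -, -, hD, hB⟩ := h.binet (AlgebraicClosure (ZMod q))
  have hne : α - β ≠ 0 := by
    intro h0
    rw [h0] at hD
    apply hΔ
    rw [← CharP.intCast_eq_zero_iff (AlgebraicClosure (ZMod q)) q, ← hD]
    ring
  have hzero : ∀ n, (q : ℤ) ∣ u n ↔ α ^ n = β ^ n := by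
    intro n
    rw [← CharP.intCast_eq_zero_iff (AlgebraicClosure (ZMod q)) q, ← sub_eq_zero (a := α ^ n), ← hB]
    simp [hne]
  have h1 := (hzero _).1 hd
  have hm0 : 0 < m := by
    rcases Nat.eq_zero_or_pos m with rfl | h'
    · simp at hm; omega
    · exact h'
  have h2 : α ^ m = β ^ m := by
    apply frobenius_inj (AlgebraicClosure (ZMod q)) q
    simp only [frobenius_def]
    rw [← pow_mul, ← pow_mul, mul_comm m q, ← hm]
    exact h1
  have h3 := (h.dvd_iff hq.pos hc m).1 ((hzero m).2 h2)
  have h4 := Nat.le_of_dvd hm0 h3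
  have := hq.two_le
  nlinarith

lemma ne_zero (h : IsLuc a₁ a₂ u) (ha₂ : a₂ ≠ 0) (hΔ : a₁ ^ 2 + 4 * a₂ ≠ 0)
    (hnd : ∀ α β : ℂ, α ^ 2 = (a₁ : ℂ) * α + (a₂ : ℂ) →
      β ^ 2 = (a₁ : ℂ) * β + (a₂ : ℂ) → α ≠ β → ∀ k : ℕ, 0 < k → (α / β) ^ k ≠ 1)
    {n : ℕ} (hn : 0 < n) : u n ≠ 0 := by
  intro h0
  obtain ⟨α, β, hα, hβ, hab, hD, hB⟩ := h.binet ℂ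
  have hne : α ≠ β := by
    rintro rfl
    apply hΔ
    have : ((a₁ ^ 2 + 4 * a₂ : ℤ) : ℂ) = 0 := by rw [← hD]; ring
    exact_mod_cast this
  have hβ0 : β ≠ 0 := by
    rintro rfl
    apply ha₂
    have : (a₂ : ℂ) = 0 := by linear_combination hab
    exact_mod_cast this
  apply hnd α β hα hβ hne n hn
  have := hB n
  rw [h0] at this
  rw [div_pow, div_eq_one_iff_eq (pow_ne_zero _ hβ0)]
  simp at this
  linear_combination -this

lemma abs_le (h : IsLuc a₁ a₂ u) (ha₂ : a₂ ≠ 0) (n : ℕ) :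
    (u n).natAbs ≤ (a₁.natAbs + a₂.natAbs) ^ n := by
  have hc : 1 ≤ a₂.natAbs := Int.natAbs_pos.2 ha₂
  suffices hh : (u n).natAbs ≤ (a₁.natAbs + a₂.natAbs) ^ n ∧
    (u (n + 1)).natAbs ≤ (a₁.natAbs + a₂.natAbs) ^ (n + 1) from hh.1
  set c := a₁.natAbs + a₂.natAbs with hcdef
  induction n with
  | zero => simp [h.h0, h.h1]; omega
  | succ n ih =>
    refine ⟨ih.2, ?_⟩
    rw [h.hrec]
    calc _ ≤ (a₁ * u (n + 1)).natAbs + (a₂ * u n).natAbs := Int.natAbs_add_le _ _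
      _ = a₁.natAbs * (u (n + 1)).natAbs + a₂.natAbs * (u n).natAbs := by
          rw [Int.natAbs_mul, Int.natAbs_mul]
      _ ≤ a₁.natAbs * c ^ (n + 1) + a₂.natAbs * c ^ n := by
          gcongr
          · exact ih.2
          · exact ih.1
      _ ≤ a₁.natAbs * c ^ (n + 1) + a₂.natAbs * c ^ (n + 1) := by
          gcongr
          · omega
          · omega
      _ = c ^ (n + 1 + 1) := by rw [pow_succ _ (n + 1), ← add_mul, hcdef, mul_comm]

lemma card_primeFactors_le (h : IsLuc a₁ a₂ u) (ha₂ : a₂ ≠ 0) {n : ℕ} (hn : u n ≠ 0) :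
    (u n).natAbs.primeFactors.card ≤ (a₁.natAbs + a₂.natAbs) * n := by
  set c := a₁.natAbs + a₂.natAbs with hcdef
  have h1 : 2 ^ (u n).natAbs.primeFactors.card ≤ (u n).natAbs := by
    calc _ ≤ ∏ p ∈ (u n).natAbs.primeFactors, p :=
          Finset.pow_card_le_prod _ _ _ (fun p hp => (Nat.prime_of_mem_primeFactors hp).two_le)
      _ ≤ _ := Nat.le_of_dvd (Int.natAbs_pos.2 hn) (Nat.prod_primeFactors_dvd _)
  have h2 : (u n).natAbs ≤ 2 ^ (c * n) := by
    rw [pow_mul]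
    exact (h.abs_le ha₂ n).trans (Nat.pow_le_pow_left Nat.lt_two_pow_self.le n)
  exact (Nat.pow_le_pow_iff_right (by norm_num)).1 (h1.trans h2)

end IsLuc

end

section

lemma prod_one_sub_inv_ge (S : Finset ℕ) : (∀ p ∈ S, 2 ≤ p) →
    (1 : ℚ) ≤ ((S.card : ℚ) + 1) * ∏ p ∈ S, (1 - (p : ℚ)⁻¹) := by
  induction S using Finset.induction_on_max with
  | empty => simp
  | insert a s hlt ih =>
    intro h2
    have ha : a ∉ s := fun h => (hlt a h).false
    have hs : ∀ p ∈ s, 2 ≤ p := fun p hp => h2 p (Finset.mem_insert_of_mem hp)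
    have ha2 := h2 a (Finset.mem_insert_self _ _)
    have hcard : s.card + 2 ≤ a := by
      have : s ⊆ Finset.Ico 2 a := fun p hp => Finset.mem_Ico.2 ⟨hs p hp, hlt p hp⟩
      have := Finset.card_le_card this
      rw [Nat.card_Ico] at this
      omega
    rw [Finset.prod_insert ha, Finset.card_insert_of_notMem ha]
    push_cast
    have hc' : (s.card : ℚ) + 2 ≤ a := by exact_mod_cast hcard
    have hpos : (0 : ℚ) < a := by positivity
    have key : ((s.card : ℚ) + 1) ≤ (s.card + 1 + 1) * (1 - (a : ℚ)⁻¹) := by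
      have : (a : ℚ)⁻¹ * ((s.card : ℚ) + 2) ≤ 1 := by
        rw [inv_mul_le_iff₀ hpos]; linarith
      nlinarith
    have hP : (0 : ℚ) ≤ ∏ p ∈ s, (1 - (p : ℚ)⁻¹) := by
      apply Finset.prod_nonneg
      intro p hp
      have : (1 : ℚ) ≤ p := by exact_mod_cast (hs p hp).trans' (by norm_num)
      have := inv_le_one_of_one_le₀ this
      linarith
    calc (1 : ℚ) ≤ _ := ih hs
      _ ≤ (s.card + 1 + 1) * (1 - (a : ℚ)⁻¹) * ∏ p ∈ s, (1 - (p : ℚ)⁻¹) := by gcongr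
      _ = _ := by ring

lemma le_totient_mul (m : ℕ) (hm : 0 < m) :
    (m : ℝ) ≤ (Nat.totient m : ℝ) * (1 + 2 * Real.log m) := by
  have h1 : (m : ℚ) ≤ (Nat.totient m : ℚ) * (m.primeFactors.card + 1) := by
    rw [Nat.totient_eq_mul_prod_factors]
    have := prod_one_sub_inv_ge m.primeFactors
      (fun p hp => (Nat.prime_of_mem_primeFactors hp).two_le)
    have hm' : (0 : ℚ) < m := by exact_mod_cast hm
    nlinarith
  have h2 : (m : ℝ) ≤ (Nat.totient m : ℝ) * (m.primeFactors.card + 1) := by exact_mod_cast h1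
  have h3 : 2 ^ m.primeFactors.card ≤ m := by
    calc _ ≤ ∏ p ∈ m.primeFactors, p :=
          Finset.pow_card_le_prod _ _ _ (fun p hp => (Nat.prime_of_mem_primeFactors hp).two_le)
      _ ≤ _ := Nat.le_of_dvd hm (Nat.prod_primeFactors_dvd _)
  have h4 : (m.primeFactors.card : ℝ) * Real.log 2 ≤ Real.log m := by
    rw [← Real.log_pow]
    apply Real.log_le_log (by positivity)
    exact_mod_cast h3
  have h5 := Real.log_two_gt_d9
  have h6 : (m.primeFactors.card : ℝ) ≤ 2 * Real.log m := by
    have : (0 : ℝ) ≤ m.primeFactors.card := by positivity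
    nlinarith
  exact h2.trans (mul_le_mul_of_nonneg_left (by linarith) (by positivity))

lemma log_pow_mul_le (lam : ℕ) (ε : ℝ) (hε : 0 < ε) : ∃ C : ℝ, 0 < C ∧ ∀ n : ℕ, 0 < n →
    Real.log n ^ lam * (1 + 6 * Real.log n) ≤ C * (n : ℝ) ^ ε := by
  set e : ℝ := ε / (lam + 1) with he
  have he0 : 0 < e := by positivity
  refine ⟨(1 / e) ^ lam * (1 + 6 / e), by positivity, fun n hn => ?_⟩
  have hn1 : (1 : ℝ) ≤ n := by exact_mod_cast hn
  have h0 : 0 ≤ Real.log n := Real.log_nonneg hn1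
  have h1 : Real.log n ≤ (n : ℝ) ^ e / e := Real.log_le_rpow_div (by positivity) he0
  have h2 : (1 : ℝ) ≤ (n : ℝ) ^ e := Real.one_le_rpow hn1 he0.le
  calc Real.log n ^ lam * (1 + 6 * Real.log n)
      ≤ ((n : ℝ) ^ e / e) ^ lam * ((n : ℝ) ^ e + 6 * ((n : ℝ) ^ e / e)) := by gcongr
    _ = (1 / e) ^ lam * (1 + 6 / e) * (((n : ℝ) ^ e) ^ lam * (n : ℝ) ^ e) := by
        rw [div_eq_mul_one_div, mul_pow]; ring
    _ = _ := by
        congr 1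
        rw [← pow_succ, ← Real.rpow_natCast, ← Real.rpow_mul (by positivity)]
        congr 1
        rw [he]; push_cast; field_simp

lemma card_divisors_le_sqrt (z : ℕ) (hz : 0 < z) :
    (z.divisors.card : ℝ) ≤ 2 * Real.sqrt z := by
  have hsub : z.divisors ⊆ (Finset.Icc 1 z.sqrt) ∪ (Finset.Icc 1 z.sqrt).image (fun d => z / d) := by
    intro d hd
    obtain ⟨⟨e, rfl⟩, -⟩ := Nat.mem_divisors.1 hd
    have hd0 : 0 < d := Nat.pos_of_mul_pos_right hz
    have he0 : 0 < e := Nat.pos_of_mul_pos_left hz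
    rw [Finset.mem_union, Finset.mem_image]
    rcases le_total d e with h | h
    · left
      rw [Finset.mem_Icc]
      exact ⟨hd0, Nat.le_sqrt.2 (Nat.mul_le_mul_left _ h)⟩
    · right
      refine ⟨e, ?_, Nat.mul_div_cancel _ he0⟩
      rw [Finset.mem_Icc]
      exact ⟨he0, Nat.le_sqrt.2 (Nat.mul_le_mul_right _ h)⟩
  have h1 : z.divisors.card ≤ z.sqrt + z.sqrt := by
    calc _ ≤ _ := Finset.card_le_card hsub
      _ ≤ _ := Finset.card_union_le _ _
      _ ≤ _ := by
        gcongr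
        · simp
        · exact Finset.card_image_le.trans (by simp)
  have h2 := Real.nat_sqrt_le_real_sqrt (a := z)
  have h3 : (z.divisors.card : ℝ) ≤ z.sqrt + z.sqrt := by exact_mod_cast h1
  linarith

lemma summ_inj {β : Type*} {S : Set ℕ} {F : β → ℝ} (hF : Summable F) {φ : ℕ → β}
    (hinj : Set.InjOn φ S) {T : ℕ → ℝ} (hT : ∀ n ∈ S, 0 ≤ T n ∧ T n ≤ F (φ n)) :
    Summable (S.indicator T) := by
  rw [← summable_subtype_iff_indicator]
  refine Summable.of_nonneg_of_le (fun n => (hT n n.2).1) (fun n => (hT n n.2).2)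
    (hF.comp_injective (i := fun n : S => φ n) ?_)
  intro a b hab
  exact Subtype.ext (hinj a.2 b.2 hab)

end

section

namespace IsLuc
variable {a₁ a₂ : ℤ} {u : ℕ → ℤ}

/-- Sum over primes of `z(q)^(-3)`. -/
lemma summable_zu_cube (h : IsLuc a₁ a₂ u) (ha₂ : a₂ ≠ 0) (hne : ∀ n : ℕ, 0 < n → u n ≠ 0) :
    Summable (({q : ℕ | q.Prime ∧ IsCoprime (q : ℤ) a₂}).indicator
      (fun q => ((zu u q : ℝ) ^ 3)⁻¹)) := by
  classical
  set F : ℕ × ℕ → ℝ := fun mq =>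
    if mq.2 ∈ (u mq.1).natAbs.primeFactors then ((mq.1 : ℝ) ^ 3)⁻¹ else 0 with hF
  have hF0 : 0 ≤ F := by
    intro x
    simp only [hF, Pi.zero_apply]
    split_ifs <;> positivity
  have hfib : ∀ m, HasSum (fun q => F (m, q))
      (∑ q ∈ (u m).natAbs.primeFactors, ((m : ℝ) ^ 3)⁻¹) := by
    intro m
    have : ∀ q ∉ (u m).natAbs.primeFactors, F (m, q) = 0 := by
      intro q hq
      simp only [hF, hq, if_false]
    have h2 : HasSum (fun q => F (m, q)) _ := hasSum_sum_of_ne_finset_zero this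
    convert h2 using 1
    apply Finset.sum_congr rfl
    intro q hq
    simp only [hF, hq, if_true]
  have hFs : Summable F := by
    rw [summable_prod_of_nonneg hF0]
    refine ⟨fun m => (hfib m).summable, ?_⟩
    simp only [fun m => (hfib m).tsum_eq, Finset.sum_const, nsmul_eq_mul]
    refine Summable.of_nonneg_of_le (fun m => by positivity) (fun m => ?_)
      ((Real.summable_nat_pow_inv (p := 2).2 (by norm_num)).mul_left
        ((a₁.natAbs + a₂.natAbs : ℕ) : ℝ))
    rcases Nat.eq_zero_or_pos m with rfl | hm
    · simp
    · have := h.card_primeFactors_le ha₂ (hne m hm)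
      have h' : ((u m).natAbs.primeFactors.card : ℝ) ≤ ((a₁.natAbs + a₂.natAbs : ℕ) : ℝ) * m := by
        exact_mod_cast this
      have hm' : (0 : ℝ) < m := by exact_mod_cast hm
      calc _ ≤ ((a₁.natAbs + a₂.natAbs : ℕ) : ℝ) * m * ((m : ℝ) ^ 3)⁻¹ := by gcongr
        _ = _ := by field_simp
  refine summ_inj hFs (φ := fun q => (zu u q, q)) (fun a _ b _ hab => (Prod.ext_iff.1 hab).2) ?_
  rintro q ⟨hq, hc⟩
  refine ⟨by positivity, ?_⟩
  obtain ⟨hz, hd⟩ := h.zu_spec hq.pos hc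
  have : q ∈ (u (zu u q)).natAbs.primeFactors := by
    rw [Nat.mem_primeFactors]
    exact ⟨hq, Int.natCast_dvd.1 hd, by simpa using hne _ hz⟩
  simp only [hF, this, if_true, le_refl]

lemma summable_q_zu (h : IsLuc a₁ a₂ u) (ha₂ : a₂ ≠ 0) (hne : ∀ n : ℕ, 0 < n → u n ≠ 0) :
    Summable (({q : ℕ | q.Prime ∧ IsCoprime (q : ℤ) a₂}).indicator
      (fun q => (q : ℝ) ^ (-(23 / 24) : ℝ) * (zu u q : ℝ) ^ (-(1 / 2) : ℝ))) := by
  have s1 := h.summable_zu_cube ha₂ hne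
  have s2 : Summable (fun q : ℕ => (q : ℝ) ^ (-(27 / 24) : ℝ)) :=
    Real.summable_nat_rpow.2 (by norm_num)
  refine Summable.of_nonneg_of_le (fun q => ?_) (fun q => ?_) (s1.add s2)
  · exact Set.indicator_nonneg (fun q _ => by positivity) _
  · by_cases hq : q ∈ {q : ℕ | q.Prime ∧ IsCoprime (q : ℤ) a₂}
    · simp only [Set.indicator_of_mem hq]
      have hz := (h.zu_spec hq.1.pos hq.2).1
      have hz1 : (1 : ℝ) ≤ zu u q := by exact_mod_cast hz
      have hq1 : (1 : ℝ) ≤ q := by exact_mod_cast hq.1.one_lt.le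
      rcases le_total (q : ℝ) ((zu u q : ℝ) ^ 3) with hle | hle
      · refine le_add_of_nonneg_of_le (by positivity) ?_
        have e1 : (zu u q : ℝ) ^ (-(1 / 2) : ℝ) = ((zu u q : ℝ) ^ 3) ^ (-(1 / 6) : ℝ) := by
          rw [← Real.rpow_natCast, ← Real.rpow_mul (by positivity)]; norm_num
        have e2 : ((zu u q : ℝ) ^ 3) ^ (-(1 / 6) : ℝ) ≤ (q : ℝ) ^ (-(1 / 6) : ℝ) :=
          Real.rpow_le_rpow_of_nonpos (by positivity) hle (by norm_num)
        calc _ ≤ (q : ℝ) ^ (-(23 / 24) : ℝ) * (q : ℝ) ^ (-(1 / 6) : ℝ) := by rw [e1]; gcongr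
          _ = _ := by rw [← Real.rpow_add (by positivity)]; norm_num
      · refine le_add_of_le_of_nonneg ?_ (by positivity)
        have e2 : (q : ℝ) ^ (-(23 / 24) : ℝ) ≤ ((zu u q : ℝ) ^ 3) ^ (-(23 / 24) : ℝ) :=
          Real.rpow_le_rpow_of_nonpos (by positivity) hle (by norm_num)
        calc _ ≤ ((zu u q : ℝ) ^ 3) ^ (-(23 / 24) : ℝ) * (zu u q : ℝ) ^ (-(1 / 2) : ℝ) := by gcongr
          _ = (zu u q : ℝ) ^ (-(27 / 8) : ℝ) := by
              rw [← Real.rpow_natCast, ← Real.rpow_mul (by positivity),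
                ← Real.rpow_add (by positivity)]
              norm_num
          _ ≤ (zu u q : ℝ) ^ (-3 : ℝ) := Real.rpow_le_rpow_of_exponent_le hz1 (by norm_num)
          _ = _ := by
              rw [Real.rpow_neg (by positivity)]
              norm_cast
    · simp only [Set.indicator_of_notMem hq]
      positivity

/-- The sum over pairs `(q, g)` with `g ∣ z(q)`. -/
lemma summable_pairs (h : IsLuc a₁ a₂ u) (ha₂ : a₂ ≠ 0) (hne : ∀ n : ℕ, 0 < n → u n ≠ 0) :
    Summable (({x : ℕ × ℕ | (x.1.Prime ∧ IsCoprime (x.1 : ℤ) a₂) ∧ x.2 ∈ (zu u x.1).divisors}).indicator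
      (fun x => (x.1 : ℝ) ^ (-(23 / 24) : ℝ) * (zu u x.1 : ℝ)⁻¹)) := by
  classical
  set F := (({x : ℕ × ℕ | (x.1.Prime ∧ IsCoprime (x.1 : ℤ) a₂) ∧
      x.2 ∈ (zu u x.1).divisors}).indicator
      (fun x => (x.1 : ℝ) ^ (-(23 / 24) : ℝ) * (zu u x.1 : ℝ)⁻¹)) with hF
  have hF0 : 0 ≤ F := fun x => Set.indicator_nonneg (fun q _ => by positivity) _
  have hfib : ∀ q, HasSum (fun g => F (q, g)) (∑ g ∈ (zu u q).divisors, F (q, g)) := by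
    intro q
    apply hasSum_sum_of_ne_finset_zero
    intro g hg
    rw [hF, Set.indicator_of_notMem]
    exact fun hh => hg hh.2
  rw [summable_prod_of_nonneg hF0]
  refine ⟨fun q => (hfib q).summable, ?_⟩
  simp only [fun m => (hfib m).tsum_eq]
  refine Summable.of_nonneg_of_le (fun q => Finset.sum_nonneg fun g _ => hF0 _) (fun q => ?_)
    ((h.summable_q_zu ha₂ hne).mul_left 2)
  by_cases hq : q ∈ {q : ℕ | q.Prime ∧ IsCoprime (q : ℤ) a₂}
  · rw [Set.indicator_of_mem hq]
    have hz := (h.zu_spec hq.1.pos hq.2).1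
    have hz0 : (0 : ℝ) < zu u q := by exact_mod_cast hz
    have e : ∀ g ∈ (zu u q).divisors, F (q, g) = (q : ℝ) ^ (-(23 / 24) : ℝ) * (zu u q : ℝ)⁻¹ := by
      intro g hg
      rw [hF, Set.indicator_of_mem]
      exact ⟨hq, hg⟩
    rw [Finset.sum_congr rfl e, Finset.sum_const, nsmul_eq_mul]
    have h1 := card_divisors_le_sqrt _ hz
    calc _ ≤ 2 * Real.sqrt (zu u q) * ((q : ℝ) ^ (-(23 / 24) : ℝ) * (zu u q : ℝ)⁻¹) := by gcongr
      _ = 2 * ((q : ℝ) ^ (-(23 / 24) : ℝ) * (Real.sqrt (zu u q) * (zu u q : ℝ)⁻¹)) := by ring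
      _ = _ := by
          congr 2
          rw [Real.sqrt_eq_rpow, ← Real.rpow_neg_one, ← Real.rpow_add hz0]
          norm_num
  · rw [Set.indicator_of_notMem hq]
    rw [mul_zero]
    apply (Finset.sum_eq_zero _).le
    intro g _
    rw [hF, Set.indicator_of_notMem]
    exact fun hh => hq hh.1

end IsLuc

/-- The largest prime power exactly dividing `n`. -/
lemma exists_big_prime (n : ℕ) (hn : 1 < n) : ∃ q : ℕ, q.Prime ∧ q ∣ n ∧
    n ≤ (q ^ n.factorization q) ^ n.primeFactors.card := by
  obtain ⟨q, hq, hmax⟩ := Finset.exists_max_image n.primeFactors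
    (fun p => p ^ n.factorization p) (Nat.nonempty_primeFactors.2 hn)
  refine ⟨q, Nat.prime_of_mem_primeFactors hq, Nat.dvd_of_mem_primeFactors hq, ?_⟩
  conv_lhs => rw [← Nat.prod_factorization_pow_eq_self (show n ≠ 0 by omega)]
  rw [Finsupp.prod, Nat.support_factorization]
  exact Finset.prod_le_pow_card _ _ _ hmax

end

section

namespace IsLuc
variable {a₁ a₂ : ℤ} {u : ℕ → ℤ}

lemma rpow_delta_le {n k Q lam : ℕ} (hlam : 0 < lam) (hk : 0 < k) (hQ : 0 < Q) (hn : n = Q * k)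
    (hle : n ≤ Q ^ lam) :
    (n : ℝ) ^ (1 / (48 * lam) : ℝ) ≤ (k : ℝ) ^ (-(1 / (48 * lam)) : ℝ) * (Q : ℝ) ^ (1 / 24 : ℝ) := by
  have hk0 : (0 : ℝ) < k := by exact_mod_cast hk
  have hQ0 : (0 : ℝ) < Q := by exact_mod_cast hQ
  have hl0 : (0 : ℝ) < lam := by exact_mod_cast hlam
  have hkn : (k : ℝ) ≤ (Q : ℝ) ^ lam := by
    have : k ≤ n := by rw [hn]; exact Nat.le_mul_of_pos_left _ hQ
    exact_mod_cast this.trans hle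
  have hnn : (n : ℝ) ≤ (Q : ℝ) ^ lam := by exact_mod_cast hle
  rw [Real.rpow_neg hk0.le, ← div_eq_inv_mul, le_div_iff₀ (by positivity)]
  calc _ ≤ ((Q : ℝ) ^ lam) ^ (1 / (48 * lam) : ℝ) * ((Q : ℝ) ^ lam) ^ (1 / (48 * lam) : ℝ) := by
        gcongr
    _ = _ := by
        rw [← Real.rpow_natCast, ← Real.rpow_mul hQ0.le, ← Real.rpow_add hQ0]
        congr 1
        field_simp
        norm_num

lemma term_le_A {n k Q lam L : ℕ} (hlam : 0 < lam) (hk : 0 < k) (hQ : 0 < Q) (hn : n = Q * k)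
    (hle : n ≤ Q ^ lam) (hL : n ≤ L) :
    (n : ℝ) ^ (1 / (48 * lam) : ℝ) / L ≤
      (Q : ℝ) ^ (-(23 / 24) : ℝ) * (k : ℝ) ^ (-(1 + 1 / (48 * lam)) : ℝ) := by
  have hk0 : (0 : ℝ) < k := by exact_mod_cast hk
  have hQ0 : (0 : ℝ) < Q := by exact_mod_cast hQ
  have hLr : (Q : ℝ) * k ≤ L := by exact_mod_cast hn ▸ hL
  calc _ ≤ ((k : ℝ) ^ (-(1 / (48 * lam)) : ℝ) * (Q : ℝ) ^ (1 / 24 : ℝ)) / (Q * k) := by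
        gcongr
        exact rpow_delta_le hlam hk hQ hn hle
    _ = ((Q : ℝ) ^ (1 / 24 : ℝ) * (Q : ℝ) ^ (-1 : ℝ)) *
          ((k : ℝ) ^ (-(1 / (48 * lam)) : ℝ) * (k : ℝ) ^ (-1 : ℝ)) := by
        rw [Real.rpow_neg_one, Real.rpow_neg_one]
        field_simp
    _ = _ := by
        rw [← Real.rpow_add hQ0, ← Real.rpow_add hk0]
        congr 2
        · norm_num
        · ring

lemma term_le_B {n k j g q z lam L : ℕ} (hlam : 0 < lam) (hj : 0 < j) (hg : 0 < g) (hq : 0 < q)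
    (hz : 0 < z) (hkj : k = g * j) (hn : n = q * k)
    (hle : n ≤ q ^ lam) (hL : q * (j * z) ≤ L) :
    (n : ℝ) ^ (1 / (48 * lam) : ℝ) / L ≤
      (q : ℝ) ^ (-(23 / 24) : ℝ) * (z : ℝ)⁻¹ * (j : ℝ) ^ (-(1 + 1 / (48 * lam)) : ℝ) := by
  have hk : 0 < k := by rw [hkj]; positivity
  have hk0 : (0 : ℝ) < k := by exact_mod_cast hk
  have hj0 : (0 : ℝ) < j := by exact_mod_cast hj
  have hz0 : (0 : ℝ) < z := by exact_mod_cast hz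
  have hQ0 : (0 : ℝ) < q := by exact_mod_cast hq
  have hLr : (q : ℝ) * (j * z) ≤ L := by exact_mod_cast hL
  have hjk : (j : ℝ) ≤ k := by
    have : j ≤ k := by rw [hkj]; exact Nat.le_mul_of_pos_left _ hg
    exact_mod_cast this
  have hkj' : (k : ℝ) ^ (-(1 / (48 * lam)) : ℝ) ≤ (j : ℝ) ^ (-(1 / (48 * lam)) : ℝ) :=
    Real.rpow_le_rpow_of_nonpos hj0 hjk (by simp)
  calc _ ≤ ((k : ℝ) ^ (-(1 / (48 * lam)) : ℝ) * (q : ℝ) ^ (1 / 24 : ℝ)) / (q * (j * z)) := by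
        gcongr
        exact rpow_delta_le hlam hk hq hn hle
    _ ≤ ((j : ℝ) ^ (-(1 / (48 * lam)) : ℝ) * (q : ℝ) ^ (1 / 24 : ℝ)) / (q * (j * z)) := by
        gcongr
    _ = ((q : ℝ) ^ (1 / 24 : ℝ) * (q : ℝ) ^ (-1 : ℝ)) * (z : ℝ)⁻¹ *
          ((j : ℝ) ^ (-(1 / (48 * lam)) : ℝ) * (j : ℝ) ^ (-1 : ℝ)) := by
        rw [Real.rpow_neg_one, Real.rpow_neg_one]
        field_simp
    _ = _ := by
        rw [← Real.rpow_add hQ0, ← Real.rpow_add hj0]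
        congr 2
        · norm_num
        · ring

lemma ell_lower (h : IsLuc a₁ a₂ u) {q k : ℕ} (hq : q.Prime) (hk : 0 < k)
    (hc : IsCoprime ((q * k : ℕ) : ℤ) a₂) (hqk : ¬ q ∣ k) (hΔ : ¬ (q : ℤ) ∣ a₁ ^ 2 + 4 * a₂) :
    q * (k / Nat.gcd k (zu u q) * zu u q) ≤ ellu u (q * k) := by
  have hqk0 : 0 < q * k := Nat.mul_pos hq.pos hk
  have hcq : IsCoprime (q : ℤ) a₂ :=
    hc.of_isCoprime_of_dvd_left (Int.natCast_dvd_natCast.2 (Dvd.intro _ rfl))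
  have hz := (h.zu_spec hq.pos hcq).1
  have h1 : zu u q ∣ zu u (q * k) := h.zu_dvd_zu hqk0 hc (Dvd.intro _ rfl)
  have e : k / Nat.gcd k (zu u q) * zu u q = Nat.lcm k (zu u q) := by
    rw [Nat.lcm, Nat.div_mul_right_comm (Nat.gcd_dvd_left _ _)]
  rw [e]
  apply Nat.le_of_dvd (h.ellu_pos hqk0 hc)
  apply Nat.Coprime.mul_dvd_of_dvd_of_dvd
  · rw [hq.coprime_iff_not_dvd]
    intro hd
    have := hd.trans (Nat.lcm_dvd_mul k (zu u q))
    rcases hq.dvd_mul.1 this with h2 | h2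
    · exact hqk h2
    · exact h.not_dvd_zu hq hcq hΔ h2
  · exact (Dvd.intro _ rfl : q ∣ q * k).trans (Nat.dvd_lcm_left _ _)
  · exact Nat.lcm_dvd ((Dvd.intro_left _ rfl : k ∣ q * k).trans (Nat.dvd_lcm_left _ _))
      (h1.trans (Nat.dvd_lcm_right _ _))

lemma summable_main (h : IsLuc a₁ a₂ u) (ha₂ : a₂ ≠ 0) (hΔ : a₁ ^ 2 + 4 * a₂ ≠ 0)
    (hne : ∀ n : ℕ, 0 < n → u n ≠ 0) (lam : ℕ) (hlam : 0 < lam) :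
    Summable (({n : ℕ | 1 < n ∧ IsCoprime (n : ℤ) a₂ ∧ n.primeFactors.card ≤ lam}).indicator
      (fun n => (n : ℝ) ^ (1 / (48 * lam) : ℝ) / (ellu u n : ℝ))) := by
  classical
  have hex : ∀ n : ℕ, ∃ q : ℕ, 1 < n → q.Prime ∧ q ∣ n ∧
      n ≤ (q ^ n.factorization q) ^ n.primeFactors.card := by
    intro n
    by_cases hn : 1 < n
    · obtain ⟨q, hq⟩ := exists_big_prime n hn
      exact ⟨q, fun _ => hq⟩
    · exact ⟨0, fun h => absurd h hn⟩
  choose q hq using hex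
  set hh : ℕ → ℕ := fun n => n.factorization (q n) with hhdef
  set k : ℕ → ℕ := fun n => n / q n ^ n.factorization (q n) with hkdef
  set T : ℕ → ℝ := fun n => (n : ℝ) ^ (1 / (48 * lam) : ℝ) / (ellu u n : ℝ) with hT
  set S := {n : ℕ | 1 < n ∧ IsCoprime (n : ℤ) a₂ ∧ n.primeFactors.card ≤ lam} with hS
  have hl0 : (0 : ℝ) < lam := by exact_mod_cast hlam
  have hnk : ∀ n, n = q n ^ hh n * k n := fun n => (Nat.ordProj_mul_ordCompl_eq_self n (q n)).symm
  have hkpos : ∀ n ∈ S, 0 < k n := fun n hn => Nat.ordCompl_pos _ (by have := hn.1; omega)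
  have hqp : ∀ n ∈ S, (q n).Prime := fun n hn => (hq n hn.1).1
  have hQpos : ∀ n ∈ S, 0 < q n ^ hh n := fun n hn => pow_pos (hqp n hn).pos _
  have hh1 : ∀ n ∈ S, 1 ≤ hh n := fun n hn =>
    ((hqp n hn).dvd_iff_one_le_factorization (by have := hn.1; omega)).1 (hq n hn.1).2.1
  have hle : ∀ n ∈ S, n ≤ (q n ^ hh n) ^ lam := fun n hn =>
    (hq n hn.1).2.2.trans (Nat.pow_le_pow_right (hQpos n hn) hn.2.2)
  have hnell : ∀ n ∈ S, n ≤ ellu u n := fun n hn =>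
    Nat.le_of_dvd (h.ellu_pos (by have := hn.1; omega) hn.2.1) (Nat.dvd_lcm_left _ _)
  have hT0 : ∀ n, 0 ≤ T n := fun n => by positivity
  have hksum : Summable (fun k : ℕ => (k : ℝ) ^ (-(1 + 1 / (48 * lam)) : ℝ)) :=
    Real.summable_nat_rpow.2 (by
      have : (0 : ℝ) < 1 / (48 * lam) := by positivity
      linarith)
  -- part 1
  have s1 : Summable ((S ∩ {n | 2 ≤ hh n}).indicator T) := by
    have f1 : Summable (fun q : ℕ => (q : ℝ) ^ (-(5 / 4) : ℝ)) :=
      Real.summable_nat_rpow.2 (by norm_num)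
    have f2 : Summable (fun i : ℕ => ((2 : ℝ) ^ (-(1 / 4) : ℝ)) ^ i) :=
      summable_geometric_of_lt_one (by positivity)
        (Real.rpow_lt_one_of_one_lt_of_neg (by norm_num) (by norm_num))
    have F := (f1.mul_of_nonneg f2 (fun _ => by positivity) (fun _ => by positivity)).mul_of_nonneg
      hksum (fun _ => by positivity) (fun _ => by positivity)
    refine summ_inj F (φ := fun n => ((q n, hh n), k n)) ?_ ?_
    · intro a ha b hb hab
      simp only [Prod.mk.injEq] at hab
      rw [hnk a, hnk b, hab.1.1, hab.1.2, hab.2]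
    · rintro n ⟨hn, hn2⟩
      refine ⟨hT0 n, ?_⟩
      refine (term_le_A hlam (hkpos n hn) (hQpos n hn) (hnk n) (hle n hn) (hnell n hn)).trans ?_
      simp only
      gcongr
      have hq2 : (2 : ℝ) ≤ q n := by exact_mod_cast (hqp n hn).two_le
      set Q : ℝ := (q n : ℝ) ^ hh n with hQ
      have hQ1 : (1 : ℝ) ≤ Q := one_le_pow₀ (by linarith)
      have a1 : (q n : ℝ) ^ 2 ≤ Q := pow_le_pow_right₀ (by linarith) hn2
      have a2 : (2 : ℝ) ^ hh n ≤ Q := by rw [hQ]; gcongr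
      calc (((q n ^ hh n : ℕ) : ℝ)) ^ (-(23 / 24) : ℝ) = Q ^ (-(23 / 24) : ℝ) := by
            rw [hQ]; push_cast; rfl
        _ ≤ Q ^ (-(7 / 8) : ℝ) := Real.rpow_le_rpow_of_exponent_le hQ1 (by norm_num)
        _ = Q ^ (-(5 / 8) : ℝ) * Q ^ (-(1 / 4) : ℝ) := by
            rw [← Real.rpow_add (by linarith)]; norm_num
        _ ≤ ((q n : ℝ) ^ 2) ^ (-(5 / 8) : ℝ) * ((2 : ℝ) ^ hh n) ^ (-(1 / 4) : ℝ) := by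
            have b1 := Real.rpow_le_rpow_of_nonpos (z := -(5 / 8)) (by positivity) a1 (by norm_num)
            have b2 := Real.rpow_le_rpow_of_nonpos (z := -(1 / 4)) (by positivity) a2 (by norm_num)
            gcongr
        _ = _ := by
            rw [← Real.rpow_natCast, ← Real.rpow_mul (by positivity), ← Real.rpow_natCast,
              ← Real.rpow_mul (by positivity), ← Real.rpow_natCast, ← Real.rpow_mul (by positivity),
              mul_comm (hh n : ℝ)]
            norm_num
  -- part 2
  have s2 : Summable ((S ∩ {n | hh n = 1 ∧ (q n : ℤ) ∣ a₁ ^ 2 + 4 * a₂}).indicator T) := by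
    have f1 : Summable (fun p : ℕ => if p ∈ (a₁ ^ 2 + 4 * a₂).natAbs.divisors then (1 : ℝ) else 0) :=
      summable_of_ne_finset_zero (s := (a₁ ^ 2 + 4 * a₂).natAbs.divisors)
        (fun b hb => by simp only [hb, if_false])
    have F := f1.mul_of_nonneg hksum
      (fun p => by simp only [Pi.zero_apply]; split_ifs <;> norm_num) (fun _ => by positivity)
    refine summ_inj F (φ := fun n => (q n, k n)) ?_ ?_
    · rintro a ⟨_, ha, _⟩ b ⟨_, hb, _⟩ hab
      simp only [Prod.mk.injEq] at hab
      rw [hnk a, hnk b, ha, hb, hab.1, hab.2]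
    · rintro n ⟨hn, hn1, hn2⟩
      refine ⟨hT0 n, ?_⟩
      refine (term_le_A hlam (hkpos n hn) (hQpos n hn) (hnk n) (hle n hn) (hnell n hn)).trans ?_
      have hm : q n ∈ (a₁ ^ 2 + 4 * a₂).natAbs.divisors := by
        rw [Nat.mem_divisors]
        exact ⟨Int.natCast_dvd.1 hn2, by simpa using hΔ⟩
      simp only [hm, if_true]
      gcongr
      have : (1 : ℝ) ≤ ((q n ^ hh n : ℕ) : ℝ) := by exact_mod_cast hQpos n hn
      exact Real.rpow_le_one_of_one_le_of_nonpos this (by norm_num)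
  -- part 3
  have s3 : Summable ((S ∩ {n | hh n = 1 ∧ ¬ (q n : ℤ) ∣ a₁ ^ 2 + 4 * a₂}).indicator T) := by
    have F := (h.summable_pairs ha₂ hne).mul_of_nonneg hksum
      (fun p => Set.indicator_nonneg (fun _ _ => by positivity) _) (fun _ => by positivity)
    refine summ_inj F (φ := fun n => ((q n, Nat.gcd (k n) (zu u (q n))),
      k n / Nat.gcd (k n) (zu u (q n)))) ?_ ?_
    · rintro a ⟨_, ha, _⟩ b ⟨_, hb, _⟩ hab
      simp only [Prod.mk.injEq] at hab
      obtain ⟨⟨h1, h2⟩, h3⟩ := hab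
      have e : k a = k b := by
        rw [← Nat.div_mul_cancel (Nat.gcd_dvd_left (k a) (zu u (q a))),
          ← Nat.div_mul_cancel (Nat.gcd_dvd_left (k b) (zu u (q b))), h3, h2]
      rw [hnk a, hnk b, ha, hb, h1, e]
    · rintro n ⟨hn, hn1, hn2⟩
      refine ⟨hT0 n, ?_⟩
      have hnq : n = q n * k n := by
        have := hnk n
        rwa [hn1, pow_one] at this
      have hcn : IsCoprime ((q n * k n : ℕ) : ℤ) a₂ := hnq ▸ hn.2.1
      have hcq : IsCoprime (q n : ℤ) a₂ :=
        hn.2.1.of_isCoprime_of_dvd_left (Int.natCast_dvd_natCast.2 (hq n hn.1).2.1)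
      have hz := (h.zu_spec (hqp n hn).pos hcq).1
      have hqk : ¬ q n ∣ k n := Nat.not_dvd_ordCompl (hqp n hn) (by have := hn.1; omega)
      have hg := Nat.gcd_pos_of_pos_left (zu u (q n)) (hkpos n hn)
      have hL := h.ell_lower (hqp n hn) (hkpos n hn) hcn hqk hn2
      rw [← hnq] at hL
      have hle' := hle n hn
      rw [hn1, pow_one] at hle'
      have hm : (q n, Nat.gcd (k n) (zu u (q n))) ∈ {x : ℕ × ℕ | (x.1.Prime ∧
          IsCoprime (x.1 : ℤ) a₂) ∧ x.2 ∈ (zu u x.1).divisors} :=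
        ⟨⟨hqp n hn, hcq⟩, Nat.mem_divisors.2 ⟨Nat.gcd_dvd_right _ _, hz.ne'⟩⟩
      simp only [Set.indicator_of_mem hm]
      exact term_le_B hlam (Nat.div_pos (Nat.le_of_dvd (hkpos n hn) (Nat.gcd_dvd_left _ _)) hg) hg
        (hqp n hn).pos hz (Nat.mul_div_cancel' (Nat.gcd_dvd_left _ _)).symm hnq hle' hL
  refine Summable.of_nonneg_of_le (fun n => Set.indicator_nonneg (fun n _ => hT0 n) n) (fun n => ?_)
    ((s1.add s2).add s3)
  have p1 := Set.indicator_nonneg (s := (S ∩ {n | 2 ≤ hh n})) (fun n _ => hT0 n) n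
  have p2 := Set.indicator_nonneg (s := (S ∩ {n | hh n = 1 ∧ (q n : ℤ) ∣ a₁ ^ 2 + 4 * a₂}))
    (fun n _ => hT0 n) n
  have p3 := Set.indicator_nonneg (s := (S ∩ {n | hh n = 1 ∧ ¬ (q n : ℤ) ∣ a₁ ^ 2 + 4 * a₂}))
    (fun n _ => hT0 n) n
  by_cases hn : n ∈ S
  · rw [Set.indicator_of_mem hn]
    have := hh1 n hn
    rcases this.lt_or_eq with h2 | h2
    · rw [Set.indicator_of_mem (s := S ∩ {n | 2 ≤ hh n}) ⟨hn, h2⟩]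
      linarith
    · by_cases hd : (q n : ℤ) ∣ a₁ ^ 2 + 4 * a₂
      · rw [Set.indicator_of_mem
          (s := (S ∩ {n | hh n = 1 ∧ (q n : ℤ) ∣ a₁ ^ 2 + 4 * a₂})) ⟨hn, h2.symm, hd⟩]
        linarith
      · rw [Set.indicator_of_mem
          (s := (S ∩ {n | hh n = 1 ∧ ¬ (q n : ℤ) ∣ a₁ ^ 2 + 4 * a₂})) ⟨hn, h2.symm, hd⟩]
        linarith
  · rw [Set.indicator_of_notMem hn]
    linarith

/-- The weight. -/
noncomputable def W (a₂ : ℤ) (u : ℕ → ℤ) (lam n : ℕ) : ℝ :=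
  if 0 < n ∧ Int.gcd (n : ℤ) a₂ = 1 then rho lam n / (Nat.totient (ellu u n) : ℝ) else 0

lemma W_nonneg (lam n : ℕ) : 0 ≤ W a₂ u lam n := by
  unfold W
  split_ifs
  · exact div_nonneg (rho_nonneg _ _) (by positivity)
  · exact le_rfl

lemma summable_W (h : IsLuc a₁ a₂ u) (ha₂ : a₂ ≠ 0) (hΔ : a₁ ^ 2 + 4 * a₂ ≠ 0)
    (hne : ∀ n : ℕ, 0 < n → u n ≠ 0) (lam : ℕ) (hlam : 0 < lam) :
    ∃ c : ℝ, 0 < c ∧ Summable (fun n : ℕ => (n : ℝ) ^ c * W a₂ u lam n) := by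
  have hl0 : (0 : ℝ) < lam := by exact_mod_cast hlam
  set c : ℝ := 1 / (96 * lam) with hc
  have hc0 : 0 < c := by positivity
  obtain ⟨C, hC, hlog⟩ := log_pow_mul_le lam c hc0
  refine ⟨c, hc0, Summable.of_nonneg_of_le (fun n => mul_nonneg (by positivity) (W_nonneg _ _))
    (fun n => ?_) ((h.summable_main ha₂ hΔ hne lam hlam).mul_left C)⟩
  have hind0 : 0 ≤ ({n : ℕ | 1 < n ∧ IsCoprime (n : ℤ) a₂ ∧ n.primeFactors.card ≤ lam}).indicator
      (fun n => (n : ℝ) ^ (1 / (48 * lam) : ℝ) / (ellu u n : ℝ)) n :=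
    Set.indicator_nonneg (fun n _ => by positivity) _
  by_cases hz : W a₂ u lam n = 0
  · rw [hz, mul_zero]; positivity
  unfold W at hz
  split_ifs at hz with hcond
  · have hr : rho lam n ≠ 0 := fun h0 => hz (by rw [h0, zero_div])
    have hn0 := hcond.1
    have hcop := Int.isCoprime_iff_gcd_eq_one.2 hcond.2
    have hn1 : 1 < n := by
      rcases (show 1 ≤ n from hn0).lt_or_eq with h1 | h1
      · exact h1
      · exact absurd (h1 ▸ rho_one lam hlam) hr
    have hcard : n.primeFactors.card ≤ lam := by
      by_contra hcon
      exact hr (rho_eq_zero lam n (not_le.1 hcon))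
    rw [Set.indicator_of_mem (by exact ⟨hn1, hcop, hcard⟩)]
    unfold W
    rw [if_pos hcond]
    have hL := h.ellu_pos hn0 hcop
    have hL0 : (0 : ℝ) < ellu u n := by exact_mod_cast hL
    have hphi : (0 : ℝ) < Nat.totient (ellu u n) := by exact_mod_cast Nat.totient_pos.2 hL
    have hnr : (0 : ℝ) < n := by exact_mod_cast hn0
    have h1 := le_totient_mul _ hL
    have h2 : Real.log (ellu u n) ≤ 3 * Real.log n := by
      have : (ellu u n : ℝ) ≤ (n : ℝ) ^ 3 := by exact_mod_cast h.ellu_le hn0 hcop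
      calc _ ≤ Real.log ((n : ℝ) ^ 3) := Real.log_le_log hL0 this
        _ = _ := by rw [Real.log_pow]; norm_num
    have hlogn : 0 ≤ Real.log n := Real.log_nonneg (by exact_mod_cast hn0)
    have h3 : rho lam n / (Nat.totient (ellu u n) : ℝ) ≤ C * (n : ℝ) ^ c / ellu u n := by
      rw [div_le_div_iff₀ hphi hL0]
      calc rho lam n * ellu u n
          ≤ Real.log n ^ lam * (Nat.totient (ellu u n) * (1 + 6 * Real.log n)) := by
            have := rho_le lam n (by omega)
            have h4 : (ellu u n : ℝ) ≤ Nat.totient (ellu u n) * (1 + 6 * Real.log n) :=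
              h1.trans (mul_le_mul_of_nonneg_left (by linarith) hphi.le)
            gcongr
        _ = Real.log n ^ lam * (1 + 6 * Real.log n) * Nat.totient (ellu u n) := by ring
        _ ≤ _ := by
            have := hlog n hn0
            gcongr
    calc _ ≤ (n : ℝ) ^ c * (C * (n : ℝ) ^ c / ellu u n) := by gcongr
      _ = C * (((n : ℝ) ^ c * (n : ℝ) ^ c) / ellu u n) := by ring
      _ = _ := by
          rw [← Real.rpow_add hnr]
          congr 4
          rw [hc]; field_simp; norm_num
  · exact absurd rfl hz

end IsLuc

end

section

open scoped BigOperators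

namespace IsLuc
variable {a₁ a₂ : ℤ} {u : ℕ → ℤ}

lemma primePiMod_le {x : ℝ} (hx : 0 ≤ x) {b : ℕ} (hb : 0 < b) :
    (primePiMod x b 1 : ℝ) ≤ x / b := by
  have h1 : primePiMod x b 1 ≤ ⌊x⌋₊ / b := by
    rw [← Nat.Ioc_filter_dvd_card_eq_div, primePiMod]
    apply Finset.card_le_card_of_injOn (fun p => p - 1)
    · intro p hp
      simp only [primesUpTo, Finset.coe_filter, Finset.mem_filter, Finset.mem_range,
        Set.mem_ofPred_eq, Finset.mem_Ioc] at hp ⊢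
      obtain ⟨⟨h1, h2⟩, h3⟩ := hp
      have := h2.two_le
      refine ⟨⟨by omega, by omega⟩, ?_⟩
      exact (Nat.modEq_iff_dvd' (by omega)).1 (Eq.symm h3)
    · intro p hp r hr hpr
      simp only [primesUpTo, Finset.coe_filter, Finset.mem_filter,
        Set.mem_ofPred_eq] at hp hr
      have := hp.1.2.two_le
      have := hr.1.2.two_le
      simp only at hpr
      omega
  calc (primePiMod x b 1 : ℝ) ≤ ((⌊x⌋₊ / b : ℕ) : ℝ) := by exact_mod_cast h1
    _ ≤ (⌊x⌋₊ : ℝ) / b := Nat.cast_div_le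
    _ ≤ x / b := by gcongr; exact Nat.floor_le hx

lemma primePi_le {x : ℝ} (hx : 0 ≤ x) : (primePi x : ℝ) ≤ x := by
  have h1 : primePi x ≤ ⌊x⌋₊ := by
    calc primePi x ≤ (Finset.Icc 1 ⌊x⌋₊).card := by
          apply Finset.card_le_card
          intro p hp
          simp only [primesUpTo, Finset.mem_filter, Finset.mem_range] at hp
          have := hp.2.one_lt
          rw [Finset.mem_Icc]
          omega
      _ = _ := by simp
  calc (primePi x : ℝ) ≤ (⌊x⌋₊ : ℝ) := by exact_mod_cast h1
    _ ≤ x := Nat.floor_le hx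

/-- Terms of the expanded sum. -/
noncomputable def RR (a₂ : ℤ) (u : ℕ → ℤ) (lam : ℕ) (x : ℝ) (m : ℕ) : ℝ :=
  if 0 < m ∧ Int.gcd (m : ℤ) a₂ = 1 then rho lam m * (primePiMod x (ellu u m) 1 : ℝ) else 0

lemma sum_expand (h : IsLuc a₁ a₂ u) (hc : IsCoprime a₁ a₂) (lam : ℕ) (x : ℝ) :
    ∑ p ∈ primesUpTo x, Real.log (gu u (p - 1) : ℝ) ^ lam =
      ∑ m ∈ Finset.range (⌊x⌋₊ + 1), RR a₂ u lam x m := by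
  classical
  have e1 : ∀ p ∈ primesUpTo x, Real.log (gu u (p - 1) : ℝ) ^ lam =
      ∑ m ∈ Finset.range (⌊x⌋₊ + 1), if 0 < m ∧ Int.gcd (m : ℤ) a₂ = 1 then
        (if p % ellu u m = 1 % ellu u m then rho lam m else 0) else 0 := by
    intro p hp
    simp only [primesUpTo, Finset.mem_filter, Finset.mem_range] at hp
    have hp2 := hp.2.two_le
    have hp1 : 0 < p - 1 := by omega
    have hg : gu u (p - 1) ∣ p - 1 := by
      have := Int.gcd_dvd_left (a := ((p - 1 : ℕ) : ℤ)) (b := u (p - 1))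
      exact Int.natCast_dvd_natCast.1 this
    have hg0 : 0 < gu u (p - 1) := Nat.pos_of_dvd_of_pos hg hp1
    have hgle := Nat.le_of_dvd hp1 hg
    rw [← rho_sum lam _ hg0.ne']
    have hsub : (gu u (p - 1)).divisors ⊆ Finset.range (⌊x⌋₊ + 1) := by
      intro m hm
      have := Nat.divisor_le hm
      rw [Finset.mem_range]
      omega
    rw [← Finset.sum_subset hsub (f := fun m : ℕ => if 0 < m ∧ Int.gcd (m : ℤ) a₂ = 1 then
        (if p % ellu u m = 1 % ellu u m then rho lam m else 0) else 0)]
    · apply Finset.sum_congr rfl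
      intro m hm
      have hm0 := Nat.pos_of_mem_divisors hm
      obtain ⟨h1, h2⟩ := (h.dvd_gu_iff hc hm0 hp1).1 (Nat.dvd_of_mem_divisors hm)
      rw [if_pos ⟨hm0, Int.isCoprime_iff_gcd_eq_one.1 h1⟩, if_pos]
      exact ((Nat.modEq_iff_dvd' (by omega)).2 h2).symm
    · intro m _ hm
      by_contra hcon
      apply hm
      simp only [ite_eq_right_iff, not_forall] at hcon
      obtain ⟨⟨hm0, hmc⟩, hmod, _⟩ := hcon
      rw [Nat.mem_divisors]
      refine ⟨(h.dvd_gu_iff hc hm0 hp1).2 ⟨Int.isCoprime_iff_gcd_eq_one.2 hmc, ?_⟩, hg0.ne'⟩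
      exact (Nat.modEq_iff_dvd' (by omega)).1 (Eq.symm hmod)
  rw [Finset.sum_congr rfl e1, Finset.sum_comm]
  apply Finset.sum_congr rfl
  intro m _
  unfold RR
  split_ifs with hm
  · rw [← Finset.sum_filter, Finset.sum_const, nsmul_eq_mul, mul_comm, primePiMod]
  · simp

lemma RR_nonneg (lam : ℕ) (x : ℝ) (m : ℕ) : 0 ≤ RR a₂ u lam x m := by
  unfold RR
  split_ifs
  · exact mul_nonneg (rho_nonneg _ _) (by positivity)
  · exact le_rfl

lemma RR_le (h : IsLuc a₁ a₂ u) (lam : ℕ) {x : ℝ} (hx : 0 ≤ x) (m : ℕ) :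
    RR a₂ u lam x m ≤ x * W a₂ u lam m := by
  unfold RR W
  split_ifs with hm
  · have hL := h.ellu_pos hm.1 (Int.isCoprime_iff_gcd_eq_one.2 hm.2)
    have hphi : (0 : ℝ) < Nat.totient (ellu u m) := by exact_mod_cast Nat.totient_pos.2 hL
    have h1 := primePiMod_le hx hL
    have h2 : (Nat.totient (ellu u m) : ℝ) ≤ ellu u m := by exact_mod_cast Nat.totient_le _
    have h3 : (primePiMod x (ellu u m) 1 : ℝ) ≤ x / Nat.totient (ellu u m) :=
      h1.trans (by gcongr)
    calc _ ≤ rho lam m * (x / Nat.totient (ellu u m)) :=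
          mul_le_mul_of_nonneg_left h3 (rho_nonneg _ _)
      _ = _ := by ring
  · simp

lemma tail_le {w : ℕ → ℝ} (hw : ∀ n, 0 ≤ w n) {c : ℝ} (hc : 0 < c)
    (hs : Summable (fun n : ℕ => (n : ℝ) ^ c * w n)) (M : ℕ) {y : ℝ} (hy : 0 < y)
    (hyM : y ≤ M + 1) (hws : Summable w) :
    ∑' i, w (i + (M + 1)) ≤ y ^ (-c) * ∑' n : ℕ, (n : ℝ) ^ c * w n := by
  have hs' := (summable_nat_add_iff (M + 1)).2 hs
  have h1 : ∑' i : ℕ, ((i + (M + 1) : ℕ) : ℝ) ^ c * w (i + (M + 1)) ≤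
      ∑' n : ℕ, (n : ℝ) ^ c * w n := by
    rw [← hs.sum_add_tsum_nat_add (M + 1)]
    have : 0 ≤ ∑ i ∈ Finset.range (M + 1), (i : ℝ) ^ c * w i :=
      Finset.sum_nonneg fun i _ => mul_nonneg (by positivity) (hw i)
    linarith
  calc ∑' i, w (i + (M + 1)) ≤
        ∑' i : ℕ, y ^ (-c) * (((i + (M + 1) : ℕ) : ℝ) ^ c * w (i + (M + 1))) := by
        refine Summable.tsum_le_tsum (fun i => ?_) ((summable_nat_add_iff (M + 1)).2 hws)
          (hs'.mul_left _)
        rw [← mul_assoc]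
        refine le_mul_of_one_le_left (hw _) ?_
        rw [Real.rpow_neg hy.le, ← div_eq_inv_mul, one_le_div (by positivity)]
        apply Real.rpow_le_rpow hy.le _ hc.le
        push_cast
        have : (0 : ℝ) ≤ i := by positivity
        linarith
    _ = y ^ (-c) * ∑' i : ℕ, (((i + (M + 1) : ℕ) : ℝ) ^ c * w (i + (M + 1))) := tsum_mul_left
    _ ≤ _ := by gcongr

lemma large_x (h : IsLuc a₁ a₂ u) (hc : IsCoprime a₁ a₂) (lam : ℕ) {c : ℝ} (hc0 : 0 < c)
    (hs : Summable (fun n : ℕ => (n : ℝ) ^ c * W a₂ u lam n)) (hws : Summable (W a₂ u lam))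
    (A : ℕ) : ∃ C x₀ : ℝ, 0 ≤ C ∧ ∀ x : ℝ, x₀ ≤ x → 1 ≤ Real.log x ∧
      |(∑ p ∈ primesUpTo x, Real.log (gu u (p - 1) : ℝ) ^ lam) -
        (∑' n, W a₂ u lam n) * (primePi x : ℝ)| ≤ C * x / Real.log x ^ A := by
  obtain ⟨B, hB⟩ := exists_nat_ge ((A : ℝ) / c)
  have hBA : (A : ℝ) ≤ B * c := by rwa [div_le_iff₀ hc0] at hB
  obtain ⟨C1, x1, hC1, hSW⟩ := siegel_walfisz (A + 2 * B) (3 * B)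
  obtain ⟨C0, hC0, hrho⟩ := log_pow_mul_le lam 1 one_pos
  set K := ∑' n : ℕ, (n : ℝ) ^ c * W a₂ u lam n with hK
  have hK0 : 0 ≤ K := tsum_nonneg fun n => mul_nonneg (by positivity) (W_nonneg _ _)
  have ev := (log_pow_le_eventually B 1 one_pos).and
    ((Filter.eventually_ge_atTop x1).and ((Filter.eventually_ge_atTop (Real.exp 1))))
  obtain ⟨x₀, hx₀⟩ := Filter.eventually_atTop.1 ev
  refine ⟨C0 * C1 + 2 * K, x₀, by positivity, fun x hx => ?_⟩
  obtain ⟨hBx, hx1, hxe⟩ := hx₀ x hx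
  have hxpos : 0 < x := (Real.exp_pos 1).trans_le hxe
  have hL1 : 1 ≤ Real.log x := (Real.le_log_iff_exp_le hxpos).2 hxe
  refine ⟨hL1, ?_⟩
  set L := Real.log x with hL
  have hL0 : 0 < L := by linarith
  set y := L ^ B with hy
  have hy1 : 1 ≤ y := one_le_pow₀ hL1
  have hyx : y ≤ x := by linarith
  set M := ⌊y⌋₊ with hM
  have hMy : (M : ℝ) ≤ y := Nat.floor_le (by linarith)
  have hyM : y ≤ M + 1 := (Nat.lt_floor_add_one y).le
  have hMN : M + 1 ≤ ⌊x⌋₊ + 1 := Nat.succ_le_succ (Nat.floor_mono hyx)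
  obtain ⟨D, hD⟩ := Nat.exists_eq_add_of_le hMN
  rw [h.sum_expand hc, hD, Finset.sum_range_add]
  set tail := ∑' i, W a₂ u lam (i + (M + 1)) with htail
  have htail_le : tail ≤ y ^ (-c) * K :=
    tail_le (fun n => W_nonneg _ _) hc0 hs M (by linarith) hyM hws
  have htail0 : 0 ≤ tail := tsum_nonneg fun n => W_nonneg _ _
  rw [← hws.sum_add_tsum_nat_add (M + 1)]
  -- middle range
  have hmid : ∑ i ∈ Finset.range D, RR a₂ u lam x (M + 1 + i) ≤ x * tail := by
    calc _ ≤ ∑ i ∈ Finset.range D, x * W a₂ u lam (i + (M + 1)) :=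
          Finset.sum_le_sum fun i _ => by
            rw [add_comm (M + 1) i]
            exact h.RR_le lam hxpos.le _
      _ = x * ∑ i ∈ Finset.range D, W a₂ u lam (i + (M + 1)) := by rw [Finset.mul_sum]
      _ ≤ _ := by
          gcongr
          exact ((summable_nat_add_iff (M + 1)).2 hws).sum_le_tsum _ (fun n _ => W_nonneg _ _)
  have hmid0 : 0 ≤ ∑ i ∈ Finset.range D, RR a₂ u lam x (M + 1 + i) :=
    Finset.sum_nonneg fun i _ => RR_nonneg _ _ _
  have hpi := primePi_le hxpos.le
  have hpi0 : (0 : ℝ) ≤ primePi x := by positivity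
  -- main range
  have hmain : |∑ m ∈ Finset.range (M + 1), (RR a₂ u lam x m - W a₂ u lam m * primePi x)| ≤
      C0 * C1 * x / L ^ A := by
    have hterm : ∀ m ∈ Finset.range (M + 1), m ≠ 0 →
        |RR a₂ u lam x m - W a₂ u lam m * primePi x| ≤ C0 * y * (C1 * x / L ^ (A + 2 * B)) := by
      intro m hm hm0
      have hmM : (m : ℝ) ≤ M := by
        have := Finset.mem_range.1 hm
        exact_mod_cast (by omega : m ≤ M)
      have hmpos : 0 < m := Nat.pos_of_ne_zero hm0
      unfold RR W
      split_ifs with hcond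
      · have hcop := Int.isCoprime_iff_gcd_eq_one.2 hcond.2
        have hell : ((ellu u m : ℕ) : ℝ) ≤ L ^ (3 * B) := by
          calc ((ellu u m : ℕ) : ℝ) ≤ (m : ℝ) ^ 3 := by exact_mod_cast h.ellu_le hmpos hcop
            _ ≤ y ^ 3 := by gcongr; exact hmM.trans hMy
            _ = _ := by rw [hy, ← pow_mul, mul_comm]
        have h1 := hSW x hx1 _ (h.ellu_pos hmpos hcop) hell
        have e : rho lam m * (primePiMod x (ellu u m) 1 : ℝ) -
            rho lam m / (Nat.totient (ellu u m) : ℝ) * primePi x =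
            rho lam m * chebErr x (ellu u m) 1 := by
          rw [chebErr]; ring
        have hr : rho lam m ≤ C0 * y := by
          have hlog : 0 ≤ Real.log m := Real.log_nonneg (by exact_mod_cast hmpos)
          calc rho lam m ≤ Real.log m ^ lam := rho_le lam m hm0
            _ ≤ Real.log m ^ lam * (1 + 6 * Real.log m) :=
                le_mul_of_one_le_right (by positivity) (by linarith)
            _ ≤ C0 * (m : ℝ) ^ (1 : ℝ) := hrho m hmpos
            _ ≤ C0 * y := by rw [Real.rpow_one]; gcongr; exact hmM.trans hMy
        rw [e, abs_mul, abs_of_nonneg (rho_nonneg _ _)]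
        gcongr
      · simp only [zero_mul, sub_zero, abs_zero]
        positivity
    have hzero : RR a₂ u lam x 0 - W a₂ u lam 0 * primePi x = 0 := by simp [RR, W]
    rw [Finset.sum_range_succ', hzero, add_zero]
    calc _ ≤ ∑ m ∈ Finset.range M, |RR a₂ u lam x (m + 1) - W a₂ u lam (m + 1) * primePi x| :=
          Finset.abs_sum_le_sum_abs _ _
      _ ≤ ∑ m ∈ Finset.range M, C0 * y * (C1 * x / L ^ (A + 2 * B)) := by
          apply Finset.sum_le_sum
          intro m hm
          apply hterm _ _ (Nat.succ_ne_zero m)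
          have := Finset.mem_range.1 hm
          rw [Finset.mem_range]; omega
      _ = M * (C0 * y * (C1 * x / L ^ (A + 2 * B))) := by simp
      _ ≤ y * (C0 * y * (C1 * x / L ^ (A + 2 * B))) := by gcongr
      _ = C0 * C1 * x / L ^ A := by
          rw [hy, pow_add, mul_comm 2 B, pow_mul]
          field_simp
  have hyc : y ^ (-c) ≤ (L ^ A)⁻¹ := by
    rw [Real.rpow_neg (by positivity)]
    apply inv_anti₀ (by positivity)
    rw [hy, ← Real.rpow_natCast, ← Real.rpow_natCast, ← Real.rpow_mul hL0.le]
    exact Real.rpow_le_rpow_of_exponent_le hL1 hBA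
  have htail2 : x * tail ≤ K * x / L ^ A := by
    calc x * tail ≤ x * ((L ^ A)⁻¹ * K) := by
          gcongr
          exact htail_le.trans (by gcongr)
      _ = _ := by ring
  rw [Finset.sum_sub_distrib, ← Finset.sum_mul] at hmain
  have hpt : tail * primePi x ≤ x * tail := by rw [mul_comm x]; gcongr
  have hpt0 : 0 ≤ tail * primePi x := by positivity
  have efin : (C0 * C1 + 2 * K) * x / L ^ A = C0 * C1 * x / L ^ A + 2 * (K * x / L ^ A) := by ring
  rw [efin]
  rw [_root_.abs_le] at hmain ⊢
  constructor
  · nlinarith [hmain.1]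
  · nlinarith [hmain.2]

end IsLuc

end

/-- For every positive integer `λ`, the series
`P_{u,λ} = Σ_{n ≥ 1, (n,a₂)=1} ρ_λ(n)/φ(ℓ(n))` converges to a positive real number `P`, and
for every `A > 0` there is `C > 0` with
`|Σ_{p ≤ x} (log g_u(p-1))^λ − P·π(x)| ≤ C·x/(log x)^A` for all `x ≥ 2`. -/
theorem statement0 (a₁ a₂ : ℤ) (hcop : IsCoprime a₁ a₂) (ha₂ : a₂ ≠ 0)
    (hΔ : a₁ ^ 2 + 4 * a₂ ≠ 0)
    (u : ℕ → ℤ) (hu0 : u 0 = 0) (hu1 : u 1 = 1)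
    (hrec : ∀ n : ℕ, u (n + 2) = a₁ * u (n + 1) + a₂ * u n)
    (hnd : ∀ α β : ℂ, α ^ 2 = (a₁ : ℂ) * α + (a₂ : ℂ) →
      β ^ 2 = (a₁ : ℂ) * β + (a₂ : ℂ) → α ≠ β → ∀ k : ℕ, 0 < k → (α / β) ^ k ≠ 1)
    (lam : ℕ) (hlam : 0 < lam) :
    ∃ P : ℝ, 0 < P ∧
      HasSum (fun n : ℕ =>
        if 0 < n ∧ Int.gcd (n : ℤ) a₂ = 1 then
          rho lam n / (Nat.totient (ellu u n) : ℝ) else 0) P ∧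
      ∀ A : ℝ, 0 < A → ∃ C : ℝ, 0 < C ∧ ∀ x : ℝ, 2 ≤ x →
        |(∑ p ∈ primesUpTo x, Real.log (gu u (p - 1) : ℝ) ^ lam) - P * (primePi x : ℝ)| ≤
          C * x / Real.log x ^ A := by
  have h : IsLuc a₁ a₂ u := ⟨hu0, hu1, hrec⟩
  have hne : ∀ n : ℕ, 0 < n → u n ≠ 0 := fun n hn => h.ne_zero ha₂ hΔ hnd hn
  obtain ⟨c, hc0, hs⟩ := h.summable_W ha₂ hΔ hne lam hlam
  have hW0 : ∀ n, 0 ≤ IsLuc.W a₂ u lam n := fun n => IsLuc.W_nonneg _ _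
  have hws : Summable (IsLuc.W a₂ u lam) := by
    refine Summable.of_nonneg_of_le hW0 (fun n => ?_) hs
    rcases Nat.eq_zero_or_pos n with rfl | hn
    · simp [IsLuc.W]
    · exact le_mul_of_one_le_left (hW0 n) (Real.one_le_rpow (by exact_mod_cast hn) hc0.le)
  set P := ∑' n, IsLuc.W a₂ u lam n with hP
  have hPpos : 0 < P := by
    obtain ⟨q, hqle, hq⟩ := Nat.exists_infinite_primes (a₂.natAbs + 1)
    have hqa : Int.gcd (q : ℤ) a₂ = 1 := by
      rw [Int.gcd, Int.natAbs_natCast]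
      exact (hq.coprime_iff_not_dvd.2 fun hd => absurd (Nat.le_of_dvd (Int.natAbs_pos.2 ha₂) hd) (by omega))
    refine hws.tsum_pos hW0 q ?_
    have hL := h.ellu_pos hq.pos (Int.isCoprime_iff_gcd_eq_one.2 hqa)
    have hphi : (0 : ℝ) < Nat.totient (ellu u q) := by exact_mod_cast Nat.totient_pos.2 hL
    rw [IsLuc.W, if_pos ⟨hq.pos, hqa⟩, rho_prime lam q hlam hq]
    have : 0 < Real.log q := Real.log_pos (by exact_mod_cast hq.one_lt)
    positivity
  refine ⟨P, hPpos, hws.hasSum, fun A hA => ?_⟩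
  obtain ⟨N, hN⟩ := exists_nat_ge A
  obtain ⟨C1, x₀, hC1, hbig⟩ := h.large_x hcop lam hc0 hs hws N
  set x1 := max x₀ 2 with hx1
  have hx12 : 2 ≤ x1 := le_max_right _ _
  set D := (∑ p ∈ primesUpTo x1, |Real.log (gu u (p - 1) : ℝ) ^ lam|) + P * (primePi x1 : ℝ) with hD
  have hD0 : 0 ≤ D := by positivity
  have hl1 : 0 < Real.log x1 := Real.log_pos (by linarith)
  refine ⟨C1 + D * Real.log x1 ^ A + 1, by positivity, fun x hx => ?_⟩
  have hlx : 0 < Real.log x := Real.log_pos (by linarith)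
  have hxp : 0 < x := by linarith
  rcases le_total x₀ x with hxx | hxx
  · obtain ⟨hL, hb⟩ := hbig x hxx
    refine hb.trans ?_
    rw [← Real.rpow_natCast]
    have : Real.log x ^ A ≤ Real.log x ^ (N : ℝ) := Real.rpow_le_rpow_of_exponent_le hL hN
    have h0 : 0 ≤ D * Real.log x1 ^ A := by positivity
    gcongr
    linarith
  · have hxx1 : x ≤ x1 := hxx.trans (le_max_left _ _)
    have hsub : primesUpTo x ⊆ primesUpTo x1 := by
      apply Finset.filter_subset_filter
      apply Finset.range_subset_range.2
      exact Nat.succ_le_succ (Nat.floor_mono hxx1)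
    have hb : |(∑ p ∈ primesUpTo x, Real.log (gu u (p - 1) : ℝ) ^ lam) - P * (primePi x : ℝ)|
        ≤ D := by
      refine (abs_sub _ _).trans (add_le_add ?_ ?_)
      · exact (Finset.abs_sum_le_sum_abs _ _).trans
          (Finset.sum_le_sum_of_subset_of_nonneg hsub fun _ _ _ => abs_nonneg _)
      · rw [abs_of_nonneg (by positivity)]
        have : primePi x ≤ primePi x1 := Finset.card_le_card hsub
        gcongr
    refine hb.trans ?_
    rw [le_div_iff₀ (by positivity)]
    have hle : Real.log x ^ A ≤ Real.log x1 ^ A := by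
      apply Real.rpow_le_rpow hlx.le _ hA.le
      exact Real.log_le_log hxp hxx1
    have hq : 0 ≤ D * Real.log x1 ^ A := by positivity
    calc D * Real.log x ^ A ≤ D * Real.log x1 ^ A := by gcongr
      _ ≤ (C1 + D * Real.log x1 ^ A + 1) * 1 := by linarith
      _ ≤ _ := by gcongr; linarith
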